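/- (Existence of an ML-solution, case μ < 1/4.) Let μ < 1/4, p > 1 and s < β₋(p − 1) + 2. Then there exist a solution U of (*) on all of Ω (U ∈ C²(Ω), U > 0, −ΔU − (μ/δ²)U + U^p/δ^s = 0 in Ω), a constant c ≥ 1 and ρ > 0 such that c⁻¹·δ(x)^{β₋} ≤ U(x) ≤ c·δ(x)^{β₋} for all x ∈ Ω_ρ. In particular U is a large sub-harmonic of L_μ which is dominated near ∂Ω by a constant multiple of a positive local super-harmonic of L_μ. -/

import Mathlib

open Set Metric MeasureTheory Real

noncomputable section

/-- Distance to the boundary of `Ω`. -/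
def bdist {N : ℕ} (Ω : Set (EuclideanSpace ℝ (Fin N))) (x : EuclideanSpace ℝ (Fin N)) : ℝ :=
  Metric.infDist x Ωᶜ

/-- The collar `Ω_ρ = {x ∈ Ω : δ(x) < ρ}`. -/
def collar {N : ℕ} (Ω : Set (EuclideanSpace ℝ (Fin N))) (ρ : ℝ) :
    Set (EuclideanSpace ℝ (Fin N)) :=
  {x ∈ Ω | bdist Ω x < ρ}

/-- The ring `Ω_{ε,ρ} = {x ∈ Ω : ε < δ(x) < ρ}`. -/
def ring' {N : ℕ} (Ω : Set (EuclideanSpace ℝ (Fin N))) (ε ρ : ℝ) :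
    Set (EuclideanSpace ℝ (Fin N)) :=
  {x ∈ Ω | ε < bdist Ω x ∧ bdist Ω x < ρ}

/-- The Laplacian. -/
def lap {N : ℕ} (f : EuclideanSpace ℝ (Fin N) → ℝ) (x : EuclideanSpace ℝ (Fin N)) : ℝ :=
  ∑ i : Fin N, fderiv ℝ (fun y => fderiv ℝ f y (EuclideanSpace.single i 1)) x
    (EuclideanSpace.single i 1)

/-- `ρ₀` is a good collar width: `δ` is `C²` on `Ω_{ρ₀}`, `|∇δ| = 1` there, `Δδ` bounded. -/
def GoodCollar {N : ℕ} (Ω : Set (EuclideanSpace ℝ (Fin N))) (ρ₀ : ℝ) : Prop :=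
  0 < ρ₀ ∧ ContDiffOn ℝ 2 (bdist Ω) (collar Ω ρ₀) ∧
    (∀ x ∈ collar Ω ρ₀, ‖gradient (bdist Ω) x‖ = 1) ∧
    ∃ M, ∀ x ∈ collar Ω ρ₀, |lap (bdist Ω) x| ≤ M

/-- A super-harmonic of `L_μ = -Δ - μ/δ²` on `G`. -/
def SuperHarm {N : ℕ} (Ω : Set (EuclideanSpace ℝ (Fin N))) (μ : ℝ)
    (G : Set (EuclideanSpace ℝ (Fin N))) (h : EuclideanSpace ℝ (Fin N) → ℝ) : Prop :=
  ContDiffOn ℝ 2 h G ∧ ∀ x ∈ G, 0 ≤ -(lap h x) - μ / (bdist Ω x) ^ 2 * h x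

/-- A sub-harmonic of `L_μ = -Δ - μ/δ²` on `G`. -/
def SubHarm {N : ℕ} (Ω : Set (EuclideanSpace ℝ (Fin N))) (μ : ℝ)
    (G : Set (EuclideanSpace ℝ (Fin N))) (h : EuclideanSpace ℝ (Fin N) → ℝ) : Prop :=
  ContDiffOn ℝ 2 h G ∧ ∀ x ∈ G, -(lap h x) - μ / (bdist Ω x) ^ 2 * h x ≤ 0

/-- A positive local super-harmonic of `L_μ`, defined on the collar `Ω_σ`. -/
def PosSuperHarmOn {N : ℕ} (Ω : Set (EuclideanSpace ℝ (Fin N))) (μ σ : ℝ)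
    (h : EuclideanSpace ℝ (Fin N) → ℝ) : Prop :=
  SuperHarm Ω μ (collar Ω σ) h ∧ ∀ x ∈ collar Ω σ, 0 < h x

/-- A sub-solution of `(*)`: `-Δu - (μ/δ²)u + u^p/δ^s = 0` on `G`. -/
def SubSol {N : ℕ} (Ω : Set (EuclideanSpace ℝ (Fin N))) (μ s p : ℝ)
    (G : Set (EuclideanSpace ℝ (Fin N))) (u : EuclideanSpace ℝ (Fin N) → ℝ) : Prop :=
  ContDiffOn ℝ 2 u G ∧ (∀ x ∈ G, 0 ≤ u x) ∧
    ∀ x ∈ G, -(lap u x) - μ / (bdist Ω x) ^ 2 * u x + (u x) ^ p / (bdist Ω x) ^ s ≤ 0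

/-- A super-solution of `(*)` on `G`. -/
def SuperSol {N : ℕ} (Ω : Set (EuclideanSpace ℝ (Fin N))) (μ s p : ℝ)
    (G : Set (EuclideanSpace ℝ (Fin N))) (u : EuclideanSpace ℝ (Fin N) → ℝ) : Prop :=
  ContDiffOn ℝ 2 u G ∧ (∀ x ∈ G, 0 < u x) ∧
    ∀ x ∈ G, 0 ≤ -(lap u x) - μ / (bdist Ω x) ^ 2 * u x + (u x) ^ p / (bdist Ω x) ^ s

/-- A regularized distance `(d, c)` on `Ω`. -/
def RegDist {N : ℕ} (Ω : Set (EuclideanSpace ℝ (Fin N))) (d : EuclideanSpace ℝ (Fin N) → ℝ)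
    (c : ℝ) : Prop :=
  1 ≤ c ∧ ContDiffOn ℝ 2 d Ω ∧ (∀ x ∈ Ω, 0 < d x) ∧
    (∀ x ∈ Ω, c⁻¹ * bdist Ω x ≤ d x ∧ d x ≤ c * bdist Ω x) ∧
    (∀ x ∈ Ω, ‖gradient d x‖ ≤ c) ∧ (∀ x ∈ Ω, |lap d x| ≤ c / d x)


open Set Metric MeasureTheory Real
noncomputable section

/-- Euclidean space, abbreviated. -/
abbrev Eu (N : ℕ) := EuclideanSpace ℝ (Fin N)

/-- Basis vector. -/
abbrev bv {N : ℕ} (i : Fin N) : Eu N := EuclideanSpace.single i 1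

open Filter Topology

lemma fderiv_apply_contDiffAt {N : ℕ} {f : Eu N → ℝ} {x : Eu N} (hf : ContDiffAt ℝ 2 f x)
    (v : Eu N) : ContDiffAt ℝ 1 (fun y => fderiv ℝ f y v) x := by
  have := hf.fderiv_right (m := 1) (by norm_num)
  exact this.clm_apply contDiffAt_const

lemma lap_congr {N : ℕ} {f g : Eu N → ℝ} {x : Eu N} (h : f =ᶠ[𝓝 x] g) : lap f x = lap g x := by
  unfold lap
  refine Finset.sum_congr rfl fun i _ => ?_
  have : (fun y => fderiv ℝ f y (bv i)) =ᶠ[𝓝 x] (fun y => fderiv ℝ g y (bv i)) := by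
    filter_upwards [h.fderiv (𝕜 := ℝ)] with y hy
    rw [hy]
  rw [this.fderiv_eq]

lemma lap_measurable {N : ℕ} (f : Eu N → ℝ) : Measurable (lap f) := by
  unfold lap
  exact Finset.measurable_sum _ fun i _ => measurable_fderiv_apply_const ℝ _ _

lemma lap_continuousAt {N : ℕ} {f : Eu N → ℝ} {x : Eu N} (hf : ContDiffAt ℝ 2 f x) :
    ContinuousAt (lap f) x := by
  unfold lap
  refine tendsto_finset_sum _ fun i _ => ?_
  have h1 := (fderiv_apply_contDiffAt hf (bv i)).fderiv_right (m := 0) (by norm_num)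
  exact (h1.clm_apply contDiffAt_const).continuousAt

lemma lap_continuousOn {N : ℕ} {f : Eu N → ℝ} {G : Set (Eu N)} (hG : IsOpen G)
    (hf : ContDiffOn ℝ 2 f G) : ContinuousOn (lap f) G := fun x hx =>
  (lap_continuousAt (hf.contDiffAt (hG.mem_nhds hx))).continuousWithinAt

lemma lap_continuous {N : ℕ} {f : Eu N → ℝ} (hf : ContDiff ℝ 2 f) : Continuous (lap f) :=
  continuous_iff_continuousAt.2 fun _ => lap_continuousAt hf.contDiffAt

lemma lap_add {N : ℕ} {f g : Eu N → ℝ} {x : Eu N} (hf : ContDiffAt ℝ 2 f x)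
    (hg : ContDiffAt ℝ 2 g x) : lap (fun y => f y + g y) x = lap f x + lap g x := by
  unfold lap
  rw [← Finset.sum_add_distrib]
  refine Finset.sum_congr rfl fun i _ => ?_
  have : (fun y => fderiv ℝ (fun y => f y + g y) y (bv i)) =ᶠ[𝓝 x]
      (fun y => fderiv ℝ f y (bv i) + fderiv ℝ g y (bv i)) := by
    filter_upwards [hf.eventually (by simp), hg.eventually (by simp)] with y h1 h2
    rw [fderiv_fun_add (h1.differentiableAt (by norm_num)) (h2.differentiableAt (by norm_num))]
    rfl
  rw [this.fderiv_eq, fderiv_fun_add ((fderiv_apply_contDiffAt hf _).differentiableAt (by norm_num))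
    ((fderiv_apply_contDiffAt hg _).differentiableAt (by norm_num))]
  rfl

lemma lap_const_mul {N : ℕ} {f : Eu N → ℝ} {x : Eu N} (c : ℝ) (hf : ContDiffAt ℝ 2 f x) :
    lap (fun y => c * f y) x = c * lap f x := by
  unfold lap
  rw [Finset.mul_sum]
  refine Finset.sum_congr rfl fun i _ => ?_
  have : (fun y => fderiv ℝ (fun y => c * f y) y (bv i)) =ᶠ[𝓝 x]
      (fun y => c * fderiv ℝ f y (bv i)) := by
    filter_upwards [hf.eventually (by simp)] with y h1
    rw [fderiv_const_mul (h1.differentiableAt (by norm_num))]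
    rfl
  rw [this.fderiv_eq, fderiv_const_mul
    ((fderiv_apply_contDiffAt hf _).differentiableAt (by norm_num))]
  rfl

lemma lap_sub {N : ℕ} {f g : Eu N → ℝ} {x : Eu N} (hf : ContDiffAt ℝ 2 f x)
    (hg : ContDiffAt ℝ 2 g x) : lap (fun y => f y - g y) x = lap f x - lap g x := by
  have : (fun y => f y - g y) = fun y => f y + (-1) * g y := by ext y; ring
  rw [this, lap_add hf (contDiffAt_const.mul hg), lap_const_mul _ hg]; ring

lemma lap_const {N : ℕ} (c : ℝ) (x : Eu N) : lap (fun _ : Eu N => c) x = 0 := by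
  unfold lap
  simp

lemma gradient_coord {N : ℕ} {f : Eu N → ℝ} {x : Eu N} :
    ‖gradient f x‖ ^ 2 = ∑ i : Fin N, (fderiv ℝ f x (bv i)) ^ 2 := by
  rw [EuclideanSpace.real_norm_sq_eq]
  refine Finset.sum_congr rfl fun i _ => ?_
  congr 1
  have h2 : inner ℝ (gradient f x) (bv i) = fderiv ℝ f x (bv i) := by
    unfold gradient
    exact InnerProductSpace.toDual_symm_apply
  rw [← h2, EuclideanSpace.inner_single_right]
  simp

lemma lap_comp {N : ℕ} {f : Eu N → ℝ} {x : Eu N} {g : ℝ → ℝ} (hf : ContDiffAt ℝ 2 f x)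
    (hg : ContDiffAt ℝ 2 g (f x)) :
    lap (fun y => g (f y)) x =
      deriv (deriv g) (f x) * ‖gradient f x‖ ^ 2 + deriv g (f x) * lap f x := by
  rw [gradient_coord]
  unfold lap
  rw [Finset.mul_sum, Finset.mul_sum, ← Finset.sum_add_distrib]
  refine Finset.sum_congr rfl fun i _ => ?_
  have hg1 : ContDiffAt ℝ 1 (deriv g) (f x) := by
    have := hg.fderiv_right (m := 1) (by norm_num)
    exact this.clm_apply contDiffAt_const
  have : (fun y => fderiv ℝ (fun y => g (f y)) y (bv i)) =ᶠ[𝓝 x]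
      (fun y => deriv g (f y) * fderiv ℝ f y (bv i)) := by
    filter_upwards [hf.eventually (by simp),
      hf.continuousAt.eventually (hg.eventually (by simp))] with y h1 h2
    have := ((h2.differentiableAt (by norm_num)).hasDerivAt).comp_hasFDerivAt y
      (h1.differentiableAt (by norm_num)).hasFDerivAt
    have h3 := this.fderiv
    simp only [Function.comp_def] at h3
    rw [h3]; simp
  have hd := ((hg1.differentiableAt (by norm_num)).hasDerivAt).comp_hasFDerivAt x
      (hf.differentiableAt (by norm_num)).hasFDerivAt
  have hd2 := ((fderiv_apply_contDiffAt hf (bv i)).differentiableAt (by norm_num)).hasFDerivAt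
  have h4 := (hd.mul hd2).fderiv
  rw [this.fderiv_eq]
  have h5 : (fun y => deriv g (f y) * fderiv ℝ f y (bv i)) =
    (deriv g ∘ f) * (fun y => fderiv ℝ f y (bv i)) := by ext; rfl
  rw [h5, h4]
  simp
  ring

lemma integrable_mul_of_tsupport {N : ℕ} {G : Set (Eu N)} (hG : IsOpen G) {h k : Eu N → ℝ}
    (hh : ContinuousOn h G) (hk : Continuous k) (hc : HasCompactSupport k) (hs : tsupport k ⊆ G) :
    Integrable (fun x => h x * k x) := by
  have h1 : Continuous (fun x => h x * k x) := by
    rw [continuous_iff_continuousAt]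
    intro x
    by_cases hx : x ∈ G
    · exact (hh.continuousAt (hG.mem_nhds hx)).mul hk.continuousAt
    · have h0 : k =ᶠ[𝓝 x] 0 := notMem_tsupport_iff_eventuallyEq.1 (fun h => hx (hs h))
      have : (fun x => h x * k x) =ᶠ[𝓝 x] fun _ => (0:ℝ) := by
        filter_upwards [h0] with y hy
        simp [hy]
      exact (continuousAt_const).congr this.symm
  exact h1.integrable_of_hasCompactSupport hc.mul_left

lemma tsupport_fderiv_apply {N : ℕ} {k : Eu N → ℝ} (v : Eu N) :
    tsupport (fun y => fderiv ℝ k y v) ⊆ tsupport k := tsupport_fderiv_apply_subset ℝ v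

lemma tsupport_lap {N : ℕ} {k : Eu N → ℝ} : tsupport (lap k) ⊆ tsupport k := by
  apply closure_minimal _ (isClosed_tsupport k)
  intro x hx
  by_contra h
  have h0 : k =ᶠ[𝓝 x] fun _ => (0:ℝ) := notMem_tsupport_iff_eventuallyEq.1 h
  exact hx (by rw [lap_congr h0, lap_const])

lemma lap_compact {N : ℕ} {k : Eu N → ℝ} (hc : HasCompactSupport k) :
    HasCompactSupport (lap k) := hc.mono' ((subset_tsupport _).trans tsupport_lap)

/-- Green's second identity with one compactly supported function. -/
lemma green {N : ℕ} {G : Set (Eu N)} (hG : IsOpen G) {h φ : Eu N → ℝ}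
    (hh : ContDiffOn ℝ 2 h G) (hφ : ContDiff ℝ 2 φ) (hc : HasCompactSupport φ)
    (hs : tsupport φ ⊆ G) : ∫ x, h x * lap φ x = ∫ x, lap h x * φ x := by
  have hd (i : Fin N) : ContDiff ℝ 1 (fun y => fderiv ℝ φ y (bv i)) :=
    (hφ.fderiv_right (m := 1) (by norm_num)).clm_apply contDiff_const
  have hdh (x) (hx : x ∈ G) : ContDiffAt ℝ 2 h x := hh.contDiffAt (hG.mem_nhds hx)
  have hh1 (i : Fin N) : ContinuousOn (fun y => fderiv ℝ h y (bv i)) G := fun x hx =>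
    (fderiv_apply_contDiffAt (hdh x hx) _).continuousAt.continuousWithinAt
  have hh2 (i : Fin N) : ContinuousOn (fun z => fderiv ℝ (fun y => fderiv ℝ h y (bv i)) z (bv i)) G :=
    fun x hx => by
      have h1 := (fderiv_apply_contDiffAt (hdh x hx) (bv i)).fderiv_right (m := 0) (by norm_num)
      exact (h1.clm_apply contDiffAt_const).continuousAt.continuousWithinAt
  have hd2 (i : Fin N) : Continuous (fun z => fderiv ℝ (fun y => fderiv ℝ φ y (bv i)) z (bv i)) :=
    ((hd i).continuous_fderiv (by norm_num)).clm_apply continuous_const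
  have s1 (i : Fin N) : tsupport (fun y => fderiv ℝ φ y (bv i)) ⊆ tsupport φ :=
    tsupport_fderiv_apply _
  have s2 (i : Fin N) : tsupport (fun z => fderiv ℝ (fun y => fderiv ℝ φ y (bv i)) z (bv i))
    ⊆ tsupport φ := (tsupport_fderiv_apply _).trans (s1 i)
  have c1 (i : Fin N) : HasCompactSupport (fun y => fderiv ℝ φ y (bv i)) :=
    hc.mono' ((subset_tsupport _).trans (s1 i))
  have c2 (i : Fin N) : HasCompactSupport
      (fun z => fderiv ℝ (fun y => fderiv ℝ φ y (bv i)) z (bv i)) :=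
    hc.mono' ((subset_tsupport _).trans (s2 i))
  have i1 (i : Fin N) := integrable_mul_of_tsupport hG hh.continuousOn (hd2 i) (c2 i)
    ((s2 i).trans hs)
  have i2 (i : Fin N) := integrable_mul_of_tsupport hG (hh1 i) (hd i).continuous (c1 i)
    ((s1 i).trans hs)
  have i3 (i : Fin N) := integrable_mul_of_tsupport hG (hh2 i) hφ.continuous hc hs
  have i4 (i : Fin N) := integrable_mul_of_tsupport hG hh.continuousOn (hd i).continuous (c1 i)
    ((s1 i).trans hs)
  have i5 (i : Fin N) := integrable_mul_of_tsupport hG (hh1 i) hφ.continuous hc hs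
  unfold lap
  simp only [Finset.mul_sum, Finset.sum_mul]
  rw [integral_finset_sum _ fun i _ => i1 i, integral_finset_sum _ fun i _ => i3 i]
  refine Finset.sum_congr rfl fun i _ => ?_
  rw [integral_mul_fderiv_eq_neg_fderiv_mul_of_integrable (i2 i) (i1 i) (i4 i)
    (fun x hx => (hdh x (hs (s1 i hx))).differentiableAt (by norm_num))
    (fun x _ => (hd i).differentiable (by norm_num) x)]
  rw [integral_mul_fderiv_eq_neg_fderiv_mul_of_integrable (i3 i) (i2 i) (i5 i)
    (fun x hx => (fderiv_apply_contDiffAt (hdh x (hs hx)) _).differentiableAt (by norm_num))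
    (fun x _ => hφ.differentiable (by norm_num) x), neg_neg]

/-- Smooth cutoff. -/
lemma exists_cutoff {N : ℕ} {G K : Set (Eu N)} (hG : IsOpen G) (hK : IsCompact K) (hKG : K ⊆ G) :
    ∃ ψ : Eu N → ℝ, ContDiff ℝ 2 ψ ∧ HasCompactSupport ψ ∧ tsupport ψ ⊆ G ∧
      (∀ x ∈ K, ∀ᶠ y in 𝓝 x, ψ y = 1) ∧ ∀ x, 0 ≤ ψ x ∧ ψ x ≤ 1 := by
  obtain ⟨L, hL, hKL, hLG⟩ := exists_compact_between hK hG hKG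
  obtain ⟨f, h1, h0, hf⟩ := exists_contMDiffMap_one_nhds_of_subset_interior
    (n := 2) (modelWithCornersSelf ℝ (Eu N)) hK.isClosed hKL
  have hsub : tsupport f ⊆ L := closure_minimal (fun x hx => by
    by_contra h; exact hx (h0 x h)) hL.isClosed
  refine ⟨f, f.contMDiff.contDiff, HasCompactSupport.of_support_subset_isCompact hL
    ((subset_tsupport _).trans hsub), hsub.trans hLG, fun x hx => ?_, fun x => hf x⟩
  exact (mem_nhdsSet_iff_forall.1 h1) x hx

lemma cutoff_mul_contDiff {N : ℕ} {G : Set (Eu N)} (hG : IsOpen G) {ψ h : Eu N → ℝ}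
    (hψ : ContDiff ℝ 2 ψ) (hs : tsupport ψ ⊆ G) (hh : ContDiffOn ℝ 2 h G) :
    ContDiff ℝ 2 (fun x => ψ x * h x) := by
  rw [contDiff_iff_contDiffAt]
  intro x
  by_cases hx : x ∈ G
  · exact hψ.contDiffAt.mul (hh.contDiffAt (hG.mem_nhds hx))
  · have h0 : ψ =ᶠ[𝓝 x] 0 := notMem_tsupport_iff_eventuallyEq.1 (fun h => hx (hs h))
    have : (fun x => ψ x * h x) =ᶠ[𝓝 x] fun _ => (0:ℝ) := by
      filter_upwards [h0] with y hy
      simp [hy]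
    exact contDiffAt_const.congr_of_eventuallyEq this

/-- Distributional solution of `-Δ u = F` on `G`. -/
def DistSol {N : ℕ} (G : Set (Eu N)) (u F : Eu N → ℝ) : Prop :=
  ∀ φ : Eu N → ℝ, ContDiff ℝ 2 φ → HasCompactSupport φ → tsupport φ ⊆ G →
    ∫ x, u x * lap φ x = -∫ x, F x * φ x

lemma DistSol.mono {N : ℕ} {G G' : Set (Eu N)} {u F : Eu N → ℝ} (h : DistSol G u F)
    (hs : G' ⊆ G) : DistSol G' u F := fun φ h1 h2 h3 => h φ h1 h2 (h3.trans hs)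

lemma DistSol.congr_ae {N : ℕ} {G : Set (Eu N)} {u F u' F' : Eu N → ℝ} (h : DistSol G u F)
    (hu : ∀ᵐ x, x ∈ G → u' x = u x) (hF : ∀ᵐ x, x ∈ G → F' x = F x) : DistSol G u' F' := by
  intro φ h1 h2 h3
  have e1 : ∫ x, u' x * lap φ x = ∫ x, u x * lap φ x := by
    apply integral_congr_ae
    filter_upwards [hu] with x hx
    by_cases hxG : x ∈ G
    · rw [hx hxG]
    · rw [image_eq_zero_of_notMem_tsupport (f := lap φ) (fun h => hxG (h3 (tsupport_lap h)))]; simp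
  have e2 : ∫ x, F' x * φ x = ∫ x, F x * φ x := by
    apply integral_congr_ae
    filter_upwards [hF] with x hx
    by_cases hxG : x ∈ G
    · rw [hx hxG]
    · rw [image_eq_zero_of_notMem_tsupport (f := φ) (fun h => hxG (h3 h))]; simp
  rw [e1, e2, h φ h1 h2 h3]

end

open Set Metric MeasureTheory Real
noncomputable section
open Filter Topology

/-- Unnormalized Gaussian. -/
def gs {N : ℕ} (z : Eu N) : ℝ := Real.exp (-(1/2) * ‖z‖ ^ 2)

lemma gs_pos {N : ℕ} (z : Eu N) : 0 < gs z := Real.exp_pos _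

lemma gs_contDiff {N : ℕ} : ContDiff ℝ 2 (gs : Eu N → ℝ) := by
  unfold gs
  exact (contDiff_const.mul (contDiff_norm_sq ℝ)).exp

lemma gauss_integrable {N : ℕ} {b : ℝ} (hb : 0 < b) :
    Integrable (fun z : Eu N => Real.exp (-b * ‖z‖ ^ 2)) := by
  have := (GaussianFourier.integrable_cexp_neg_mul_sq_norm_add (V := Eu N) (b := (b:ℂ))
    (by simpa using hb) 0 0).norm
  refine this.congr (ae_of_all _ fun z => ?_)
  simp only [Complex.norm_exp]
  congr 1
  have : (-(b:ℂ) * (‖z‖:ℂ) ^ 2 + 0 * ((inner ℝ (0 : Eu N) z : ℝ) : ℂ)) = ((-b * ‖z‖^2 : ℝ) : ℂ) := by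
    push_cast; ring
  rw [this, Complex.ofReal_re]

lemma gs_integrable {N : ℕ} : Integrable (gs : Eu N → ℝ) := gauss_integrable (by norm_num)

lemma norm_gs_integrable {N : ℕ} : Integrable (fun z : Eu N => ‖z‖ * gs z) := by
  refine (gauss_integrable (N := N) (b := 1/4) (by norm_num)).mono'
    (continuous_norm.mul gs_contDiff.continuous).aestronglyMeasurable (ae_of_all _ fun z => ?_)
  rw [Real.norm_of_nonneg (mul_nonneg (norm_nonneg _) (gs_pos z).le)]
  unfold gs
  have h1 : ‖z‖ ≤ Real.exp (‖z‖^2/4) := by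
    have := Real.add_one_le_exp (‖z‖^2/4)
    nlinarith [sq_nonneg (‖z‖/2 - 1)]
  calc ‖z‖ * Real.exp (-(1/2) * ‖z‖ ^ 2) ≤ Real.exp (‖z‖^2/4) * Real.exp (-(1/2) * ‖z‖ ^ 2) := by gcongr
    _ = _ := by rw [← Real.exp_add]; congr 1; ring

lemma gs_fderiv {N : ℕ} (z : Eu N) (i : Fin N) : fderiv ℝ gs z (bv i) = - (z i * gs z) := by
  have h1 : HasFDerivAt (fun z : Eu N => ‖z‖^2) (2 • (innerSL ℝ z)) z := (hasStrictFDerivAt_norm_sq z).hasFDerivAt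
  have h2 := ((h1.const_mul (-(1/2))).exp).fderiv
  unfold gs
  rw [h2]
  simp [EuclideanSpace.inner_single_right]
  ring

/-- gaussian mean -/
def Mg {N : ℕ} (φ : Eu N → ℝ) (x : Eu N) (r : ℝ) : ℝ := ∫ z, φ (x + r • z) * gs z

lemma exists_bound {N : ℕ} {φ : Eu N → ℝ} (hφ : Continuous φ) (hc : HasCompactSupport φ) :
    ∃ C, ∀ x, |φ x| ≤ C := hc.exists_bound_of_continuous hφ

lemma bdd_gs_integrable {N : ℕ} {φ : Eu N → ℝ} (hφ : Continuous φ) {C : ℝ} (hC : ∀ x, |φ x| ≤ C) :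
    Integrable (fun z => φ z * gs z) := by
  exact gs_integrable.bdd_mul (c := C) hφ.aestronglyMeasurable (ae_of_all _ hC)

lemma Mg_hasDerivAt {N : ℕ} {φ : Eu N → ℝ} (hφ : ContDiff ℝ 2 φ) (hc : HasCompactSupport φ)
    (x : Eu N) (r : ℝ) : HasDerivAt (Mg φ x) (r * Mg (lap φ) x r) r := by
  obtain ⟨C0, hC0⟩ := exists_bound hφ.continuous hc
  obtain ⟨C1, hC1⟩ := (hc.fderiv (𝕜 := ℝ)).exists_bound_of_continuous
    (hφ.continuous_fderiv (by norm_num))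
  have hd (r : ℝ) (z : Eu N) : HasDerivAt (fun r : ℝ => φ (x + r • z) * gs z)
      (fderiv ℝ φ (x + r • z) z * gs z) r := by
    have h1 : HasDerivAt (fun r : ℝ => x + r • z) z r := by
      simpa using ((hasDerivAt_id r).smul_const z).const_add x
    exact (((hφ.differentiable (by norm_num) _).hasFDerivAt).comp_hasDerivAt r h1).mul_const _
  have hcont (r : ℝ) : Continuous fun z : Eu N => x + r • z := by fun_prop
  have key := hasDerivAt_integral_of_dominated_loc_of_deriv_le (μ := volume) (s := univ)
    (F := fun r z => φ (x + r • z) * gs z)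
    (F' := fun r z => fderiv ℝ φ (x + r • z) z * gs z)
    (bound := fun z => C1 * (‖z‖ * gs z)) (x₀ := r) Filter.univ_mem
    (Eventually.of_forall fun r => ((hφ.continuous.comp (hcont r)).mul
      gs_contDiff.continuous).aestronglyMeasurable)
    (bdd_gs_integrable (hφ.continuous.comp (hcont r)) (fun z => hC0 _))
    ((((hφ.continuous_fderiv (by norm_num)).comp (hcont r)).clm_apply continuous_id).mul
      gs_contDiff.continuous).aestronglyMeasurable
    (ae_of_all _ fun z r _ => by
      rw [norm_mul, Real.norm_of_nonneg (gs_pos z).le, ← mul_assoc]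
      have := ((fderiv ℝ φ (x + r • z)).le_opNorm z).trans
        (mul_le_mul_of_nonneg_right (hC1 _) (norm_nonneg _))
      exact mul_le_mul_of_nonneg_right this (gs_pos z).le)
    (norm_gs_integrable.const_mul C1)
    (ae_of_all _ fun z r _ => hd r z)
  suffices e : r * Mg (lap φ) x r = ∫ z, fderiv ℝ φ (x + r • z) z * gs z by
    rw [e]; exact key.2
  -- integration by parts
  have hdi (i : Fin N) : ContDiff ℝ 1 (fun y => fderiv ℝ φ y (bv i)) :=
    (hφ.fderiv_right (m := 1) (by norm_num)).clm_apply contDiff_const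
  have hci (i : Fin N) : HasCompactSupport (fun y => fderiv ℝ φ y (bv i)) :=
    hc.mono' ((subset_tsupport _).trans (tsupport_fderiv_apply _))
  have hcii (i : Fin N) : HasCompactSupport (fun y => fderiv ℝ (fun y => fderiv ℝ φ y (bv i)) y (bv i)) :=
    (hci i).mono' ((subset_tsupport _).trans (tsupport_fderiv_apply _))
  have hcont2 (i : Fin N) : Continuous (fun y => fderiv ℝ (fun y => fderiv ℝ φ y (bv i)) y (bv i)) :=
    ((hdi i).continuous_fderiv (by norm_num)).clm_apply continuous_const
  choose D hD using fun i => exists_bound (hdi i).continuous (hci i)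
  choose D2 hD2 using fun i => exists_bound (hcont2 i) (hcii i)
  have hlin (i : Fin N) (z : Eu N) : fderiv ℝ (fun z => fderiv ℝ φ (x + r • z) (bv i)) z (bv i) =
      r * fderiv ℝ (fun y => fderiv ℝ φ y (bv i)) (x + r • z) (bv i) := by
    have h1 : HasFDerivAt (fun z : Eu N => x + r • z) (r • ContinuousLinearMap.id ℝ (Eu N)) z := by
      simpa using ((hasFDerivAt_id (𝕜 := ℝ) z).const_smul r).const_add x
    have h2 := (((hdi i).differentiable (by norm_num) (x + r • z)).hasFDerivAt).comp z h1
    have h3 := h2.fderiv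
    simp only [Function.comp_def] at h3
    rw [h3]; simp
  have hzi (i : Fin N) : Integrable (fun z : Eu N => z i * gs z * fderiv ℝ φ (x + r • z) (bv i)) := by
    have : Integrable (fun z : Eu N => z i * gs z) := norm_gs_integrable.mono
      (by have := gs_contDiff (N := N); exact (Continuous.mul (by fun_prop) this.continuous).aestronglyMeasurable)
      (ae_of_all _ fun z => by
        rw [norm_mul, norm_mul]; gcongr; simpa using PiLp.norm_apply_le z i)
    exact this.mul_bdd (c := D i) ((hdi i).continuous.comp (hcont r)).aestronglyMeasurable
      (ae_of_all _ fun z => hD i _)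
  have hsum (z : Eu N) : fderiv ℝ φ (x + r • z) z * gs z =
      ∑ i, z i * gs z * fderiv ℝ φ (x + r • z) (bv i) := by
    have : z = ∑ i, z i • (bv i : Eu N) := by
      conv_lhs => rw [← (EuclideanSpace.basisFun (Fin N) ℝ).sum_repr z]
      simp
    conv_lhs => rw [show fderiv ℝ φ (x + r • z) z = fderiv ℝ φ (x + r • z) (∑ i, z i • (bv i : Eu N)) by rw [← this]]
    rw [map_sum, Finset.sum_mul]
    refine Finset.sum_congr rfl fun i _ => ?_
    rw [map_smul]; simp; ring
  simp_rw [hsum]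
  rw [integral_finsetSum _ fun i _ => hzi i]
  unfold Mg lap
  simp_rw [Finset.sum_mul]
  have hii (i : Fin N) : Integrable (fun z => fderiv ℝ (fun y => fderiv ℝ φ y (bv i)) (x + r • z) (bv i) * gs z) := bdd_gs_integrable ((hcont2 i).comp (hcont r)) (fun z => hD2 i (x + r • z))
  rw [integral_finsetSum _ fun i _ => hii i, Finset.mul_sum]
  refine Finset.sum_congr rfl fun i _ => ?_
  have hib := integral_mul_fderiv_eq_neg_fderiv_mul_of_integrable (μ := (volume : Measure (Eu N)))
    (f := gs) (g := fun z => fderiv ℝ φ (x + r • z) (bv i)) (v := bv i)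
    (by refine (hzi i).neg.congr (ae_of_all _ fun z => ?_); simp [gs_fderiv])
    (by
      refine ((hii i).const_mul r).congr (ae_of_all _ fun z => ?_)
      simp only [hlin]; ring)
    (by
      refine (bdd_gs_integrable ((hdi i).continuous.comp (hcont r)) (fun z => hD i _)).congr
        (ae_of_all _ fun z => ?_)
      simp only [Function.comp]; ring)
    (fun z _ => gs_contDiff.differentiable (by norm_num) z)
    (fun z _ => by
      have : ContDiff ℝ 1 (fun z => fderiv ℝ φ (x + r • z) (bv i)) := (hdi i).comp (by fun_prop)
      exact this.differentiable (by norm_num) z)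
  simp_rw [hlin, gs_fderiv] at hib
  rw [← integral_const_mul]
  rw [← integral_neg] at hib
  calc _ = ∫ z, gs z * (r * fderiv ℝ (fun y => fderiv ℝ φ y (bv i)) (x + r • z) (bv i)) := by
        congr 1; ext z; ring
    _ = _ := by rw [hib]; congr 1; ext z; ring

lemma gs_int_pos {N : ℕ} : 0 < ∫ z : Eu N, gs z := by
  rw [integral_pos_iff_support_of_nonneg (fun z => (gs_pos z).le) gs_integrable]
  have : Function.support (gs : Eu N → ℝ) = univ := by
    ext z; simp [(gs_pos z).ne']
  rw [this]
  exact isOpen_univ.measure_pos volume univ_nonempty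

lemma Mg_bound {N : ℕ} {φ : Eu N → ℝ} {C : ℝ} (hC : ∀ x, |φ x| ≤ C) (x : Eu N) (r : ℝ) :
    |Mg φ x r| ≤ C * ∫ z : Eu N, gs z := by
  unfold Mg
  rw [← integral_const_mul]
  rw [← Real.norm_eq_abs]
  refine norm_integral_le_of_norm_le (gs_integrable.const_mul C) (ae_of_all _ fun z => ?_)
  rw [norm_mul, Real.norm_of_nonneg (gs_pos z).le]
  exact mul_le_mul_of_nonneg_right (hC _) (gs_pos z).le

lemma Mg_continuous {N : ℕ} {φ : Eu N → ℝ} (hφ : Continuous φ) {C : ℝ} (hC : ∀ x, |φ x| ≤ C)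
    (x : Eu N) : Continuous (Mg φ x) := by
  unfold Mg
  refine continuous_of_dominated (μ := (volume : Measure (Eu N))) (F := fun r z => φ (x + r • z) * gs z) (bound := fun z => C * gs z) (fun r => ?_) (fun r => ae_of_all _ fun z => ?_)
    (gs_integrable.const_mul C) (ae_of_all _ fun z => ?_)
  · exact (Continuous.mul (by fun_prop) gs_contDiff.continuous).aestronglyMeasurable
  · rw [norm_mul, Real.norm_of_nonneg (gs_pos z).le]
    exact mul_le_mul_of_nonneg_right (hC _) (gs_pos z).le
  · fun_prop

lemma hasDerivAt_expl (l r : ℝ) : HasDerivAt (fun r : ℝ => Real.exp (-l * r^2/2))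
    (-(l * r * Real.exp (-l * r^2/2))) r := by
  have h : HasDerivAt (fun r : ℝ => -l * r^2/2) (-l * r) r := by
    have := ((hasDerivAt_pow 2 r).const_mul (-l)).div_const 2
    exact this.congr_deriv (by simp; ring)
  exact h.exp.congr_deriv (by ring)

lemma tendsto_expl {l : ℝ} (hl : 0 < l) : Tendsto (fun r : ℝ => Real.exp (-l * r^2/2)) atTop (𝓝 0) := by
  apply Real.tendsto_exp_atBot.comp
  have h1 : Tendsto (fun r : ℝ => (l/2) * r^2) atTop atTop :=
    (tendsto_pow_atTop (by norm_num)).const_mul_atTop (by positivity)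
  have := tendsto_neg_atTop_atBot.comp h1
  refine this.congr fun r => ?_
  simp; ring

lemma expl_integrable {l : ℝ} (hl : 0 < l) :
    IntegrableOn (fun r : ℝ => r * Real.exp (-l * r^2/2)) (Ioi 0) ∧
    ∫ r in Ioi (0:ℝ), r * Real.exp (-l * r^2/2) = 1 / l := by
  have hd (r : ℝ) : HasDerivAt (fun r : ℝ => -(1/l) * Real.exp (-l * r^2/2)) (r * Real.exp (-l * r^2/2)) r := by
    have := (hasDerivAt_expl l r).const_mul (-(1/l))
    exact this.congr_deriv (by field_simp)
  have ht : Tendsto (fun r : ℝ => -(1/l) * Real.exp (-l * r^2/2)) atTop (𝓝 0) := by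
    simpa using (tendsto_expl hl).const_mul (-(1/l))
  have hi := integrableOn_Ioi_deriv_of_nonneg' (a := 0) (fun r _ => hd r)
    (fun r hr => mul_nonneg (le_of_lt hr) (Real.exp_pos _).le) ht
  refine ⟨hi, ?_⟩
  rw [integral_Ioi_of_hasDerivAt_of_tendsto' (fun r _ => hd r) hi ht]
  simp

lemma resolvent_radial {N : ℕ} {φ : Eu N → ℝ} (hφ : ContDiff ℝ 2 φ) (hc : HasCompactSupport φ)
    {l : ℝ} (hl : 0 < l) (x : Eu N) :
    ∫ r in Ioi (0:ℝ), r * Real.exp (-l * r^2/2) * (l * Mg φ x r - Mg (lap φ) x r) = φ x * ∫ z : Eu N, gs z := by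
  obtain ⟨C0, hC0⟩ := exists_bound hφ.continuous hc
  obtain ⟨C2, hC2⟩ := exists_bound (lap_continuous hφ) (lap_compact hc)
  have hd (r : ℝ) : HasDerivAt (fun r => -(Real.exp (-l * r^2/2) * Mg φ x r))
      (r * Real.exp (-l * r^2/2) * (l * Mg φ x r - Mg (lap φ) x r)) r := by
    exact ((hasDerivAt_expl l r).mul (Mg_hasDerivAt hφ hc x r)).neg.congr_deriv (by ring)
  have ht : Tendsto (fun r => -(Real.exp (-l * r^2/2) * Mg φ x r)) atTop (𝓝 0) := by
    have h1 : Tendsto (fun r => Real.exp (-l * r^2/2) * (C0 * ∫ z : Eu N, gs z)) atTop (𝓝 0) := by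
      simpa using (tendsto_expl hl).mul_const (C0 * ∫ z : Eu N, gs z)
    refine squeeze_zero_norm (fun r => ?_) h1
    rw [norm_neg, norm_mul, Real.norm_of_nonneg (Real.exp_pos _).le]
    exact mul_le_mul_of_nonneg_left (Mg_bound hC0 x r) (Real.exp_pos _).le
  have hi : IntegrableOn (fun r => r * Real.exp (-l * r^2/2) * (l * Mg φ x r - Mg (lap φ) x r)) (Ioi 0) := by
    refine (expl_integrable hl).1.mul_bdd (c := l * (C0 * ∫ z : Eu N, gs z) + C2 * ∫ z : Eu N, gs z) ?_
      (ae_of_all _ fun r => ?_)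
    · exact ((continuous_const.mul (Mg_continuous hφ.continuous hC0 x)).sub
        (Mg_continuous (lap_continuous hφ) hC2 x)).aestronglyMeasurable
    · refine (norm_sub_le _ _).trans (add_le_add ?_ (Mg_bound hC2 x r))
      rw [norm_mul, Real.norm_of_nonneg hl.le]
      exact mul_le_mul_of_nonneg_left (Mg_bound hC0 x r) hl.le
  rw [integral_Ioi_of_hasDerivAt_of_tendsto' (fun r _ => hd r) hi ht]
  simp [Mg, integral_const_mul]

/-- The resolvent kernel as a finite symmetric measure. -/
lemma exists_resolvent (N : ℕ) {l : ℝ} (hl : 0 < l) : ∃ m : Measure (Eu N), IsFiniteMeasure m ∧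
    m.map Neg.neg = m ∧ m.real univ = 1 / l ∧
    ∀ φ : Eu N → ℝ, ContDiff ℝ 2 φ → HasCompactSupport φ → ∀ x,
      ∫ y, (l * φ (x + y) - lap φ (x + y)) ∂m = φ x := by
  set c := ∫ z : Eu N, gs z with hcdef
  have hcpos : 0 < c := gs_int_pos
  let γ : Measure (Eu N) := volume.withDensity fun z => ENNReal.ofReal (c⁻¹ * gs z)
  let ν : Measure ℝ := (volume.restrict (Ioi 0)).withDensity fun r => ENNReal.ofReal (r * Real.exp (-l * r^2/2))
  have hγm : Measurable fun z : Eu N => c⁻¹ * gs z := (continuous_const.mul gs_contDiff.continuous).measurable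
  have hνm : Measurable fun r : ℝ => r * Real.exp (-l * r^2/2) := by fun_prop
  have hνnn : ∀ᵐ r ∂(volume.restrict (Ioi (0:ℝ))), 0 ≤ r * Real.exp (-l * r^2/2) := by
    filter_upwards [ae_restrict_mem measurableSet_Ioi] with r hr
    exact mul_nonneg (le_of_lt hr) (Real.exp_pos _).le
  have hγi (h : Eu N → ℝ) : ∫ z, h z ∂γ = ∫ z, (c⁻¹ * gs z) * h z := by
    rw [integral_withDensity_eq_integral_toReal_smul hγm.ennreal_ofReal (by simp)]
    congr 1; ext z
    rw [ENNReal.toReal_ofReal (mul_nonneg (inv_nonneg.2 hcpos.le) (gs_pos z).le)]; rfl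
  have hνi (h : ℝ → ℝ) : ∫ r, h r ∂ν = ∫ r in Ioi 0, (r * Real.exp (-l * r^2/2)) * h r := by
    rw [integral_withDensity_eq_integral_toReal_smul hνm.ennreal_ofReal (by simp)]
    apply integral_congr_ae
    filter_upwards [hνnn] with r hr
    rw [ENNReal.toReal_ofReal hr]; rfl
  have : IsFiniteMeasure γ := isFiniteMeasure_withDensity_ofReal
    (gs_integrable.const_mul c⁻¹).2
  have : IsFiniteMeasure ν := isFiniteMeasure_withDensity_ofReal (expl_integrable hl).1.2
  have hγ1 : γ.real univ = 1 := by
    have := hγi (fun _ => 1)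
    simp only [integral_const, smul_eq_mul, mul_one, integral_const_mul] at this
    rw [this, ← hcdef]; field_simp
  have hν1 : ν.real univ = 1 / l := by
    have := hνi (fun _ => 1)
    simp only [integral_const, smul_eq_mul, mul_one] at this
    rw [this, (expl_integrable hl).2]
  have hsm : Measurable fun p : ℝ × Eu N => p.1 • p.2 := by fun_prop
  have hγs : γ.map Neg.neg = γ := by
    ext s hs
    rw [Measure.map_apply measurable_neg hs, withDensity_apply _ hs,
      withDensity_apply _ (measurable_neg hs)]
    have := (Measure.measurePreserving_neg (volume : Measure (Eu N))).setLIntegral_comp_preimage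
      (f := fun z => ENNReal.ofReal (c⁻¹ * gs z)) hs hγm.ennreal_ofReal
    rw [← this]
    congr 1; ext z; simp [gs]
  refine ⟨(ν.prod γ).map (fun p => p.1 • p.2), inferInstance, ?_, ?_, ?_⟩
  · rw [Measure.map_map measurable_neg hsm]
    have h1 : ν.prod γ = (ν.prod γ).map (Prod.map id Neg.neg) := by
      rw [← Measure.map_prod_map _ _ measurable_id measurable_neg, hγs, Measure.map_id]
    conv_rhs => rw [h1, Measure.map_map hsm (by fun_prop)]
    congr 1
    ext1 p
    simp
  · rw [measureReal_def, Measure.map_apply hsm MeasurableSet.univ, preimage_univ, ← measureReal_def,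
      ← univ_prod_univ, measureReal_prod_prod, hγ1, hν1, mul_one]
  · intro φ hφ hc x
    obtain ⟨C0, hC0⟩ := exists_bound hφ.continuous hc
    obtain ⟨C2, hC2⟩ := exists_bound (lap_continuous hφ) (lap_compact hc)
    have hlc := lap_continuous hφ
    have hφc := hφ.continuous
    have hcont : Continuous fun y => l * φ (x + y) - lap φ (x + y) := by fun_prop
    rw [integral_map hsm.aemeasurable hcont.aestronglyMeasurable, integral_prod]
    · rw [hνi]
      have h1 := resolvent_radial hφ hc hl x
      have h2 (r : ℝ) : ∫ z, (l * φ (x + r • z) - lap φ (x + r • z)) ∂γ =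
          c⁻¹ * (l * Mg φ x r - Mg (lap φ) x r) := by
        rw [hγi]
        unfold Mg
        rw [← integral_const_mul, ← integral_sub, ← integral_const_mul]
        · congr 1; ext z; ring
        · exact (bdd_gs_integrable (φ := fun z => φ (x + r • z)) (by fun_prop) (fun z => hC0 _)).const_mul l
        · exact (bdd_gs_integrable (φ := fun z => lap φ (x + r • z)) (by fun_prop) (fun z => hC2 _))
      simp_rw [h2]
      rw [← hcdef] at h1
      have h3 : ∀ r, r * Real.exp (-l * r^2/2) * (c⁻¹ * (l * Mg φ x r - Mg (lap φ) x r)) =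
        c⁻¹ * (r * Real.exp (-l * r^2/2) * (l * Mg φ x r - Mg (lap φ) x r)) := fun r => by ring
      simp_rw [h3]
      rw [integral_const_mul, h1]; field_simp
    · refine Integrable.of_bound (C := l * C0 + C2) ?_ (ae_of_all _ fun p => ?_)
      · exact (hcont.comp (by fun_prop : Continuous fun p : ℝ × Eu N => p.1 • p.2)).aestronglyMeasurable
      · refine (norm_sub_le _ _).trans (add_le_add ?_ (hC2 _))
        rw [norm_mul, Real.norm_of_nonneg hl.le]
        exact mul_le_mul_of_nonneg_left (hC0 _) hl.le
end

open Set Metric MeasureTheory Real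
noncomputable section
open Filter Topology

lemma conv_measurable {N : ℕ} {m : Measure (Eu N)} [IsFiniteMeasure m] {g : Eu N → ℝ}
    (hg : Measurable g) : Measurable fun x => ∫ y, g (x + y) ∂m := by
  have : StronglyMeasurable (Function.uncurry fun x y : Eu N => g (x + y)) :=
    (hg.comp (by fun_prop : Measurable fun p : Eu N × Eu N => p.1 + p.2)).stronglyMeasurable
  exact this.integral_prod_right.measurable

lemma duality {N : ℕ} {m : Measure (Eu N)} [IsFiniteMeasure m] (hm : m.map Neg.neg = m)
    {g θ : Eu N → ℝ} (hg : Measurable g) {B : ℝ} (hB : ∀ x, |g x| ≤ B) (hgi : Integrable g)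
    (hθ : Continuous θ) (hc : HasCompactSupport θ) :
    ∫ x, (∫ y, g (x + y) ∂m) * θ x = ∫ x, g x * ∫ y, θ (x + y) ∂m := by
  obtain ⟨C, hC⟩ := exists_bound hθ hc
  have hθi : Integrable θ := hθ.integrable_of_hasCompactSupport hc
  have i1 : Integrable (Function.uncurry fun x y => g (x + y) * θ x) (volume.prod m) := by
    have h1 : Integrable (fun p : Eu N × Eu N => θ p.1 * (1:ℝ)) (volume.prod m) :=
      hθi.mul_prod (integrable_const (1:ℝ))
    have h2 := h1.bdd_mul (c := B) (f := fun p : Eu N × Eu N => g (p.1 + p.2))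
      (hg.comp (by fun_prop : Measurable fun p : Eu N × Eu N => p.1 + p.2)).aestronglyMeasurable
      (ae_of_all _ fun p => hB _)
    refine h2.congr (ae_of_all _ fun p => ?_)
    simp [Function.uncurry]
  have i2 : Integrable (Function.uncurry fun x y => g x * θ (x - y)) (volume.prod m) := by
    have h1 : Integrable (fun p : Eu N × Eu N => g p.1 * (1:ℝ)) (volume.prod m) :=
      hgi.mul_prod (integrable_const (1:ℝ))
    have h2 := h1.mul_bdd (c := C) (g := fun p : Eu N × Eu N => θ (p.1 - p.2))
      (hθ.measurable.comp (by fun_prop : Measurable fun p : Eu N × Eu N => p.1 - p.2)).aestronglyMeasurable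
      (ae_of_all _ fun p => hC _)
    refine h2.congr (ae_of_all _ fun p => ?_)
    simp [Function.uncurry]
  calc ∫ x, (∫ y, g (x + y) ∂m) * θ x = ∫ x, ∫ y, g (x + y) * θ x ∂m := by
        congr 1; ext x; rw [integral_mul_const]
    _ = ∫ y, (∫ x, g (x + y) * θ x) ∂m := integral_integral_swap i1
    _ = ∫ y, (∫ x, g x * θ (x - y)) ∂m := by
        congr 1; ext y
        rw [← integral_add_right_eq_self (fun x => g x * θ (x - y)) y]
        simp
    _ = ∫ x, ∫ y, g x * θ (x - y) ∂m := (integral_integral_swap i2).symm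
    _ = _ := by
        congr 1; ext x
        rw [integral_const_mul]
        congr 1
        conv_rhs => rw [← hm]
        rw [integral_map measurable_neg.aemeasurable (by
          exact (hθ.comp (by fun_prop)).aestronglyMeasurable)]
        simp [sub_eq_add_neg]

lemma compact_bound {N : ℕ} {Q : Set (Eu N)} (hQ : IsCompact Q) {h : Eu N → ℝ}
    (hh : ContinuousOn h Q) : ∃ C, 0 ≤ C ∧ ∀ x ∈ Q, |h x| ≤ C := by
  obtain ⟨C, hC⟩ := hQ.exists_bound_of_continuousOn hh
  exact ⟨max C 0, le_max_right _ _, fun x hx => (hC x hx).trans (le_max_left _ _)⟩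

/-- Solving the problem on a compact set by monotone iteration. -/
lemma penalized {N : ℕ} {Ω : Set (Eu N)} (hΩ : IsOpen Ω) {ub lb : Eu N → ℝ}
    (hub : ContDiffOn ℝ 2 ub Ω) (hlb : ContDiffOn ℝ 2 lb Ω) (mub : Measurable ub)
    (h0 : ∀ x ∈ Ω, 0 ≤ lb x) (hlt : ∀ x ∈ Ω, lb x < ub x) {f : Eu N → ℝ → ℝ}
    (mf : Measurable (Function.uncurry f)) (f0 : ∀ x, f x 0 = 0)
    (hsup : ∀ x ∈ Ω, f x (ub x) ≤ -lap ub x) (hsub : ∀ x ∈ Ω, -lap lb x ≤ f x (lb x))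
    {Q : Set (Eu N)} (hQ : IsCompact Q) (hQΩ : Q ⊆ Ω)
    (hlip : ∀ B : ℝ, ∃ L : ℝ, 0 ≤ L ∧ ∀ x ∈ Q, ∀ a ∈ Icc 0 B, ∀ b ∈ Icc 0 B,
      |f x a - f x b| ≤ L * |a - b|) :
    ∃ u : Eu N → ℝ, Measurable u ∧ (∀ x ∈ Q, lb x ≤ u x ∧ u x ≤ ub x) ∧
      DistSol (interior Q) u (fun x => f x (u x)) := by
  classical
  obtain ⟨ψ, ψc, ψs, ψΩ, ψ1, ψb⟩ := exists_cutoff hΩ hQ hQΩ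
  set φ : Eu N → ℝ := fun x => ψ x * (ub x - lb x - 1) with hφd
  have hφ : ContDiff ℝ 2 φ := cutoff_mul_contDiff hΩ ψc ψΩ ((hub.sub hlb).sub contDiffOn_const)
  have hφs : HasCompactSupport φ := ψs.mul_right
  obtain ⟨C0, hC0⟩ := exists_bound hφ.continuous hφs
  obtain ⟨C2, hC2⟩ := exists_bound (lap_continuous hφ) (lap_compact hφs)
  set V : Eu N → ℝ := fun x => 1 + φ x with hVd
  have hVc : Continuous V := continuous_const.add hφ.continuous
  have hVpos (x) : 0 < V x := by
    by_cases hx : x ∈ Ω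
    · have h1 := hlt x hx
      have h2 := ψb x
      have : V x = ψ x * (ub x - lb x) + (1 - ψ x) := by simp only [hVd, hφd]; ring
      rw [this]
      rcases h2.1.eq_or_lt with h | h
      · rw [← h]; simp
      · have := mul_pos h (sub_pos.2 h1); linarith
    · have : ψ x = 0 := image_eq_zero_of_notMem_tsupport (fun h => hx (ψΩ h))
      simp [hVd, hφd, this]
  obtain ⟨c0, hc0, hVc0⟩ : ∃ c0 > 0, ∀ x, c0 ≤ V x := by
    rcases (tsupport φ).eq_empty_or_nonempty with he | hne
    · refine ⟨1, one_pos, fun x => ?_⟩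
      have : φ x = 0 := image_eq_zero_of_notMem_tsupport (by rw [he]; simp)
      simp [hVd, this]
    · obtain ⟨x1, hx1, hmin⟩ := hφs.isCompact.exists_isMinOn hne hVc.continuousOn
      refine ⟨min 1 (V x1), lt_min one_pos (hVpos _), fun x => ?_⟩
      by_cases hx : x ∈ tsupport φ
      · exact (min_le_right _ _).trans (hmin hx)
      · have : φ x = 0 := image_eq_zero_of_notMem_tsupport hx
        simp [hVd, this]
  obtain ⟨Bu, hBu0, hBu⟩ := compact_bound hQ (hub.continuousOn.mono hQΩ)
  obtain ⟨Bl, hBl0, hBl⟩ := compact_bound hQ ((lap_continuousOn hΩ hub).mono hQΩ)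
  obtain ⟨L, hL0, hL⟩ := hlip Bu
  have hC2n : 0 ≤ C2 := (abs_nonneg _).trans (hC2 0)
  set l : ℝ := L + C2 / c0 + 1 with hl
  have hlpos : 0 < l := by positivity
  have hlL : L ≤ l := by have : 0 ≤ C2 / c0 := by positivity
                         linarith
  have hlV (x) : 0 ≤ l * V x - lap φ x := by
    have h1 : C2 / c0 ≤ l := by linarith
    have h2 : C2 ≤ l * c0 := by rwa [div_le_iff₀ hc0] at h1
    have h3 : l * c0 ≤ l * V x := mul_le_mul_of_nonneg_left (hVc0 x) hlpos.le
    have := (abs_le.1 (hC2 x)).2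
    linarith
  have hVQ : ∀ x ∈ Q, V x = ub x - lb x := fun x hx => by
    have := (ψ1 x hx).self_of_nhds
    simp [hVd, hφd, this]
  have hlapQ : ∀ x ∈ Q, lap φ x = lap ub x - lap lb x := fun x hx => by
    have h1 : φ =ᶠ[𝓝 x] fun y => (ub y - lb y) - 1 := by
      filter_upwards [ψ1 x hx] with y hy
      simp [hφd, hy]
    have hu := hub.contDiffAt (hΩ.mem_nhds (hQΩ hx))
    have hl := hlb.contDiffAt (hΩ.mem_nhds (hQΩ hx))
    rw [lap_congr h1, lap_sub (hu.sub hl) contDiffAt_const, lap_sub hu hl, lap_const]; ring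
  obtain ⟨m, mfin, msym, mmass, mres⟩ := exists_resolvent N hlpos
  let G : (Eu N → ℝ) → Eu N → ℝ := fun w => Q.indicator
    (fun x => l * w x - lap ub x - f x (ub x - w x))
  have hGm (w : Eu N → ℝ) (hw : Measurable w) : Measurable (G w) := by
    refine Measurable.indicator ?_ hQ.measurableSet
    refine ((hw.const_mul l).sub (lap_measurable _)).sub ?_
    exact mf.comp (measurable_id.prodMk (mub.sub hw))
  have hmem (x) (hx : x ∈ Q) (a : ℝ) (ha : 0 ≤ a ∧ a ≤ V x) : ub x - a ∈ Icc 0 Bu := by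
    rw [hVQ x hx] at ha
    have h1 := h0 x (hQΩ hx)
    have h2 := (abs_le.1 (hBu x hx)).2
    constructor <;> linarith [ha.1, ha.2]
  have hmono (x) (hx : x ∈ Q) (a b : ℝ) (ha : 0 ≤ a) (hab : a ≤ b) (hb : b ≤ V x) :
      l * a - lap ub x - f x (ub x - a) ≤ l * b - lap ub x - f x (ub x - b) := by
    have h1 := hL x hx _ (hmem x hx b ⟨ha.trans hab, hb⟩) _ (hmem x hx a ⟨ha, hab.trans hb⟩)
    have h2 := (abs_le.1 h1).2
    have h3 : |ub x - b - (ub x - a)| = b - a := by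
      rw [show ub x - b - (ub x - a) = -(b - a) by ring, abs_neg, abs_of_nonneg (by linarith)]
    rw [h3] at h2
    nlinarith
  have hGmono (w w' : Eu N → ℝ) (h1 : ∀ x, 0 ≤ w x) (h2 : ∀ x, w x ≤ w' x) (h3 : ∀ x, w' x ≤ V x) :
      ∀ x, G w x ≤ G w' x := fun x => by
    by_cases hx : x ∈ Q
    · simp only [G, indicator_of_mem hx]
      exact hmono x hx _ _ (h1 x) (h2 x) (h3 x)
    · simp only [G, indicator_of_notMem hx]; exact le_rfl
  have hGnn (w : Eu N → ℝ) (h1 : ∀ x, 0 ≤ w x ∧ w x ≤ V x) (x) : 0 ≤ G w x := by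
    by_cases hx : x ∈ Q
    · simp only [G, indicator_of_mem hx]
      have := hmono x hx 0 (w x) le_rfl (h1 x).1 (h1 x).2
      have h2 := hsup x (hQΩ hx)
      simp only [sub_zero] at this
      linarith
    · simp only [G, indicator_of_notMem hx]; exact le_rfl
  have hGV (w : Eu N → ℝ) (h1 : ∀ x, 0 ≤ w x ∧ w x ≤ V x) (x) : G w x ≤ l * V x - lap φ x := by
    by_cases hx : x ∈ Q
    · simp only [G, indicator_of_mem hx]
      have := hmono x hx (w x) (V x) (h1 x).1 (h1 x).2 le_rfl
      have h2 := hsub x (hQΩ hx)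
      have h3 : ub x - V x = lb x := by rw [hVQ x hx]; ring
      rw [h3] at this
      rw [hlapQ x hx]
      linarith
    · simp only [G, indicator_of_notMem hx]; exact hlV x
  set BV : ℝ := l * (1 + C0) + C2 with hBV
  have hGbd (w : Eu N → ℝ) (h1 : ∀ x, 0 ≤ w x ∧ w x ≤ V x) (x) : |G w x| ≤ BV := by
    rw [abs_of_nonneg (hGnn w h1 x)]
    refine (hGV w h1 x).trans ?_
    have h2 := (abs_le.1 (hC0 x)).2
    have h3 := (abs_le.1 (hC2 x)).1
    have : l * V x ≤ l * (1 + C0) := mul_le_mul_of_nonneg_left (by simp only [hVd]; linarith) hlpos.le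
    linarith
  have hGint (w : Eu N → ℝ) (hw : Measurable w) (h1 : ∀ x, 0 ≤ w x ∧ w x ≤ V x) (x) :
      Integrable (fun y => G w (x + y)) m :=
    Integrable.of_bound (C := BV) ((hGm w hw).comp (measurable_const_add x)).aestronglyMeasurable
      (ae_of_all _ fun y => hGbd w h1 _)
  have hKV (x) : ∫ y, (l * V (x + y) - lap φ (x + y)) ∂m = V x := by
    have h1 := mres φ hφ hφs x
    have hcl := lap_continuous hφ
    have hcφ := hφ.continuous
    have h2 : Integrable (fun y => l * φ (x + y) - lap φ (x + y)) m := by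
      refine Integrable.of_bound (C := l * C0 + C2) (by fun_prop) (ae_of_all _ fun y => ?_)
      refine (norm_sub_le _ _).trans (add_le_add ?_ (hC2 _))
      rw [norm_mul, Real.norm_of_nonneg hlpos.le]
      exact mul_le_mul_of_nonneg_left (hC0 _) hlpos.le
    have h3 : ∀ y, l * V (x + y) - lap φ (x + y) = l + (l * φ (x + y) - lap φ (x + y)) := fun y => by
      simp only [hVd]; ring
    simp_rw [h3]
    rw [integral_add (integrable_const _) h2, h1, integral_const, mmass]
    simp only [hVd, smul_eq_mul]; field_simp
  have hVint (x) : Integrable (fun y => l * V (x + y) - lap φ (x + y)) m := by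
    have hcl := lap_continuous hφ
    refine Integrable.of_bound (C := BV) (by fun_prop) (ae_of_all _ fun y => ?_)
    rw [Real.norm_of_nonneg (hlV _)]
    have h2 := (abs_le.1 (hC0 (x+y))).2
    have h3 := (abs_le.1 (hC2 (x+y))).1
    have : l * V (x+y) ≤ l * (1 + C0) := mul_le_mul_of_nonneg_left (by simp only [hVd]; linarith) hlpos.le
    linarith
  let T : (Eu N → ℝ) → Eu N → ℝ := fun w x => ∫ y, G w (x + y) ∂m
  let w : ℕ → Eu N → ℝ := fun k => T^[k] (fun _ => 0)
  have hwS (k) : w (k+1) = T (w k) := Function.iterate_succ_apply' _ _ _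
  have hA (k) : Measurable (w k) ∧ ∀ x, 0 ≤ w k x ∧ w k x ≤ V x := by
    induction k with
    | zero => exact ⟨measurable_const, fun x => ⟨le_rfl, (hVpos x).le⟩⟩
    | succ k ih =>
      rw [hwS]
      refine ⟨conv_measurable (hGm _ ih.1), fun x => ⟨?_, ?_⟩⟩
      · exact integral_nonneg fun y => hGnn _ ih.2 _
      · rw [← hKV x]
        exact integral_mono (hGint _ ih.1 ih.2 x) (hVint x) fun y => hGV _ ih.2 _
  have hB (k) : ∀ x, w k x ≤ w (k+1) x := by
    induction k with
    | zero => exact fun x => ((hA 1).2 x).1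
    | succ k ih =>
      intro x
      rw [hwS k, hwS (k+1)]
      exact integral_mono (hGint _ (hA k).1 (hA k).2 x) (hGint _ (hA (k+1)).1 (hA (k+1)).2 x)
        fun y => hGmono _ _ (fun x => ((hA k).2 x).1) ih (fun x => ((hA (k+1)).2 x).2) _
  let W : Eu N → ℝ := fun x => ⨆ k, w k x
  have hWt (x) : Tendsto (fun k => w k x) atTop (𝓝 (W x)) :=
    tendsto_atTop_ciSup (monotone_nat_of_le_succ fun k => hB k x)
      ⟨V x, by rintro _ ⟨k, rfl⟩; exact ((hA k).2 x).2⟩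
  have hWm : Measurable W := measurable_of_tendsto_metrizable (fun k => (hA k).1) (tendsto_pi_nhds.2 hWt)
  have hWb (x) : 0 ≤ W x ∧ W x ≤ V x :=
    ⟨ge_of_tendsto' (hWt x) fun k => ((hA k).2 x).1, le_of_tendsto' (hWt x) fun k => ((hA k).2 x).2⟩
  have hGt (x) : Tendsto (fun k => G (w k) x) atTop (𝓝 (G W x)) := by
    by_cases hx : x ∈ Q
    · simp only [G, indicator_of_mem hx]
      refine (((hWt x).const_mul l).sub tendsto_const_nhds).sub ?_
      rw [tendsto_iff_dist_tendsto_zero]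
      have h1 : Tendsto (fun k => L * |w k x - W x|) atTop (𝓝 0) := by
        have := (tendsto_iff_dist_tendsto_zero.1 (hWt x)).const_mul L
        simpa [Real.dist_eq] using this
      refine squeeze_zero (fun _ => dist_nonneg) (fun k => ?_) h1
      have := hL x hx _ (hmem x hx _ ((hA k).2 x)) _ (hmem x hx _ (hWb x))
      rw [Real.dist_eq]
      refine this.trans (le_of_eq ?_)
      congr 1
      rw [show ub x - w k x - (ub x - W x) = -(w k x - W x) by ring, abs_neg]
    · simp only [G, indicator_of_notMem hx]; exact tendsto_const_nhds
  have hWfix (x) : W x = ∫ y, G W (x + y) ∂m := by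
    refine tendsto_nhds_unique ((tendsto_add_atTop_iff_nat 1).2 (hWt x)) ?_
    simp_rw [hwS]
    exact tendsto_integral_of_dominated_convergence (fun _ => BV)
      (fun k => (hGint _ (hA k).1 (hA k).2 x).aestronglyMeasurable) (integrable_const _)
      (fun k => ae_of_all _ fun y => hGbd _ (hA k).2 _) (ae_of_all _ fun y => hGt _)
  refine ⟨Q.indicator fun x => ub x - W x, (mub.sub hWm).indicator hQ.measurableSet,
    fun x hx => ?_, ?_⟩
  · rw [indicator_of_mem hx]
    have := hWb x
    rw [hVQ x hx] at this
    constructor <;> linarith [this.1, this.2]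
  · intro θ hθ hθc hθs
    have hθQ : tsupport θ ⊆ Q := hθs.trans interior_subset
    have hθΩ : tsupport θ ⊆ Ω := hθQ.trans hQΩ
    have hlθ := lap_continuous hθ
    have hGi : Integrable (G W) := by
      have h1 : IntegrableOn (G W) Q :=
        IntegrableOn.of_bound hQ.measure_lt_top (hGm W hWm).aestronglyMeasurable BV
          (ae_of_all _ fun x => hGbd W hWb x)
      exact (integrableOn_iff_integrable_of_support_subset (by simp [G])).1 h1
    have hd := duality msym (hGm W hWm) (hGbd W hWb) hGi
      (θ := fun x => l * θ x - lap θ x) ((continuous_const.mul hθ.continuous).sub hlθ)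
      (by
        refine HasCompactSupport.of_support_subset_isCompact (hθc.isCompact) fun x hx => ?_
        by_contra h
        apply hx
        have h1 := image_eq_zero_of_notMem_tsupport h
        have h2 := image_eq_zero_of_notMem_tsupport (f := lap θ) (fun hh => h (tsupport_lap hh))
        simp [h1, h2])
    simp_rw [mres θ hθ hθc, ← hWfix] at hd
    -- integrability
    have hWbd (x) : |W x| ≤ 1 + C0 := by
      rw [abs_of_nonneg (hWb x).1]
      have h2 := (abs_le.1 (hC0 x)).2
      have := (hWb x).2
      simp only [hVd] at this
      linarith
    have hWi (k : Eu N → ℝ) (hk : Continuous k) (hkc : HasCompactSupport k) :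
        Integrable fun x => W x * k x :=
      (hk.integrable_of_hasCompactSupport hkc).bdd_mul (c := 1 + C0) hWm.aestronglyMeasurable
        (ae_of_all _ hWbd)
    have j1 := hWi θ hθ.continuous hθc
    have j2 := hWi (lap θ) hlθ (lap_compact hθc)
    have j3 := integrable_mul_of_tsupport hΩ hub.continuousOn hlθ (lap_compact hθc)
      (tsupport_lap.trans hθΩ)
    have j4 := integrable_mul_of_tsupport hΩ (lap_continuousOn hΩ hub) hθ.continuous hθc hθΩ
    have j5 : Integrable fun x => G W x * θ x :=
      (hθ.continuous.integrable_of_hasCompactSupport hθc).bdd_mul (c := BV)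
        (hGm W hWm).aestronglyMeasurable (ae_of_all _ (hGbd W hWb))
    have hgr := green hΩ hub hθ hθc hθΩ
    have e1 : ∫ x, Q.indicator (fun x => ub x - W x) x * lap θ x =
        (∫ x, ub x * lap θ x) - ∫ x, W x * lap θ x := by
      rw [← integral_sub j3 j2]
      congr 1; ext x
      by_cases hx : x ∈ Q
      · rw [indicator_of_mem hx]; ring
      · rw [image_eq_zero_of_notMem_tsupport (f := lap θ) (fun h => hx (hθQ (tsupport_lap h)))]; simp
    have e2 : ∫ x, f x (Q.indicator (fun x => ub x - W x) x) * θ x =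
        l * (∫ x, W x * θ x) - (∫ x, lap ub x * θ x) - ∫ x, G W x * θ x := by
      rw [← integral_const_mul, ← integral_sub (j1.const_mul l) j4,
        ← integral_sub (f := fun a => l * (W a * θ a) - lap ub a * θ a) ((j1.const_mul l).sub j4) j5]
      congr 1; ext x
      by_cases hx : x ∈ Q
      · simp only [G, indicator_of_mem hx]; ring
      · rw [image_eq_zero_of_notMem_tsupport (f := θ) (fun h => hx (hθQ h))]; simp
    have e3 : ∫ x, W x * (l * θ x - lap θ x) = l * (∫ x, W x * θ x) - ∫ x, W x * lap θ x := by
      rw [← integral_const_mul, ← integral_sub (j1.const_mul l) j2]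
      congr 1; ext x; ring
    rw [e1, e2, hgr]
    rw [e3] at hd
    linarith
end

open Set Metric MeasureTheory Real
noncomputable section
open Filter Topology

/-- truncated power -/
def qq (k : ℕ) (t : ℝ) : ℝ := (max t 0) ^ k

lemma qq_hasDerivAt (k : ℕ) (t : ℝ) : HasDerivAt (qq (k+2)) ((k+2 : ℝ) * qq (k+1) t) t := by
  rcases lt_trichotomy t 0 with h | h | h
  · have : qq (k+2) =ᶠ[𝓝 t] fun _ => 0 := by
      filter_upwards [Iio_mem_nhds h] with s hs
      simp [qq, max_eq_right (mem_Iio.1 hs).le]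
    exact ((hasDerivAt_const t (0:ℝ)).congr_of_eventuallyEq this).congr_deriv
      (by simp [qq, max_eq_right h.le])
  · subst h
    rw [hasDerivAt_iff_tendsto_slope]
    have h1 : Tendsto (fun t : ℝ => qq (k+1) t) (𝓝[≠] 0) (𝓝 (((k:ℝ)+2) * qq (k+1) 0)) := by
      have hc : Continuous (qq (k+1)) := by unfold qq; fun_prop
      have := (hc.tendsto 0).mono_left (nhdsWithin_le_nhds (s := {0}ᶜ))
      have e : ((k:ℝ)+2) * qq (k+1) 0 = qq (k+1) 0 := by simp [qq]
      rw [e]; exact this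
    refine h1.congr' ?_
    filter_upwards [self_mem_nhdsWithin] with s hs
    have hs : s ≠ 0 := hs
    rw [slope_def_field]
    rcases lt_or_gt_of_ne hs with h | h
    · simp [qq, max_eq_right h.le]
    · simp [qq, max_eq_left h.le]
      field_simp
      ring
  · have : qq (k+2) =ᶠ[𝓝 t] fun s => s ^ (k+2) := by
      filter_upwards [Ioi_mem_nhds h] with s hs
      simp [qq, max_eq_left (mem_Ioi.1 hs).le]
    exact ((hasDerivAt_pow (k+2) t).congr_of_eventuallyEq this).congr_deriv
      (by simp [qq, max_eq_left h.le])

lemma qq_deriv (k : ℕ) : deriv (qq (k+2)) = fun t => (k+2 : ℝ) * qq (k+1) t :=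
  funext fun t => (qq_hasDerivAt k t).deriv

lemma qq_continuous (k : ℕ) : Continuous (qq k) := by unfold qq; fun_prop

lemma qq_contDiff1 (k : ℕ) : ContDiff ℝ 1 (qq (k+2)) := by
  rw [contDiff_one_iff_deriv]
  refine ⟨fun t => (qq_hasDerivAt k t).differentiableAt, ?_⟩
  rw [qq_deriv]
  exact continuous_const.mul (qq_continuous _)

lemma qq_contDiff2 (k : ℕ) : ContDiff ℝ 2 (qq (k+3)) := by
  rw [show (2 : WithTop ℕ∞) = 1 + 1 by norm_num, contDiff_succ_iff_deriv]
  refine ⟨fun t => (qq_hasDerivAt (k+1) t).differentiableAt, by simp, ?_⟩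
  rw [qq_deriv]
  exact contDiff_const.mul (qq_contDiff1 _)

lemma qq_nonneg (k : ℕ) (t : ℝ) : 0 ≤ qq k t := by unfold qq; positivity

lemma qq_le_one (k : ℕ) {t : ℝ} (ht : t ≤ 1) : qq k t ≤ 1 :=
  pow_le_one₀ (le_max_right _ _) (max_le ht zero_le_one)

lemma qq_zero (k : ℕ) {t : ℝ} (ht : t ≤ 0) : qq (k+1) t = 0 := by simp [qq, max_eq_right ht]

/-- profile -/
def Psi {N : ℕ} (z : Eu N) : ℝ := qq 5 (1 - ‖z‖ ^ 2)
/-- profile -/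
def Rho {N : ℕ} (z : Eu N) : ℝ := 10 * qq 4 (1 - ‖z‖ ^ 2)

lemma Psi_contDiff {N : ℕ} : ContDiff ℝ 2 (Psi : Eu N → ℝ) :=
  (qq_contDiff2 2).comp (contDiff_const.sub (contDiff_norm_sq ℝ))
lemma Rho_contDiff {N : ℕ} : ContDiff ℝ 2 (Rho : Eu N → ℝ) :=
  contDiff_const.mul ((qq_contDiff2 1).comp (contDiff_const.sub (contDiff_norm_sq ℝ)))
lemma Psi_nonneg {N : ℕ} (z : Eu N) : 0 ≤ Psi z := qq_nonneg _ _
lemma Rho_nonneg {N : ℕ} (z : Eu N) : 0 ≤ Rho z := mul_nonneg (by norm_num) (qq_nonneg _ _)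
lemma Psi_zero {N : ℕ} {z : Eu N} (h : 1 ≤ ‖z‖) : Psi z = 0 := qq_zero 4 (by nlinarith)
lemma Rho_zero {N : ℕ} {z : Eu N} (h : 1 ≤ ‖z‖) : Rho z = 0 := by
  unfold Rho; rw [qq_zero 3 (by nlinarith)]; simp
lemma Psi_le {N : ℕ} (z : Eu N) : Psi z ≤ 1 := qq_le_one _ (by nlinarith [norm_nonneg z])
lemma Rho_le {N : ℕ} (z : Eu N) : Rho z ≤ 10 := by
  have := qq_le_one 4 (t := 1 - ‖z‖^2) (by nlinarith [norm_nonneg z])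
  unfold Rho; linarith
lemma compact_of_zero {N : ℕ} {k : Eu N → ℝ} (h : ∀ z, 1 ≤ ‖z‖ → k z = 0) : HasCompactSupport k := by
  refine HasCompactSupport.of_support_subset_isCompact (isCompact_closedBall 0 1) fun z hz => ?_
  rw [mem_closedBall_zero_iff]
  by_contra hh
  exact hz (h z (not_le.1 hh).le)
lemma Psi_compact {N : ℕ} : HasCompactSupport (Psi : Eu N → ℝ) := compact_of_zero fun _ => Psi_zero
lemma Rho_compact {N : ℕ} : HasCompactSupport (Rho : Eu N → ℝ) := compact_of_zero fun _ => Rho_zero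

/-- mass -/
def CR (N : ℕ) : ℝ := ∫ z : Eu N, Rho z
lemma CR_pos (N : ℕ) : 0 < CR N :=
  Rho_contDiff.continuous.integral_pos_of_hasCompactSupport_nonneg_nonzero (x := 0) Rho_compact
    Rho_nonneg (by simp [Rho, qq])

/-- scaled averages -/
def Tk {N : ℕ} (k h : Eu N → ℝ) (r : ℝ) (x : Eu N) : ℝ := ∫ z, h (x + r • z) * k z

lemma Tk_change {N : ℕ} (k h : Eu N → ℝ) {r : ℝ} (hr : 0 < r) (x : Eu N) :
    Tk k h r x = (r⁻¹) ^ N * ∫ y, h y * k (r⁻¹ • (y - x)) := by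
  have h1 := Measure.integral_comp_smul_of_nonneg (volume : Measure (Eu N))
    (fun y => h (x + y) * k (r⁻¹ • y)) r (hR := hr.le)
  have h2 := integral_add_left_eq_self (μ := (volume : Measure (Eu N))) (fun y => h y * k (r⁻¹ • (y - x))) x
  unfold Tk
  rw [← h2]
  simp only [add_sub_cancel_left]
  rw [smul_eq_mul, finrank_euclideanSpace_fin, ← inv_pow] at h1
  rw [← h1]
  congr 1; ext z
  rw [smul_smul, inv_mul_cancel₀ hr.ne', one_smul]

lemma lap_normsq {N : ℕ} (x y : Eu N) : lap (fun y => ‖y - x‖ ^ 2) y = 2 * N ∧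
    ‖gradient (fun y => ‖y - x‖ ^ 2) y‖ ^ 2 = 4 * ‖y - x‖ ^ 2 := by
  have h1 (y : Eu N) (i : Fin N) : fderiv ℝ (fun y => ‖y - x‖ ^ 2) y (bv i) = 2 * (y i - x i) := by
    have h : HasFDerivAt (fun y : Eu N => ‖y - x‖^2) ((2 • (innerSL ℝ (y - x))).comp (ContinuousLinearMap.id ℝ (Eu N))) y :=
      ((hasStrictFDerivAt_norm_sq (y - x)).hasFDerivAt).comp (f := fun y => y - x) y ((hasFDerivAt_id y).sub_const x)
    rw [h.fderiv]
    simp [EuclideanSpace.inner_single_right]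
  constructor
  · unfold lap
    simp_rw [h1]
    have h2 (i : Fin N) : fderiv ℝ (fun y : Eu N => 2 * (y i - x i)) y (bv i) = 2 := by
      have h : HasFDerivAt (fun y : Eu N => 2 * (y i - x i)) ((2:ℝ) • (EuclideanSpace.proj i : Eu N →L[ℝ] ℝ)) y :=
        (((EuclideanSpace.proj i : Eu N →L[ℝ] ℝ).hasFDerivAt).sub_const (x i)).const_mul 2
      rw [h.fderiv]; simp
    simp [h2]; ring
  · rw [gradient_coord, EuclideanSpace.real_norm_sq_eq, Finset.mul_sum]
    refine Finset.sum_congr rfl fun i _ => ?_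
    rw [h1]; simp; ring

/-- kernel derivative -/
def Dk (N : ℕ) (t s : ℝ) : ℝ :=
  t ^ N * (80 * s * qq 3 (1 - s * t ^ 2) * t ^ 3 - 10 * N * qq 4 (1 - s * t ^ 2) * t)

lemma lap_test {N : ℕ} (x y : Eu N) {r : ℝ} (hr : 0 < r) :
    r * lap (fun y => (r⁻¹) ^ N * Psi (r⁻¹ • (y - x))) y = Dk N r⁻¹ (‖y - x‖ ^ 2) := by
  have e : (fun y => (r⁻¹) ^ N * Psi (r⁻¹ • (y - x))) =
      fun y => (fun s => (r⁻¹) ^ N * qq 5 (1 - s * (r⁻¹)^2)) (‖y - x‖ ^ 2) := by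
    ext y
    simp only [Psi, norm_smul, Real.norm_of_nonneg (inv_nonneg.2 hr.le)]
    congr 3; ring
  have hg1 (s : ℝ) : HasDerivAt (fun s => (r⁻¹) ^ N * qq 5 (1 - s * (r⁻¹)^2))
      (-(5 * (r⁻¹) ^ N * (r⁻¹)^2 * qq 4 (1 - s * (r⁻¹)^2))) s := by
    have h0 : HasDerivAt (fun s => 1 - s * (r⁻¹)^2) (-(r⁻¹)^2) s := by
      exact (((hasDerivAt_id' s).mul_const ((r⁻¹)^2)).const_sub 1).congr_deriv (by ring)
    have := ((qq_hasDerivAt 3 (1 - s * (r⁻¹)^2)).comp s h0).const_mul ((r⁻¹) ^ N)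
    exact this.congr_deriv (by push_cast; ring)
  have hg2 (s : ℝ) : HasDerivAt (fun s => (-(5 * (r⁻¹) ^ N * (r⁻¹)^2 * qq 4 (1 - s * (r⁻¹)^2))))
      (20 * (r⁻¹) ^ N * (r⁻¹)^4 * qq 3 (1 - s * (r⁻¹)^2)) s := by
    have h0 : HasDerivAt (fun s => 1 - s * (r⁻¹)^2) (-(r⁻¹)^2) s := by
      exact (((hasDerivAt_id' s).mul_const ((r⁻¹)^2)).const_sub 1).congr_deriv (by ring)
    have := (((qq_hasDerivAt 2 (1 - s * (r⁻¹)^2)).comp s h0).const_mul (5 * (r⁻¹) ^ N * (r⁻¹)^2)).neg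
    exact this.congr_deriv (by push_cast; ring)
  have hd1 : deriv (fun s => (r⁻¹) ^ N * qq 5 (1 - s * (r⁻¹)^2)) = _ := funext fun s => (hg1 s).deriv
  have hc : ContDiff ℝ 2 (fun s => (r⁻¹) ^ N * qq 5 (1 - s * (r⁻¹)^2)) :=
    contDiff_const.mul ((qq_contDiff2 2).comp (contDiff_const.sub (contDiff_id.mul contDiff_const)))
  rw [e, lap_comp (f := fun y => ‖y - x‖ ^ 2) (g := fun s => (r⁻¹) ^ N * qq 5 (1 - s * (r⁻¹)^2))
    (by exact ((contDiff_norm_sq ℝ).comp (contDiff_id.sub contDiff_const)).contDiffAt)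
    hc.contDiffAt, hd1, (hg2 _).deriv, (lap_normsq x y).1, (lap_normsq x y).2]
  unfold Dk
  field_simp
  ring

lemma rho_deriv (N : ℕ) (s : ℝ) {r : ℝ} (hr : 0 < r) :
    HasDerivAt (fun r => (r⁻¹) ^ N * (10 * qq 4 (1 - s * (r⁻¹)^2))) (Dk N r⁻¹ s) r := by
  have hi : HasDerivAt (fun r : ℝ => r⁻¹) (-(r⁻¹)^2) r := by
    simpa using hasDerivAt_inv hr.ne'
  have hg (t : ℝ) : HasDerivAt (fun t : ℝ => t ^ N * (10 * qq 4 (1 - s * t^2)))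
      (N * t ^ (N - 1) * (10 * qq 4 (1 - s * t^2)) + t ^ N * (10 * (4 * qq 3 (1 - s * t^2) * (-(s * (2 * t)))))) t := by
    have h0 : HasDerivAt (fun t : ℝ => 1 - s * t^2) (-(s * (2 * t))) t := by
      have := ((hasDerivAt_pow 2 t).const_mul s).const_sub 1
      simpa using this
    have h1 := ((qq_hasDerivAt 2 (1 - s * t^2)).comp t h0).const_mul 10
    exact ((hasDerivAt_pow N t).mul h1).congr_deriv (by simp only [Function.comp]; push_cast; ring)
  refine ((hg r⁻¹).comp r hi).congr_deriv ?_
  unfold Dk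
  rcases N with _ | n
  · simp; ring
  · simp; ring
end

open Set Metric MeasureTheory Real
noncomputable section
open Filter Topology

lemma Dk_zero (N : ℕ) {t s : ℝ} (h : 1 ≤ s * t ^ 2) : Dk N t s = 0 := by
  unfold Dk
  rw [qq_zero 2 (by linarith), qq_zero 3 (by linarith)]; simp

lemma Dk_continuous (N : ℕ) : Continuous (fun p : ℝ × ℝ => Dk N p.1 p.2) := by
  unfold Dk
  have h3 := qq_continuous 3
  have h4 := qq_continuous 4
  fun_prop

lemma Dk_bound (N : ℕ) {ε R : ℝ} (hε : 0 < ε) : ∃ C, 0 ≤ C ∧ ∀ r ∈ Icc ε R, ∀ s, 0 ≤ s →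
    |Dk N r⁻¹ s| ≤ if s ≤ R ^ 2 then C else 0 := by
  obtain ⟨C, hC⟩ := ((isCompact_Icc (a := R⁻¹) (b := ε⁻¹)).prod
    (isCompact_Icc (a := 0) (b := R^2))).exists_bound_of_continuousOn (Dk_continuous N).continuousOn
  refine ⟨max C 0, le_max_right _ _, fun r hr s hs => ?_⟩
  have hr0 : 0 < r := hε.trans_le hr.1
  split_ifs with h
  · refine le_trans (hC (r⁻¹, s) ⟨⟨?_, ?_⟩, hs, h⟩) (le_max_left _ _)
    · exact inv_anti₀ hr0 hr.2
    · exact inv_anti₀ hε hr.1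
  · rw [Dk_zero]; simp
    have h1 : r ^ 2 ≤ s := by nlinarith [hr.2, not_le.1 h]
    calc (1:ℝ) = r ^ 2 * (r⁻¹)^2 := by field_simp
      _ ≤ _ := by gcongr

lemma test_props {N : ℕ} (x : Eu N) {r : ℝ} (hr : 0 < r) :
    ContDiff ℝ 2 (fun y => (r⁻¹) ^ N * Psi (r⁻¹ • (y - x))) ∧
    HasCompactSupport (fun y => (r⁻¹) ^ N * Psi (r⁻¹ • (y - x))) ∧
    tsupport (fun y => (r⁻¹) ^ N * Psi (r⁻¹ • (y - x))) ⊆ closedBall x r := by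
  have hs : Function.support (fun y => (r⁻¹) ^ N * Psi (r⁻¹ • (y - x))) ⊆ closedBall x r := by
    intro y hy
    by_contra h
    rw [mem_closedBall, not_le, dist_eq_norm] at h
    apply hy
    simp only
    rw [Psi_zero, mul_zero]
    rw [norm_smul, Real.norm_of_nonneg (inv_nonneg.2 hr.le)]
    rw [← inv_mul_cancel₀ hr.ne']
    gcongr
  refine ⟨contDiff_const.mul (Psi_contDiff.comp (f := fun y => r⁻¹ • (y - x)) (by fun_prop)),
    HasCompactSupport.of_support_subset_isCompact (isCompact_closedBall x r) hs,
    closure_minimal hs isClosed_closedBall⟩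

lemma Rho_scaled {N : ℕ} (x y : Eu N) {r : ℝ} (hr : 0 < r) :
    Rho (r⁻¹ • (y - x)) = 10 * qq 4 (1 - ‖y - x‖^2 * (r⁻¹)^2) := by
  simp only [Rho, norm_smul, Real.norm_of_nonneg (inv_nonneg.2 hr.le)]
  congr 3; ring

/-- Representation between two radii. -/
lemma rep_two {N : ℕ} {G : Set (Eu N)} {u F : Eu N → ℝ} (mu : Measurable u) {A : ℝ}
    (hA : ∀ x, |u x| ≤ A) (hD : DistSol G u F) {x : Eu N} {ε R : ℝ} (hε : 0 < ε) (hεR : ε ≤ R)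
    (hB : closedBall x R ⊆ G) :
    Tk Rho u R x - Tk Rho u ε x = -∫ r in ε..R, r * Tk Psi F r x := by
  have hR : 0 < R := hε.trans_le hεR
  obtain ⟨C, hC0, hC⟩ := Dk_bound N (R := R) hε
  have hA0 : 0 ≤ A := (abs_nonneg _).trans (hA x)
  have i1 (r : ℝ) (hr : 0 < r) : Integrable (fun y => u y * ((r⁻¹) ^ N * Rho (r⁻¹ • (y - x)))) := by
    have h1 : Continuous (fun y => ((r⁻¹) ^ N * Rho (r⁻¹ • (y - x)))) := by
      have := Rho_contDiff (N := N) |>.continuous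
      fun_prop
    have h2 : HasCompactSupport (fun y => ((r⁻¹) ^ N * Rho (r⁻¹ • (y - x)))) := by
      refine HasCompactSupport.of_support_subset_isCompact (isCompact_closedBall x r) fun y hy => ?_
      by_contra h
      rw [mem_closedBall, not_le, dist_eq_norm] at h
      apply hy
      simp only
      rw [Rho_zero, mul_zero]
      rw [norm_smul, Real.norm_of_nonneg (inv_nonneg.2 hr.le)]
      rw [← inv_mul_cancel₀ hr.ne']
      gcongr
    exact (h1.integrable_of_hasCompactSupport h2).bdd_mul (c := A) mu.aestronglyMeasurable
      (ae_of_all _ hA)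
  have e1 (r : ℝ) (hr : 0 < r) : Tk Rho u r x = ∫ y, u y * ((r⁻¹) ^ N * Rho (r⁻¹ • (y - x))) := by
    rw [Tk_change _ _ hr, ← integral_const_mul]
    congr 1; ext y; ring
  rw [e1 R hR, e1 ε hε, ← integral_sub (i1 R hR) (i1 ε hε)]
  have e2 (y : Eu N) : u y * ((R⁻¹) ^ N * Rho (R⁻¹ • (y - x))) - u y * ((ε⁻¹) ^ N * Rho (ε⁻¹ • (y - x)))
      = ∫ r in ε..R, u y * Dk N r⁻¹ (‖y - x‖^2) := by
    rw [intervalIntegral.integral_const_mul, intervalIntegral.integral_eq_sub_of_hasDerivAt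
      (f := fun r => (r⁻¹) ^ N * (10 * qq 4 (1 - ‖y - x‖^2 * (r⁻¹)^2))), Rho_scaled _ _ hR,
      Rho_scaled _ _ hε]
    · ring
    · intro r hr
      rw [uIcc_of_le hεR] at hr
      exact rho_deriv N _ (hε.trans_le hr.1)
    · apply ContinuousOn.intervalIntegrable
      rw [uIcc_of_le hεR]
      refine (Dk_continuous N).comp_continuousOn (ContinuousOn.prodMk ?_ continuousOn_const)
      exact continuousOn_inv₀.mono fun r hr => (hε.trans_le hr.1).ne'
  simp_rw [e2]
  rw [← intervalIntegral_integral_swap (f := fun r y => u y * Dk N r⁻¹ (‖y - x‖^2))]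
  · rw [← intervalIntegral.integral_neg]
    apply intervalIntegral.integral_congr
    intro r hr
    rw [uIcc_of_le hεR] at hr
    have hr0 : 0 < r := hε.trans_le hr.1
    obtain ⟨t1, t2, t3⟩ := test_props x hr0
    have := hD _ t1 t2 (t3.trans ((closedBall_subset_closedBall hr.2).trans hB))
    simp only
    rw [Tk_change _ _ hr0]
    calc ∫ y, u y * Dk N r⁻¹ (‖y - x‖^2)
        = r * ∫ y, u y * lap (fun y => (r⁻¹) ^ N * Psi (r⁻¹ • (y - x))) y := by
          rw [← integral_const_mul]
          congr 1; ext y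
          rw [← lap_test x y hr0]; ring
      _ = _ := by
          rw [this, ← integral_const_mul]
          rw [mul_neg]
          congr 3; ext y; ring
  · rw [uIoc_of_le hεR]
    have hi : Integrable (fun p : ℝ × Eu N => (1:ℝ) * (closedBall x R).indicator (fun _ => A * C) p.2)
        ((volume.restrict (Ioc ε R)).prod volume) := by
      refine Integrable.mul_prod (f := fun _ => (1:ℝ)) (integrable_const _) ?_
      exact (integrable_indicator_iff measurableSet_closedBall).2
        (integrableOn_const (by exact measure_closedBall_lt_top.ne))
    refine hi.mono' ?_ ?_
    · have : Measurable (Function.uncurry fun (r : ℝ) (y : Eu N) => u y * Dk N r⁻¹ (‖y - x‖^2)) := by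
        refine (mu.comp measurable_snd).mul ((Dk_continuous N).measurable.comp
          (f := fun a : ℝ × Eu N => (a.1⁻¹, ‖a.2 - x‖^2)) ?_)
        fun_prop
      exact this.aestronglyMeasurable
    · have : ∀ᵐ p : ℝ × Eu N ∂((volume.restrict (Ioc ε R)).prod volume), p.1 ∈ Ioc ε R := by
        have h := (Measure.quasiMeasurePreserving_fst (μ := (volume.restrict (Ioc ε R))) (ν := (volume : Measure (Eu N)))).ae
          (ae_restrict_mem measurableSet_Ioc)
        exact h
      filter_upwards [this] with p hp
      simp only [Function.uncurry, norm_mul, Real.norm_eq_abs, one_mul]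
      have h1 := hC p.1 ⟨hp.1.le, hp.2⟩ (‖p.2 - x‖^2) (by positivity)
      by_cases hb : p.2 ∈ closedBall x R
      · rw [indicator_of_mem hb]
        have hb' : ‖p.2 - x‖ ≤ R := by rwa [mem_closedBall, dist_eq_norm] at hb
        rw [if_pos (by gcongr)] at h1
        exact mul_le_mul (hA _) h1 (abs_nonneg _) hA0
      · rw [indicator_of_notMem hb]
        have hb' : R < ‖p.2 - x‖ := by rwa [mem_closedBall, dist_eq_norm, not_le] at hb
        rw [if_neg (by rw [not_le]; gcongr)] at h1
        rw [le_antisymm h1 (abs_nonneg _)]; simp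

lemma Tk_integrable {N : ℕ} {k h : Eu N → ℝ} (hk : Integrable k) (mh : Measurable h) {A : ℝ}
    (hA : ∀ x, |h x| ≤ A) (r : ℝ) (x : Eu N) : Integrable (fun z => h (x + r • z) * k z) :=
  hk.bdd_mul (c := A) (mh.comp (by fun_prop : Measurable fun z : Eu N => x + r • z)).aestronglyMeasurable
    (ae_of_all _ fun z => hA _)

lemma Tk_bound {N : ℕ} {k h : Eu N → ℝ} (hk : Integrable k) (hk0 : ∀ z, 1 ≤ ‖z‖ → k z = 0) {A : ℝ}
    {r : ℝ} {x : Eu N} (hA : ∀ z, ‖z‖ < 1 → |h (x + r • z)| ≤ A) :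
    |Tk k h r x| ≤ A * ∫ z, |k z| := by
  unfold Tk
  rw [← Real.norm_eq_abs, ← integral_const_mul]
  refine norm_integral_le_of_norm_le (hk.abs.const_mul A) (ae_of_all _ fun z => ?_)
  rw [norm_mul, Real.norm_eq_abs, Real.norm_eq_abs]
  rcases lt_or_ge ‖z‖ 1 with h1 | h1
  · gcongr; exact hA z h1
  · rw [hk0 z h1]; simp

lemma Tk_measurable {N : ℕ} {k h : Eu N → ℝ} (mk : Measurable k) (mh : Measurable h) (x : Eu N) :
    Measurable (fun r => Tk k h r x) := by
  have : StronglyMeasurable (Function.uncurry fun (r : ℝ) (z : Eu N) => h (x + r • z) * k z) :=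
    ((mh.comp (by fun_prop : Measurable fun p : ℝ × Eu N => x + p.1 • p.2)).mul
      (mk.comp measurable_snd)).stronglyMeasurable
  exact this.integral_prod_right.measurable

lemma Tk_lip {N : ℕ} {k h : Eu N → ℝ} {K : NNReal} (hk : LipschitzWith K k)
    (hk0 : ∀ z, 1 ≤ ‖z‖ → k z = 0) (mh : Measurable h) {A : ℝ}
    (hA : ∀ x, |h x| ≤ A) {r : ℝ} (hr : 0 < r) (x x' : Eu N) :
    |Tk k h r x - Tk k h r x'| ≤
      (A * K * (2 * (volume : Measure (Eu N)).real (closedBall 0 1))) * (r⁻¹ * ‖x - x'‖) := by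
  have hki : Integrable k := hk.continuous.integrable_of_hasCompactSupport (compact_of_zero hk0)
  have hA0 : 0 ≤ A := (abs_nonneg _).trans (hA x)
  set v : Eu N := r⁻¹ • (x - x') with hv
  have hvn : ‖v‖ = r⁻¹ * ‖x - x'‖ := by rw [hv, norm_smul, Real.norm_of_nonneg (inv_nonneg.2 hr.le)]
  have e : Tk k h r x' = ∫ z, h (x + r • z) * k (z + v) := by
    unfold Tk
    rw [← integral_add_right_eq_self (μ := (volume : Measure (Eu N))) (fun z => h (x' + r • z) * k z) v]
    congr 1; ext z
    congr 2
    rw [hv, smul_add, smul_smul, mul_inv_cancel₀ hr.ne', one_smul]; abel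
  have i2 : Integrable (fun z => h (x + r • z) * k (z + v)) :=
    Tk_integrable (hki.comp_add_right v) mh hA r x
  rw [e]; unfold Tk
  rw [← integral_sub (Tk_integrable hki mh hA r x) i2, ← hvn, ← Real.norm_eq_abs]
  have hind (c : Eu N) : Integrable ((closedBall c 1).indicator (fun _ => (1:ℝ))) :=
    (integrable_indicator_iff measurableSet_closedBall).2
        (integrableOn_const (by exact measure_closedBall_lt_top.ne))
  have h_integ (c : Eu N) : ∫ z, (closedBall c 1).indicator (fun _ => (1:ℝ)) z =
      (volume : Measure (Eu N)).real (closedBall 0 1) := by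
    rw [integral_indicator measurableSet_closedBall, setIntegral_const, smul_eq_mul, mul_one]
    simp only [Measure.real, Measure.addHaar_closedBall_center]
  have : ∫ z, (A * K * ‖v‖) * ((closedBall 0 1).indicator (fun _ => (1:ℝ)) z +
      (closedBall (-v) 1).indicator (fun _ => (1:ℝ)) z) =
      (A * K * (2 * (volume : Measure (Eu N)).real (closedBall 0 1))) * ‖v‖ := by
    rw [integral_const_mul, integral_add (hind _) (hind _), h_integ, h_integ]; ring
  rw [← this]
  refine norm_integral_le_of_norm_le (((hind _).add (hind _)).const_mul _) (ae_of_all _ fun z => ?_)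
  rw [← mul_sub, norm_mul, Real.norm_eq_abs, Real.norm_eq_abs]
  have hkd : |k z - k (z + v)| ≤ K * ‖v‖ := by
    have := hk.dist_le_mul z (z + v)
    rwa [Real.dist_eq, dist_eq_norm, show z - (z + v) = -v by abel, norm_neg] at this
  have p0 (c : Eu N) : 0 ≤ (closedBall c 1).indicator (fun _ => (1:ℝ)) z :=
    indicator_nonneg (fun _ _ => zero_le_one) _
  by_cases h1 : 1 ≤ ‖z‖ ∧ 1 ≤ ‖z + v‖
  · rw [hk0 _ h1.1, hk0 _ h1.2]; simp
    have := p0 0; have := p0 (-v); positivity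
  · have h2 : 1 ≤ (closedBall 0 1).indicator (fun _ => (1:ℝ)) z +
      (closedBall (-v) 1).indicator (fun _ => (1:ℝ)) z := by
      rw [not_and_or, not_le, not_le] at h1
      rcases h1 with h1 | h1
      · rw [indicator_of_mem (s := closedBall (0 : Eu N) 1) (by simpa using h1.le)]
        linarith [p0 (-v)]
      · rw [indicator_of_mem (s := closedBall (-v) 1)
          (by rw [mem_closedBall, dist_eq_norm, sub_neg_eq_add]; exact h1.le)]
        linarith [p0 0]
    calc |h (x + r • z)| * |k z - k (z + v)| ≤ A * (K * ‖v‖) :=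
          mul_le_mul (hA _) hkd (abs_nonneg _) hA0
      _ = (A * K * ‖v‖) * 1 := by ring
      _ ≤ _ := by gcongr

lemma Rho_int {N : ℕ} : Integrable (Rho : Eu N → ℝ) :=
  Rho_contDiff.continuous.integrable_of_hasCompactSupport Rho_compact
lemma Psi_int {N : ℕ} : Integrable (Psi : Eu N → ℝ) :=
  Psi_contDiff.continuous.integrable_of_hasCompactSupport Psi_compact

/-- Lebesgue points. -/
lemma Tk_leb {N : ℕ} {u : Eu N → ℝ} (mu : Measurable u) {A : ℝ} (hA : ∀ x, |u x| ≤ A) :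
    ∀ᵐ x, Tendsto (fun ε => Tk Rho u ε x) (𝓝[>] 0) (𝓝 (CR N * u x)) := by
  have hloc : LocallyIntegrable u := by
    refine (locallyIntegrable_const (A:ℝ)).mono mu.aestronglyMeasurable (ae_of_all _ fun x => ?_)
    rw [Real.norm_eq_abs, Real.norm_eq_abs]
    exact (hA x).trans (le_abs_self A)
  filter_upwards [IsUnifLocDoublingMeasure.ae_tendsto_average_norm_sub volume hloc 1] with x hx
  have h1 := hx (l := 𝓝[>] (0:ℝ)) (fun _ => x) (fun ε => ε) tendsto_id (by
    filter_upwards [self_mem_nhdsWithin] with ε hε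
    rw [one_mul]; exact mem_closedBall_self (le_of_lt hε))
  set V := (volume : Measure (Eu N)).real (closedBall 0 1)
  rw [tendsto_iff_norm_sub_tendsto_zero]
  refine squeeze_zero' (Eventually.of_forall fun _ => norm_nonneg _) ?_
    (by simpa using h1.const_mul (10 * V))
  filter_upwards [self_mem_nhdsWithin] with ε hε
  have hε : 0 < ε := hε
  have e1 : Tk Rho u ε x - CR N * u x = Tk Rho (fun y => u y - u x) ε x := by
    have i1 := Tk_integrable Rho_int mu hA ε x
    unfold Tk CR
    rw [mul_comm, ← integral_const_mul, ← integral_sub i1 (Rho_int.const_mul _)]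
    congr 1; ext z; ring
  rw [e1, Tk_change _ _ hε, ← integral_const_mul]
  have e2 : (10 * V) * ⨍ y in closedBall x ε, ‖u y - u x‖ =
      ∫ y, (closedBall x ε).indicator (fun y => (ε⁻¹)^N * 10 * ‖u y - u x‖) y := by
    rw [integral_indicator measurableSet_closedBall, integral_const_mul, setAverage_eq, smul_eq_mul]
    have : (volume : Measure (Eu N)).real (closedBall x ε) = ε ^ N * V := by
      have := Measure.addHaar_real_closedBall' (volume : Measure (Eu N)) x hε.le
      rw [this, finrank_euclideanSpace_fin]
    rw [this]
    have hV : 0 < V := by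
      have := measure_closedBall_pos (volume : Measure (Eu N)) 0 one_pos
      exact ENNReal.toReal_pos this.ne' measure_closedBall_lt_top.ne
    rw [inv_pow]
    field_simp
  change _ ≤ (10 * V) * ⨍ y in closedBall x ε, ‖u y - u x‖
  rw [e2]
  refine norm_integral_le_of_norm_le ?_ (ae_of_all _ fun y => ?_)
  · rw [integrable_indicator_iff measurableSet_closedBall]
    have : IntegrableOn (fun y => ‖u y - u x‖) (closedBall x ε) :=
      ((hloc.integrableOn_isCompact (isCompact_closedBall x ε)).sub
        (integrableOn_const (by exact measure_closedBall_lt_top.ne))).norm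
    exact this.const_mul _
  · by_cases hy : y ∈ closedBall x ε
    · rw [indicator_of_mem hy, norm_mul, norm_mul, Real.norm_of_nonneg (by positivity),
        Real.norm_of_nonneg (Rho_nonneg _)]
      have := Rho_le (ε⁻¹ • (y - x))
      calc ε⁻¹ ^ N * (‖u y - u x‖ * Rho (ε⁻¹ • (y - x))) ≤ ε⁻¹ ^ N * (‖u y - u x‖ * 10) := by gcongr
        _ = _ := by ring
    · rw [indicator_of_notMem hy, Rho_zero]
      · simp
      · rw [mem_closedBall, not_le, dist_eq_norm] at hy
        rw [norm_smul, Real.norm_of_nonneg (inv_nonneg.2 hε.le), ← inv_mul_cancel₀ hε.ne']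
        gcongr

lemma Tk_ii {N : ℕ} {F : Eu N → ℝ} (mF : Measurable F) {B : ℝ} (hB : ∀ x, |F x| ≤ B) (x : Eu N)
    (a b : ℝ) : IntervalIntegrable (fun r => r * Tk Psi F r x) volume a b := by
  have h1 : IntervalIntegrable (fun r => Tk Psi F r x) volume a b := by
    refine (intervalIntegrable_const (c := B * ∫ z : Eu N, |Psi z|)).mono_fun
      (Tk_measurable Psi_contDiff.continuous.measurable mF x).aestronglyMeasurable
      (ae_of_all _ fun r => ?_)
    change |Tk Psi F r x| ≤ abs (B * ∫ z : Eu N, |Psi z|)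
    exact (Tk_bound Psi_int (fun _ => Psi_zero) fun z _ => hB _).trans (le_abs_self _)
  exact h1.continuousOn_mul continuousOn_id

lemma rep_tendsto {N : ℕ} {G : Set (Eu N)} {u F : Eu N → ℝ} (mu : Measurable u) {A B : ℝ}
    (hA : ∀ x, |u x| ≤ A) (mF : Measurable F) (hBF : ∀ x, |F x| ≤ B)
    (hD : DistSol G u F) {x : Eu N} {R : ℝ} (hR : 0 < R) (hB : closedBall x R ⊆ G) :
    Tendsto (fun ε => Tk Rho u ε x) (𝓝[>] 0)
      (𝓝 (Tk Rho u R x + ∫ r in (0:ℝ)..R, r * Tk Psi F r x)) := by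
  have hc := intervalIntegral.continuous_primitive (μ := volume) (Tk_ii mF hBF x) 0
  have h1 : Tendsto (fun ε => Tk Rho u R x + ((∫ r in (0:ℝ)..R, r * Tk Psi F r x) -
      ∫ r in (0:ℝ)..ε, r * Tk Psi F r x)) (𝓝[>] 0)
      (𝓝 (Tk Rho u R x + ∫ r in (0:ℝ)..R, r * Tk Psi F r x)) := by
    have := ((tendsto_const_nhds (x := ∫ r in (0:ℝ)..R, r * Tk Psi F r x)).sub
      ((hc.tendsto 0).mono_left (nhdsWithin_le_nhds (s := Ioi 0)))).const_add (Tk Rho u R x)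
    simpa using this
  refine h1.congr' ?_
  filter_upwards [Ioo_mem_nhdsGT hR] with ε hε
  have := rep_two mu hA hD hε.1 hε.2.le hB
  rw [intervalIntegral.integral_interval_sub_left (Tk_ii mF hBF x _ _) (Tk_ii mF hBF x _ _)]
  linarith

lemma Tk_congr {N : ℕ} {k h h' : Eu N → ℝ} (hk0 : ∀ z, 1 ≤ ‖z‖ → k z = 0) {r : ℝ} {x : Eu N}
    (hh : ∀ z, ‖z‖ < 1 → h (x + r • z) = h' (x + r • z)) : Tk k h r x = Tk k h' r x := by
  unfold Tk
  congr 1; ext z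
  rcases lt_or_ge ‖z‖ 1 with h1 | h1
  · rw [hh z h1]
  · rw [hk0 z h1]; simp

/-- precise representative -/
def vl {N : ℕ} (u : Eu N → ℝ) (x : Eu N) : ℝ :=
  (CR N)⁻¹ * limUnder (𝓝[>] (0:ℝ)) (fun ε => Tk Rho u ε x)

lemma reg_local (N : ℕ) : ∃ κ : ℝ, 0 ≤ κ ∧ ∀ (R A B : ℝ) (x0 : Eu N) (u F : Eu N → ℝ), 0 < R → 0 ≤ A →
    0 ≤ B → Measurable u → Measurable F → (∀ x ∈ ball x0 (3 * R), |u x| ≤ A) →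
    (∀ x ∈ ball x0 (3 * R), |F x| ≤ B) → DistSol (ball x0 (3 * R)) u F →
    (∀ x ∈ ball x0 R, ∀ x' ∈ ball x0 R, |vl u x - vl u x'| ≤ κ * (A / R + B * R) * ‖x - x'‖) ∧
    (∀ᵐ x, x ∈ ball x0 R → u x = vl u x) ∧
    (∀ x ∈ ball x0 R, CR N * vl u x = Tk Rho u R x + ∫ r in (0:ℝ)..R, r * Tk Psi F r x) := by
  obtain ⟨K1, hK1⟩ := Rho_contDiff.lipschitzWith_of_hasCompactSupport (Rho_compact (N := N)) (by norm_num)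
  obtain ⟨K2, hK2⟩ := Psi_contDiff.lipschitzWith_of_hasCompactSupport (Psi_compact (N := N)) (by norm_num)
  set V := (volume : Measure (Eu N)).real (closedBall 0 1) with hVdef
  have hV0 : 0 ≤ V := measureReal_nonneg
  have hCR := CR_pos N
  refine ⟨(CR N)⁻¹ * (2 * V) * (K1 + K2), by positivity, ?_⟩
  intro R A B x0 u F hR hA0 hB0 mu mF hA hB hD
  set S := ball x0 (3 * R) with hS
  set u' := S.indicator u
  set F' := S.indicator F
  have mu' : Measurable u' := mu.indicator measurableSet_ball
  have mF' : Measurable F' := mF.indicator measurableSet_ball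
  have hA' (x) : |u' x| ≤ A := by
    by_cases h : x ∈ S
    · simp only [u', indicator_of_mem h]; exact hA x h
    · simp only [u', indicator_of_notMem h]; simpa
  have hB' (x) : |F' x| ≤ B := by
    by_cases h : x ∈ S
    · simp only [F', indicator_of_mem h]; exact hB x h
    · simp only [F', indicator_of_notMem h]; simpa
  have hD' : DistSol S u' F' := hD.congr_ae (ae_of_all _ fun x hx => indicator_of_mem hx _)
    (ae_of_all _ fun x hx => indicator_of_mem hx _)
  have hmem {x : Eu N} (hx : x ∈ ball x0 R) {r : ℝ} (hr0 : 0 ≤ r) (hr : r ≤ R) {z : Eu N} (hz : ‖z‖ < 1) :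
      x + r • z ∈ S := by
    rw [hS, mem_ball, dist_eq_norm]
    rw [mem_ball, dist_eq_norm] at hx
    calc ‖x + r • z - x0‖ = ‖(x - x0) + r • z‖ := by congr 1; abel
      _ ≤ ‖x - x0‖ + r * ‖z‖ := by
        refine (norm_add_le _ _).trans ?_
        rw [norm_smul, Real.norm_of_nonneg hr0]
      _ < 3 * R := by nlinarith [norm_nonneg z]
  have hcu {x : Eu N} (hx : x ∈ ball x0 R) {r : ℝ} (hr0 : 0 ≤ r) (hr : r ≤ R) :
      Tk Rho u' r x = Tk Rho u r x :=
    Tk_congr (fun _ => Rho_zero) fun z hz => indicator_of_mem (hmem hx hr0 hr hz) _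
  have hcF {x : Eu N} (hx : x ∈ ball x0 R) {r : ℝ} (hr0 : 0 ≤ r) (hr : r ≤ R) :
      Tk Psi F' r x = Tk Psi F r x :=
    Tk_congr (fun _ => Psi_zero) fun z hz => indicator_of_mem (hmem hx hr0 hr hz) _
  have hcl {x : Eu N} (hx : x ∈ ball x0 R) : closedBall x R ⊆ S := by
    intro y hy
    rw [hS, mem_ball]
    rw [mem_ball] at hx
    rw [mem_closedBall] at hy
    linarith [dist_triangle y x x0]
  have h_integ {x : Eu N} (hx : x ∈ ball x0 R) : ∫ r in (0:ℝ)..R, r * Tk Psi F' r x =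
      ∫ r in (0:ℝ)..R, r * Tk Psi F r x := by
    apply intervalIntegral.integral_congr
    intro r hr
    rw [uIcc_of_le hR.le] at hr
    simp only
    rw [hcF hx hr.1 hr.2]
  have hev {x : Eu N} (hx : x ∈ ball x0 R) : (fun ε => Tk Rho u' ε x) =ᶠ[𝓝[>] (0:ℝ)] fun ε => Tk Rho u ε x := by
    filter_upwards [Ioo_mem_nhdsGT hR] with ε hε
    exact hcu hx hε.1.le hε.2.le
  have hlim {x : Eu N} (hx : x ∈ ball x0 R) : CR N * vl u x = Tk Rho u' R x + ∫ r in (0:ℝ)..R, r * Tk Psi F' r x := by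
    have := (rep_tendsto mu' hA' mF' hB' hD' hR (hcl hx)).congr' (hev hx)
    unfold vl
    rw [this.limUnder_eq]
    field_simp
  refine ⟨?_, ?_, fun x hx => ?_⟩
  · intro x hx x' hx'
    have h1 := Tk_lip hK1 (fun _ => Rho_zero) mu' hA' hR x x'
    have h2 : |(∫ r in (0:ℝ)..R, r * Tk Psi F' r x) - ∫ r in (0:ℝ)..R, r * Tk Psi F' r x'| ≤
        (B * K2 * (2 * V) * ‖x - x'‖) * |R - 0| := by
      rw [← intervalIntegral.integral_sub (Tk_ii mF' hB' _ _ _) (Tk_ii mF' hB' _ _ _), ← Real.norm_eq_abs]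
      refine intervalIntegral.norm_integral_le_of_norm_le_const fun r hr => ?_
      rw [uIoc_of_le hR.le] at hr
      have := Tk_lip hK2 (fun _ => Psi_zero) mF' hB' hr.1 x x'
      rw [← hVdef] at this
      rw [← mul_sub, norm_mul, Real.norm_of_nonneg hr.1.le, Real.norm_eq_abs]
      calc r * _ ≤ r * _ := mul_le_mul_of_nonneg_left this hr.1.le
        _ = _ := by have := hr.1.ne'; field_simp
    rw [sub_zero, abs_of_pos hR] at h2
    have h3 : |CR N * vl u x - CR N * vl u x'| ≤ (2 * V) * (K1 + K2) * (A / R + B * R) * ‖x - x'‖ := by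
      rw [hlim hx, hlim hx', add_sub_add_comm]
      refine (abs_add_le _ _).trans ((add_le_add h1 h2).trans ?_)
      rw [← hVdef]
      have e : (2 * V) * (K1 + K2) * (A / R + B * R) * ‖x - x'‖ = A * K1 * (2 * V) * (R⁻¹ * ‖x - x'‖) +
        B * K2 * (2 * V) * ‖x - x'‖ * R + (2 * V * ‖x - x'‖ * (K1 * (B * R) + K2 * (A / R))) := by
        field_simp; ring
      rw [e]
      have : 0 ≤ 2 * V * ‖x - x'‖ * (K1 * (B * R) + K2 * (A / R)) := by positivity
      linarith
    rw [← mul_sub, abs_mul, abs_of_pos hCR] at h3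
    calc |vl u x - vl u x'| = (CR N)⁻¹ * (CR N * |vl u x - vl u x'|) := by field_simp
      _ ≤ (CR N)⁻¹ * ((2 * V) * (K1 + K2) * (A / R + B * R) * ‖x - x'‖) := by gcongr
      _ = _ := by ring
  · filter_upwards [Tk_leb mu' hA'] with x hx hxb
    have h1 := (hx.congr' (hev hxb)).limUnder_eq
    unfold vl
    rw [h1]
    have : u' x = u x := indicator_of_mem (ball_subset_ball (by linarith) hxb) _
    rw [this]; field_simp
  · rw [hlim hx, h_integ hx, hcu hx hR.le le_rfl]
end

open Set Metric MeasureTheory Real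
noncomputable section
open Filter Topology

lemma nonneg_of_ae {N : ℕ} {S : Set (Eu N)} (hS : IsOpen S) {g : Eu N → ℝ} (hg : ContinuousOn g S)
    (h : ∀ᵐ x, x ∈ S → 0 ≤ g x) : ∀ x ∈ S, 0 ≤ g x := by
  intro x hx
  by_contra hlt
  have ho : IsOpen (S ∩ g ⁻¹' Iio 0) := hg.isOpen_inter_preimage hS isOpen_Iio
  have hz : volume (S ∩ g ⁻¹' Iio 0) = 0 := by
    refine measure_mono_null (fun y hy => ?_) (ae_iff.1 h)
    simp only [mem_setOf_eq, not_forall]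
    exact ⟨hy.1, not_le.2 hy.2⟩
  have := ho.measure_eq_zero_iff volume |>.1 hz
  exact (this ▸ (⟨hx, not_le.1 hlt⟩ : x ∈ S ∩ g ⁻¹' Iio 0) : x ∈ (∅ : Set (Eu N)))

lemma lip_continuousOn {N : ℕ} {S : Set (Eu N)} {g : Eu N → ℝ} {L : ℝ}
    (h : ∀ x ∈ S, ∀ y ∈ S, |g x - g y| ≤ L * ‖x - y‖) : ContinuousOn g S := by
  have : LipschitzOnWith (Real.toNNReal L) g S := by
    refine LipschitzOnWith.of_dist_le_mul fun x hx y hy => ?_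
    rw [Real.dist_eq, dist_eq_norm]
    refine (h x hx y hy).trans ?_
    gcongr
    exact Real.le_coe_toNNReal L
  exact this.continuousOn

lemma limit_solution {N : ℕ} {Ω : Set (Eu N)} (hΩ : IsOpen Ω) (hΩb : Bornology.IsBounded Ω)
    (hne : Ωᶜ.Nonempty) {ub lb : Eu N → ℝ}
    (hub : ContDiffOn ℝ 2 ub Ω) (hlb : ContDiffOn ℝ 2 lb Ω) (mub : Measurable ub)
    (h0 : ∀ x ∈ Ω, 0 ≤ lb x) (hlt : ∀ x ∈ Ω, lb x < ub x) {f : Eu N → ℝ → ℝ}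
    (mf : Measurable (Function.uncurry f)) (f0 : ∀ x, f x 0 = 0)
    (hsup : ∀ x ∈ Ω, f x (ub x) ≤ -lap ub x) (hsub : ∀ x ∈ Ω, -lap lb x ≤ f x (lb x))
    (hlip : ∀ Q : Set (Eu N), IsCompact Q → Q ⊆ Ω → ∀ B : ℝ, ∃ L : ℝ, 0 ≤ L ∧ ∀ x ∈ Q, ∀ a ∈ Icc 0 B,
      ∀ b ∈ Icc 0 B, |f x a - f x b| ≤ L * |a - b|) :
    ∃ U : Eu N → ℝ, (∀ x ∈ Ω, lb x ≤ U x ∧ U x ≤ ub x) ∧ ∀ x0 ∈ Ω, ∃ R > 0, ∃ L : ℝ, 0 ≤ L ∧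
      ball x0 R ⊆ Ω ∧ (∀ x ∈ ball x0 R, ∀ y ∈ ball x0 R, |U x - U y| ≤ L * ‖x - y‖) ∧
      DistSol (ball x0 R) U (fun x => f x (U x)) := by
  obtain ⟨κ, hκ, hreg⟩ := reg_local N
  set δ : Eu N → ℝ := fun x => infDist x Ωᶜ with hδ
  have hδpos {x} (hx : x ∈ Ω) : 0 < δ x := by
    rw [hδ, ← hΩ.isClosed_compl.notMem_iff_infDist_pos hne]; simpa using hx
  set Q : ℕ → Set (Eu N) := fun n => {x | 1 / ((n:ℝ) + 1) ≤ δ x} with hQ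
  have hQΩ (n) : Q n ⊆ Ω := by
    intro x hx
    by_contra h
    have : δ x = 0 := infDist_zero_of_mem (by exact h)
    have h2 : 1 / ((n:ℝ) + 1) ≤ δ x := hx
    have : 0 < 1 / ((n:ℝ) + 1) := by positivity
    linarith
  have hQc (n) : IsCompact (Q n) :=
    Metric.isCompact_of_isClosed_isBounded (isClosed_le continuous_const (continuous_infDist_pt _))
      (hΩb.subset (hQΩ n))
  choose u mu hu hDu using fun n => penalized hΩ hub hlb mub h0 hlt mf f0 hsup hsub (hQc n) (hQΩ n)
    (hlip (Q n) (hQc n) (hQΩ n))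
  -- local estimates
  have hloc : ∀ x0 ∈ Ω, ∃ R > 0, ∃ L A B C : ℝ, ∃ n0 : ℕ, 0 ≤ L ∧ 0 ≤ C ∧ ball x0 R ⊆ Ω ∧
      (∀ x ∈ ball x0 R, ub x ≤ A) ∧ (∀ x ∈ ball x0 R, ∀ a ∈ Icc 0 A, ∀ b ∈ Icc 0 A,
        |f x a - f x b| ≤ C * |a - b|) ∧ ∀ n ≥ n0,
      (∀ x ∈ ball x0 R, ∀ y ∈ ball x0 R, |vl (u n) x - vl (u n) y| ≤ L * ‖x - y‖) ∧
      (∀ᵐ x, x ∈ ball x0 R → u n x = vl (u n) x) ∧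
      DistSol (ball x0 R) (u n) (fun x => f x (u n x)) ∧
      (∀ x ∈ ball x0 R, lb x ≤ u n x ∧ u n x ≤ ub x) ∧
      (∀ x ∈ ball x0 R, lb x ≤ vl (u n) x ∧ vl (u n) x ≤ ub x) ∧
      (∀ x ∈ ball x0 R, |f x (u n x)| ≤ B) := by
    intro x0 hx0
    have hd := hδpos hx0
    set R := δ x0 / 8 with hR
    have hR0 : 0 < R := by positivity
    have hcb {y} (hy : y ∈ closedBall x0 (3 * R)) : δ x0 / 2 ≤ δ y := by
      have := infDist_le_infDist_add_dist (s := Ωᶜ) (x := x0) (y := y)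
      rw [mem_closedBall, dist_comm] at hy
      simp only [hδ] at *
      linarith
    have hcΩ : closedBall x0 (3 * R) ⊆ Ω := by
      intro y hy
      by_contra h
      have h1 : δ y = 0 := infDist_zero_of_mem (by exact h)
      have := hcb hy
      linarith
    obtain ⟨A, hA0, hA⟩ := compact_bound (isCompact_closedBall x0 (3 * R)) (hub.continuousOn.mono hcΩ)
    obtain ⟨C, hC0, hC⟩ := hlip _ (isCompact_closedBall x0 (3 * R)) hcΩ A
    obtain ⟨n0, hn0⟩ := exists_nat_one_div_lt (half_pos hd)
    have hb1 : ball x0 R ⊆ ball x0 (3 * R) := ball_subset_ball (by linarith)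
    have hb3 : ball x0 (3 * R) ⊆ Ω := ball_subset_closedBall.trans hcΩ
    refine ⟨R, hR0, κ * (A / R + (C * A) * R), A, C * A, C, n0, by positivity, hC0, hb1.trans hb3, ?_, ?_, ?_⟩
    · exact fun x hx => (le_abs_self _).trans (hA x (ball_subset_closedBall (hb1 hx)))
    · exact fun x hx => hC x (ball_subset_closedBall (hb1 hx))
    intro n hn
    have hbQ : ball x0 (3 * R) ⊆ Q n := by
      intro y hy
      have h1 := hcb (ball_subset_closedBall hy)
      have h2 : 1 / ((n:ℝ) + 1) ≤ 1 / ((n0:ℝ) + 1) := by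
        have : (n0:ℝ) ≤ n := by exact_mod_cast hn
        gcongr
      show 1 / ((n:ℝ) + 1) ≤ δ y
      linarith
    have hbI : ball x0 (3 * R) ⊆ interior (Q n) := interior_maximal hbQ isOpen_ball
    have hun {x} (hx : x ∈ ball x0 (3 * R)) : u n x ∈ Icc 0 A :=
      ⟨(h0 x (hb3 hx)).trans (hu n x (hbQ hx)).1, (hu n x (hbQ hx)).2.trans ((le_abs_self _).trans (hA x (ball_subset_closedBall hx)))⟩
    have hF {x} (hx : x ∈ ball x0 (3 * R)) : |f x (u n x)| ≤ C * A := by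
      have := hC x (ball_subset_closedBall hx) _ (hun hx) 0 ⟨le_rfl, hA0⟩
      rw [f0, sub_zero, sub_zero, abs_of_nonneg (hun hx).1] at this
      exact this.trans (mul_le_mul_of_nonneg_left (hun hx).2 hC0)
    have mF : Measurable (fun x => f x (u n x)) := mf.comp (measurable_id.prodMk (mu n))
    have hDn := (hDu n).mono hbI
    obtain ⟨r1, r2, -⟩ := hreg R A (C * A) x0 (u n) (fun x => f x (u n x)) hR0 hA0 (by positivity) (mu n) mF
      (fun x hx => by rw [abs_of_nonneg (hun hx).1]; exact (hun hx).2) (fun x hx => hF hx) hDn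
    have hvc := lip_continuousOn r1
    have hbΩ := hb1.trans hb3
    refine ⟨r1, r2, hDn.mono hb1, fun x hx => hu n x (hbQ (hb1 hx)), fun x hx => ⟨?_, ?_⟩, fun x hx => hF (hb1 hx)⟩
    · have := nonneg_of_ae (g := fun x => vl (u n) x - lb x) isOpen_ball (hvc.sub (hlb.continuousOn.mono hbΩ))
        (by
          filter_upwards [r2] with y hy hyb
          rw [← hy hyb]
          linarith [(hu n y (hbQ (hb1 hyb))).1]) x hx
      linarith
    · have := nonneg_of_ae (g := fun x => ub x - vl (u n) x) isOpen_ball ((hub.continuousOn.mono hbΩ).sub hvc)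
        (by
          filter_upwards [r2] with y hy hyb
          rw [← hy hyb]
          linarith [(hu n y (hbQ (hb1 hyb))).2]) x hx
      linarith
  -- subsequence
  set d := TopologicalSpace.denseSeq (Eu N)
  set w : ℕ → ℕ → ℝ := fun n k => max 0 (min (vl (u n) (d k)) (max 0 (ub (d k))))
  have hwc : IsCompact (univ.pi fun k => Icc (0:ℝ) (max 0 (ub (d k)))) :=
    isCompact_univ_pi fun k => isCompact_Icc
  obtain ⟨l, -, φ, hφ, hl⟩ := hwc.tendsto_subseq (x := w) (fun n k _ =>
    ⟨le_max_left _ _, max_le (le_max_left _ _) (min_le_right _ _)⟩)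
  rw [tendsto_pi_nhds] at hl
  have hconv : ∀ x ∈ Ω, ∃ l, Tendsto (fun n => vl (u (φ n)) x) atTop (𝓝 l) := by
    intro x hx
    obtain ⟨R, hR, L, A, B, C, n0, hL, hC, hbΩ, hA, hf, hn⟩ := hloc x hx
    apply cauchySeq_tendsto_of_complete
    rw [Metric.cauchySeq_iff]
    intro ε hε
    obtain ⟨k, hk⟩ := (TopologicalSpace.denseRange_denseSeq (Eu N)).exists_dist_lt x
      (lt_min hR (show 0 < ε / 3 / (L + 1) by positivity))
    have hkb : d k ∈ ball x R := by rw [mem_ball, dist_comm]; exact hk.trans_le (min_le_left _ _)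
    have hkd : L * ‖x - d k‖ < ε / 3 := by
      have : ‖x - d k‖ < ε / 3 / (L + 1) := by rw [← dist_eq_norm]; exact hk.trans_le (min_le_right _ _)
      rw [lt_div_iff₀ (by positivity)] at this
      nlinarith [norm_nonneg (x - d k)]
    obtain ⟨n1, hn1⟩ := Metric.cauchySeq_iff.1 (hl k).cauchySeq (ε / 3) (by positivity)
    refine ⟨max n0 n1, fun m hm n hn' => ?_⟩
    have hm0 : φ m ≥ n0 := (le_max_left _ _).trans (hm.trans (hφ.id_le m))
    have hn0 : φ n ≥ n0 := (le_max_left _ _).trans (hn'.trans (hφ.id_le n))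
    have hw {m} (hm0 : φ m ≥ n0) : w (φ m) k = vl (u (φ m)) (d k) := by
      have h1 := (hn _ hm0).2.2.2.2.1 _ hkb
      have h2 := (h0 _ (hbΩ hkb)).trans h1.1
      simp only [w]
      rw [min_eq_left (h1.2.trans (le_max_right _ _)), max_eq_right h2]
    have h1 := hn1 m ((le_max_right _ _).trans hm) n ((le_max_right _ _).trans hn')
    simp only [Function.comp] at h1
    rw [hw hm0, hw hn0, Real.dist_eq] at h1
    have h2 := (hn _ hm0).1 x (mem_ball_self hR) _ hkb
    have h3 := (hn _ hn0).1 x (mem_ball_self hR) _ hkb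
    rw [Real.dist_eq]
    rw [abs_le] at h2 h3
    rw [abs_lt] at h1 ⊢
    constructor <;> linarith
  set U : Eu N → ℝ := fun x => limUnder atTop (fun n => vl (u (φ n)) x)
  have hU (x) (hx : x ∈ Ω) : Tendsto (fun n => vl (u (φ n)) x) atTop (𝓝 (U x)) :=
    tendsto_nhds_limUnder (hconv x hx)
  have hev (n0 : ℕ) : ∀ᶠ n in atTop, φ n ≥ n0 := hφ.tendsto_atTop.eventually_ge_atTop n0
  have hbd : ∀ x ∈ Ω, lb x ≤ U x ∧ U x ≤ ub x := by
    intro x hx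
    obtain ⟨R, hR, L, A, B, C, n0, hL, hC, hbΩ, hA, hf, hn⟩ := hloc x hx
    constructor
    · refine ge_of_tendsto (hU x hx) ?_
      filter_upwards [hev n0] with n hn0 using ((hn _ hn0).2.2.2.2.1 x (mem_ball_self hR)).1
    · refine le_of_tendsto (hU x hx) ?_
      filter_upwards [hev n0] with n hn0 using ((hn _ hn0).2.2.2.2.1 x (mem_ball_self hR)).2
  refine ⟨U, hbd, fun x0 hx0 => ?_⟩
  obtain ⟨R, hR, L, A, B, C, n0, hL, hC, hbΩ, hA, hf, hn⟩ := hloc x0 hx0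
  refine ⟨R, hR, L, hL, hbΩ, fun x hx y hy => ?_, ?_⟩
  · refine le_of_tendsto ((hU x (hbΩ hx)).sub (hU y (hbΩ hy))).abs ?_
    filter_upwards [hev n0] with n hn0 using (hn _ hn0).1 x hx y hy
  intro ψ hψ hc hs
  have hae : ∀ᵐ x, x ∈ ball x0 R → Tendsto (fun n => u (φ n) x) atTop (𝓝 (U x)) := by
    have : ∀ᵐ x, ∀ n, φ n ≥ n0 → x ∈ ball x0 R → u (φ n) x = vl (u (φ n)) x := by
      rw [ae_all_iff]; intro n
      by_cases h : φ n ≥ n0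
      · filter_upwards [(hn _ h).2.1] with x hx _ using hx
      · exact ae_of_all _ fun x h' => absurd h' h
    filter_upwards [this] with x hx hxb
    refine (hU x (hbΩ hxb)).congr' ?_
    filter_upwards [hev n0] with n hn0 using (hx n hn0 hxb).symm
  have hlz {x} (hx : x ∉ ball x0 R) : lap ψ x = 0 :=
    image_eq_zero_of_notMem_tsupport (f := lap ψ) (fun h => hx (hs (tsupport_lap h)))
  have hz {x} (hx : x ∉ ball x0 R) : ψ x = 0 := image_eq_zero_of_notMem_tsupport fun h => hx (hs h)
  have mF (n) : Measurable (fun x => f x (u n x)) := mf.comp (measurable_id.prodMk (mu n))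
  have t1 : Tendsto (fun n => ∫ x, u (φ n) x * lap ψ x) atTop (𝓝 (∫ x, U x * lap ψ x)) := by
    refine tendsto_integral_filter_of_dominated_convergence (fun x => A * |lap ψ x|)
      (Eventually.of_forall fun n => ((mu _).mul (lap_measurable ψ)).aestronglyMeasurable) ?_ ?_ ?_
    · filter_upwards [hev n0] with n hn0
      refine ae_of_all _ fun x => ?_
      rw [norm_mul, Real.norm_eq_abs, Real.norm_eq_abs]
      by_cases hx : x ∈ ball x0 R
      · have h1 := (hn _ hn0).2.2.2.1 x hx
        rw [abs_of_nonneg ((h0 _ (hbΩ hx)).trans h1.1)]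
        gcongr
        exact h1.2.trans (hA x hx)
      · rw [hlz hx]; simp
    · exact ((lap_continuous hψ).integrable_of_hasCompactSupport (lap_compact hc)).abs.const_mul A
    · filter_upwards [hae] with x hx
      by_cases hxb : x ∈ ball x0 R
      · exact (hx hxb).mul_const _
      · rw [hlz hxb]; simp
  have t2 : Tendsto (fun n => ∫ x, f x (u (φ n) x) * ψ x) atTop (𝓝 (∫ x, f x (U x) * ψ x)) := by
    refine tendsto_integral_filter_of_dominated_convergence (fun x => B * |ψ x|)
      (Eventually.of_forall fun n => ((mF _).mul hψ.continuous.measurable).aestronglyMeasurable) ?_ ?_ ?_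
    · filter_upwards [hev n0] with n hn0
      refine ae_of_all _ fun x => ?_
      rw [norm_mul, Real.norm_eq_abs, Real.norm_eq_abs]
      by_cases hx : x ∈ ball x0 R
      · gcongr
        exact (hn _ hn0).2.2.2.2.2 x hx
      · rw [hz hx]; simp
    · exact (hψ.continuous.integrable_of_hasCompactSupport hc).abs.const_mul B
    · filter_upwards [hae] with x hx
      by_cases hxb : x ∈ ball x0 R
      · refine Tendsto.mul_const _ ?_
        rw [tendsto_iff_norm_sub_tendsto_zero]
        have h1 := (tendsto_iff_norm_sub_tendsto_zero.1 (hx hxb)).const_mul C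
        rw [mul_zero] at h1
        refine squeeze_zero' (Eventually.of_forall fun _ => norm_nonneg _) ?_ h1
        filter_upwards [hev n0] with n hn0
        have h2 := (hn _ hn0).2.2.2.1 x hxb
        have h3 := hbd x (hbΩ hxb)
        have h4 := h0 x (hbΩ hxb)
        have h5 := hA x hxb
        exact hf x hxb _ ⟨h4.trans h2.1, h2.2.trans h5⟩ _ ⟨h4.trans h3.1, h3.2.trans h5⟩
      · rw [hz hxb]; simp
  refine tendsto_nhds_unique t1 (t2.neg.congr' ?_)
  filter_upwards [hev n0] with n hn0
  exact ((hn _ hn0).2.2.1 ψ hψ hc hs).symm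
end

open Set Metric MeasureTheory Real
noncomputable section
open Filter Topology

lemma clm_sum {N : ℕ} (D : Eu N →L[ℝ] ℝ) :
    D = ∑ i, D (bv i) • (EuclideanSpace.proj i : Eu N →L[ℝ] ℝ) := by
  ext w
  have h := (EuclideanSpace.basisFun (Fin N) ℝ).sum_repr w
  conv_lhs => rw [← h]
  rw [map_sum, ContinuousLinearMap.sum_apply]
  refine Finset.sum_congr rfl fun i _ => ?_
  simp [mul_comm]

lemma Tk_conv {N : ℕ} (k h : Eu N → ℝ) {r : ℝ} (hr : 0 < r) :
    Tk k h r = MeasureTheory.convolution h (fun w => (r⁻¹) ^ N * k (-(r⁻¹ • w)))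
      (ContinuousLinearMap.mul ℝ ℝ) volume := by
  ext x
  rw [Tk_change _ _ hr, convolution_mul, ← integral_const_mul]
  congr 1; ext y
  rw [← smul_neg, neg_sub]; ring

lemma kern_compact {N : ℕ} {k : Eu N → ℝ} (hk : HasCompactSupport k) {r : ℝ} (hr : 0 < r) :
    HasCompactSupport (fun w => (r⁻¹) ^ N * k (-(r⁻¹ • w))) := by
  have h1 : HasCompactSupport (fun w : Eu N => k ((-r⁻¹) • w)) :=
    hk.comp_smul (neg_ne_zero.2 (inv_pos.2 hr).ne')
  have h2 := h1.mul_left (f := fun _ => (r⁻¹) ^ N)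
  have e : (fun w => (r⁻¹) ^ N * k (-(r⁻¹ • w))) = (fun _ => (r⁻¹) ^ N) * (fun w : Eu N => k ((-r⁻¹) • w)) := by
    ext w; simp
  rw [e]; exact h2

lemma Tk_contDiff {N : ℕ} {k h : Eu N → ℝ} {n : ℕ∞} (hk : ContDiff ℝ n k) (hc : HasCompactSupport k)
    (hh : Continuous h) {r : ℝ} (hr : 0 < r) : ContDiff ℝ n (Tk k h r) := by
  rw [Tk_conv k h hr]
  refine (kern_compact hc hr).contDiff_convolution_right _ hh.locallyIntegrable ?_
  exact contDiff_const.mul (hk.comp (f := fun w : Eu N => -(r⁻¹ • w)) (by fun_prop))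

lemma Tk_hasFDerivAt {N : ℕ} {k h : Eu N → ℝ} (hk : ContDiff ℝ 1 k) (hc : HasCompactSupport k)
    (hh : Continuous h) {r : ℝ} (hr : 0 < r) (x : Eu N) :
    HasFDerivAt (Tk k h r) (∑ i, (-(r⁻¹) * Tk (fun z => fderiv ℝ k z (bv i)) h r x) •
      (EuclideanSpace.proj i : Eu N →L[ℝ] ℝ)) x := by
  have hG : ContDiff ℝ 1 (fun w => (r⁻¹) ^ N * k (-(r⁻¹ • w))) :=
    contDiff_const.mul (hk.comp (f := fun w : Eu N => -(r⁻¹ • w)) (by fun_prop))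
  have hGc := kern_compact hc hr
  have h1 := hGc.hasFDerivAt_convolution_right (ContinuousLinearMap.mul ℝ ℝ)
    (μ := volume) hh.locallyIntegrable hG x
  rw [← Tk_conv k h hr] at h1
  refine h1.congr_fderiv ?_
  rw [clm_sum (MeasureTheory.convolution _ _ _ _ _)]
  refine Finset.sum_congr rfl fun i _ => ?_
  congr 1
  rw [convolution_precompR_apply _ hh.locallyIntegrable (hGc.fderiv ℝ) (hG.continuous_fderiv one_ne_zero),
    Tk_conv _ h hr, convolution_mul, convolution_mul, ← integral_const_mul]
  congr 1; ext y
  have h2 (w : Eu N) : HasFDerivAt (fun w => (r⁻¹) ^ N * k (-(r⁻¹ • w)))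
      ((r⁻¹)^N • ((fderiv ℝ k (-(r⁻¹ • w))).comp (-(r⁻¹ • ContinuousLinearMap.id ℝ (Eu N))))) w := by
    have h3 : HasFDerivAt (fun w : Eu N => -(r⁻¹ • w)) (-(r⁻¹ • ContinuousLinearMap.id ℝ (Eu N))) w :=
      ((hasFDerivAt_id w).const_smul r⁻¹).neg
    exact (((hk.differentiable one_ne_zero _).hasFDerivAt).comp w h3).const_mul _
  rw [(h2 _).fderiv]
  simp
  ring

/-- radial superposition -/
def Jk {N : ℕ} (a : ℝ → ℝ) (k g : Eu N → ℝ) (R : ℝ) (x : Eu N) : ℝ :=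
  ∫ r in (0:ℝ)..R, a r * Tk k g r x

lemma fderiv_zero_out {N : ℕ} {k : Eu N → ℝ} (hk0 : ∀ z, 1 < ‖z‖ → k z = 0) (i : Fin N) {z : Eu N} (hz : 1 < ‖z‖) :
    fderiv ℝ k z (bv i) = 0 := by
  have : k =ᶠ[𝓝 z] fun _ => 0 := by
    filter_upwards [(isOpen_lt continuous_const continuous_norm).mem_nhds hz] with w hw using hk0 w hw
  rw [this.fderiv_eq]; simp

lemma compact_of_zero' {N : ℕ} {k : Eu N → ℝ} (h : ∀ z, 1 < ‖z‖ → k z = 0) : HasCompactSupport k := by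
  refine HasCompactSupport.of_support_subset_isCompact (isCompact_closedBall 0 1) fun z hz => ?_
  rw [mem_closedBall_zero_iff]
  by_contra hh
  exact hz (h z (not_le.1 hh))

lemma integral_partial_zero {N : ℕ} {k : Eu N → ℝ} (hk : ContDiff ℝ 1 k) (hc : HasCompactSupport k) (i : Fin N) :
    ∫ z, fderiv ℝ k z (bv i) = 0 := by
  have hd : Continuous (fun z => fderiv ℝ k z (bv i)) :=
    (hk.continuous_fderiv one_ne_zero).clm_apply continuous_const
  have hci : HasCompactSupport (fun z => fderiv ℝ k z (bv i)) := hc.fderiv_apply (𝕜 := ℝ) _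
  have := integral_mul_fderiv_eq_neg_fderiv_mul_of_integrable (μ := (volume : Measure (Eu N)))
    (f := fun _ => (1:ℝ)) (g := k) (v := bv i) (by simp) (by simpa using hd.integrable_of_hasCompactSupport hci)
    (by simpa using hk.continuous.integrable_of_hasCompactSupport hc) (by fun_prop)
    (fun x _ => hk.differentiable one_ne_zero x)
  simpa using this

lemma Tk_osc {N : ℕ} {k g : Eu N → ℝ} (hk : Continuous k) (hk0 : ∀ z, 1 < ‖z‖ → k z = 0)
    (hm : ∫ z, k z = 0) {L : NNReal} (hg : LipschitzWith L g) {r : ℝ} (hr : 0 ≤ r) (x : Eu N) :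
    |Tk k g r x| ≤ L * r * ∫ z, |k z| := by
  have hc := compact_of_zero' hk0
  have hki : Integrable k := hk.integrable_of_hasCompactSupport hc
  have i1 : Integrable (fun z => g (x + r • z) * k z) := by
    have h1 : Continuous fun z => g (x + r • z) := hg.continuous.comp (by fun_prop)
    exact (h1.mul hk).integrable_of_hasCompactSupport hc.mul_left
  have e : Tk k g r x = ∫ z, (g (x + r • z) - g x) * k z := by
    simp_rw [sub_mul]
    rw [integral_sub i1 (hki.const_mul _), integral_const_mul, hm, mul_zero, sub_zero]; rfl
  rw [e, ← Real.norm_eq_abs, ← integral_const_mul]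
  refine norm_integral_le_of_norm_le (hki.abs.const_mul _) (ae_of_all _ fun z => ?_)
  rw [norm_mul, Real.norm_eq_abs, Real.norm_eq_abs]
  rcases le_or_gt ‖z‖ 1 with h | h
  · have h1 := hg.dist_le_mul (x + r • z) x
    rw [Real.dist_eq, dist_eq_norm, add_sub_cancel_left, norm_smul, Real.norm_of_nonneg hr] at h1
    gcongr
    refine h1.trans ?_
    have : r * ‖z‖ ≤ r * 1 := by gcongr
    calc (L:ℝ) * (r * ‖z‖) ≤ L * (r * 1) := by gcongr
      _ = _ := by ring
  · rw [hk0 z h]; simp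

lemma Jk_step {N : ℕ} {k g : Eu N → ℝ} (hk : ContDiff ℝ 1 k) (hk0 : ∀ z, 1 < ‖z‖ → k z = 0)
    {L : NNReal} (hg : LipschitzWith L g) {a : ℝ → ℝ} (ma : Measurable a) {a0 R : ℝ} (hR : 0 < R)
    (ha : ∀ r ∈ Ioc 0 R, |a r| ≤ a0) :
    (∀ x, HasFDerivAt (Jk a k g R) (∑ i, Jk (fun r => -(a r * r⁻¹)) (fun z => fderiv ℝ k z (bv i)) g R x •
      (EuclideanSpace.proj i : Eu N →L[ℝ] ℝ)) x) ∧
    ∀ i, Continuous (Jk (fun r => -(a r * r⁻¹)) (fun z => fderiv ℝ k z (bv i)) g R) := by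
  have hc := compact_of_zero' hk0
  have ha0 : 0 ≤ a0 := (abs_nonneg _).trans (ha R ⟨hR, le_rfl⟩)
  set ki : Fin N → Eu N → ℝ := fun i z => fderiv ℝ k z (bv i) with hki
  have kic (i) : Continuous (ki i) := (hk.continuous_fderiv one_ne_zero).clm_apply continuous_const
  have ki0 (i) (z : Eu N) (hz : 1 < ‖z‖) : ki i z = 0 := fderiv_zero_out hk0 i hz
  have kim (i) : ∫ z, ki i z = 0 := integral_partial_zero hk hc i
  have mg : Measurable g := hg.continuous.measurable
  set c : Fin N → Eu N → ℝ → ℝ := fun i x r => -(a r * r⁻¹) * Tk (ki i) g r x with hcdef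
  have cm (i x) : Measurable (c i x) :=
    (ma.mul measurable_inv).neg.mul (Tk_measurable (kic i).measurable mg x)
  have cb (i x) (r) (hr : r ∈ Ioc 0 R) : |c i x r| ≤ a0 * L * ∫ z, |ki i z| := by
    have h1 := Tk_osc (kic i) (ki0 i) (kim i) hg hr.1.le x
    have hI : 0 ≤ ∫ z, |ki i z| := integral_nonneg fun _ => abs_nonneg _
    simp only [hcdef]
    rw [abs_mul, abs_neg, abs_mul, abs_of_pos (inv_pos.2 hr.1)]
    calc |a r| * r⁻¹ * |Tk (ki i) g r x| ≤ a0 * r⁻¹ * (L * r * ∫ z, |ki i z|) := by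
          have := ha r hr
          have := inv_pos.2 hr.1
          gcongr
      _ = _ := by have := hr.1.ne'; field_simp
  have cii (i x) : IntervalIntegrable (c i x) volume 0 R := by
    rw [intervalIntegrable_iff, uIoc_of_le hR.le]
    refine Integrable.of_bound (C := a0 * L * ∫ z, |ki i z|) (cm i x).aestronglyMeasurable ?_
    filter_upwards [ae_restrict_mem measurableSet_Ioc] with r hr using cb i x r hr
  refine ⟨fun x => ?_, fun i => ?_⟩
  · have h := intervalIntegral.hasFDerivAt_integral_of_dominated_of_fderiv_le (𝕜 := ℝ) (μ := volume)
      (F := fun x r => a r * Tk k g r x) (a := 0) (b := R) (x₀ := x) (s := univ)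
      (F' := fun x r => ∑ i, c i x r • (EuclideanSpace.proj i : Eu N →L[ℝ] ℝ))
      (bound := fun _ => ∑ i, (a0 * L * ∫ z, |ki i z|) * ‖(EuclideanSpace.proj i : Eu N →L[ℝ] ℝ)‖)
      univ_mem
      (Eventually.of_forall fun x => (ma.mul (Tk_measurable hk.continuous.measurable mg x)).aestronglyMeasurable)
      ?_ ?_ ?_ intervalIntegrable_const ?_
    · rw [intervalIntegral.integral_finset_sum] at h
      · refine h.congr_fderiv (Finset.sum_congr rfl fun i _ => ?_)
        rw [intervalIntegral.integral_smul_const]; rfl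
      · intro i _
        exact ⟨Integrable.smul_const (cii i x).1 _, Integrable.smul_const (cii i x).2 _⟩
    · rw [intervalIntegrable_iff, uIoc_of_le hR.le]
      refine Integrable.of_bound (C := a0 * ((|g x| + L * R) * ∫ z, |k z|))
        (ma.mul (Tk_measurable hk.continuous.measurable mg x)).aestronglyMeasurable ?_
      filter_upwards [ae_restrict_mem measurableSet_Ioc] with r hr
      rw [norm_mul, Real.norm_eq_abs, Real.norm_eq_abs]
      have hki : Integrable k := hk.continuous.integrable_of_hasCompactSupport hc
      have h2 : |Tk k g r x| ≤ (|g x| + L * R) * ∫ z, |k z| := by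
        unfold Tk
        rw [← Real.norm_eq_abs, ← integral_const_mul]
        refine norm_integral_le_of_norm_le (hki.abs.const_mul _) (ae_of_all _ fun z => ?_)
        rw [norm_mul, Real.norm_eq_abs, Real.norm_eq_abs]
        rcases le_or_gt ‖z‖ 1 with h | h
        · have h1 := hg.dist_le_mul (x + r • z) x
          rw [Real.dist_eq, dist_eq_norm, add_sub_cancel_left, norm_smul, Real.norm_of_nonneg hr.1.le] at h1
          have h3 : r * ‖z‖ ≤ R * 1 := mul_le_mul hr.2 h (norm_nonneg _) hR.le
          have h4 : (L:ℝ) * (r * ‖z‖) ≤ L * (R * 1) := by gcongr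
          gcongr
          have := abs_sub_abs_le_abs_sub (g (x + r • z)) (g x)
          linarith
        · rw [hk0 z h]; simp
      have hI : 0 ≤ ∫ z, |k z| := integral_nonneg fun _ => abs_nonneg _
      exact mul_le_mul (ha r hr) h2 (abs_nonneg _) ha0
    · have : Measurable (fun r => ∑ i, c i x r • (EuclideanSpace.proj i : Eu N →L[ℝ] ℝ)) :=
        Finset.measurable_sum _ fun i _ => (cm i x).smul_const _
      exact this.aestronglyMeasurable
    · refine ae_of_all _ fun r hr x _ => ?_
      rw [uIoc_of_le hR.le] at hr
      refine norm_sum_le_of_le _ fun i _ => ?_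
      rw [norm_smul]
      gcongr
      exact cb i x r hr
    · refine ae_of_all _ fun r hr x _ => ?_
      rw [uIoc_of_le hR.le] at hr
      refine ((Tk_hasFDerivAt hk hc hg.continuous hr.1 x).const_mul (a r)).congr_fderiv ?_
      rw [Finset.smul_sum]
      refine Finset.sum_congr rfl fun i _ => ?_
      rw [smul_smul]
      simp only [hcdef]
      congr 1; ring
  · refine intervalIntegral.continuous_of_dominated_interval
      (fun x => (cm i x).aestronglyMeasurable) (bound := fun _ => a0 * L * ∫ z, |ki i z|)
      (fun x => ae_of_all _ fun r hr => ?_) intervalIntegrable_const (ae_of_all _ fun r hr => ?_)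
    · rw [uIoc_of_le hR.le] at hr; exact cb i x r hr
    · rw [uIoc_of_le hR.le] at hr
      refine continuous_const.mul ?_
      have := Tk_contDiff (n := 0) (k := ki i) (contDiff_zero.2 (kic i)) (compact_of_zero' (ki0 i)) hg.continuous hr.1
      exact this.continuous

lemma Jk_contDiff1 {N : ℕ} {k g : Eu N → ℝ} (hk : ContDiff ℝ 1 k) (hk0 : ∀ z, 1 < ‖z‖ → k z = 0)
    {L : NNReal} (hg : LipschitzWith L g) {a : ℝ → ℝ} (ma : Measurable a) {a0 R : ℝ} (hR : 0 < R)
    (ha : ∀ r ∈ Ioc 0 R, |a r| ≤ a0) : ContDiff ℝ 1 (Jk a k g R) := by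
  obtain ⟨h1, h2⟩ := Jk_step hk hk0 hg ma hR ha
  rw [contDiff_one_iff_hasFDerivAt]
  exact ⟨_, continuous_finsetSum _ fun i _ => (h2 i).smul continuous_const, h1⟩

lemma Jk_contDiff2 {N : ℕ} {k g : Eu N → ℝ} (hk : ContDiff ℝ 2 k) (hk0 : ∀ z, 1 < ‖z‖ → k z = 0)
    {L : NNReal} (hg : LipschitzWith L g) {R : ℝ} (hR : 0 < R) :
    ContDiff ℝ 2 (Jk (fun r => r) k g R) := by
  obtain ⟨h1, -⟩ := Jk_step (hk.of_le (by norm_num)) hk0 hg measurable_id hR (a0 := R) (a := fun r => r)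
    (fun r hr => by rw [abs_of_pos hr.1]; exact hr.2)
  rw [show (2 : WithTop ℕ∞) = ((1:ℕ):WithTop ℕ∞) + 1 by norm_num, contDiff_succ_iff_hasFDerivAt]
  refine ⟨_, ?_, h1⟩
  refine ContDiff.sum fun i _ => ?_
  suffices h : ContDiff ℝ ((1:ℕ):WithTop ℕ∞) (Jk (fun r => -(r * r⁻¹)) (fun z => (fderiv ℝ k z) (bv i)) g R) from
    h.smul contDiff_const
  refine Jk_contDiff1 (a0 := 1) ((hk.fderiv_right (m := 1) (by norm_num)).clm_apply contDiff_const)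
    (fun z hz => fderiv_zero_out hk0 i hz) hg (by fun_prop) hR fun r hr => ?_
  rw [mul_inv_cancel₀ hr.1.ne']; simp
end

open Set Metric MeasureTheory Real
noncomputable section
open Filter Topology

lemma eq_of_ae {N : ℕ} {S : Set (Eu N)} (hS : IsOpen S) {g h : Eu N → ℝ} (hg : ContinuousOn g S)
    (hh : ContinuousOn h S) (e : ∀ᵐ x, x ∈ S → g x = h x) : ∀ x ∈ S, g x = h x := by
  intro x hx
  have h1 := nonneg_of_ae hS (hg.sub hh) (by filter_upwards [e] with x hx hxs; simp [hx hxs]) x hx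
  have h2 := nonneg_of_ae hS (hh.sub hg) (by filter_upwards [e] with x hx hxs; simp [hx hxs]) x hx
  simp only [Pi.sub_apply] at h1 h2
  linarith

lemma rep_local {N : ℕ} {U F : Eu N → ℝ} {L L' : NNReal} (hU : LipschitzWith L U) (hF : LipschitzWith L' F)
    {x0 : Eu N} {R : ℝ} (hR : 0 < R) (hD : DistSol (ball x0 (3 * R)) U F) :
    ∀ x ∈ ball x0 R, CR N * U x = Tk Rho U R x + Jk (fun r => r) Psi F R x := by
  obtain ⟨κ, -, H⟩ := reg_local N
  obtain ⟨A, hA, hA'⟩ := compact_bound (isCompact_closedBall x0 (3 * R)) hU.continuous.continuousOn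
  obtain ⟨B, hB, hB'⟩ := compact_bound (isCompact_closedBall x0 (3 * R)) hF.continuous.continuousOn
  obtain ⟨h1, h2, h3⟩ := H R A B x0 U F hR hA hB hU.continuous.measurable hF.continuous.measurable
    (fun x hx => hA' x (ball_subset_closedBall hx)) (fun x hx => hB' x (ball_subset_closedBall hx)) hD
  intro x hx
  rw [eq_of_ae isOpen_ball hU.continuous.continuousOn (lip_continuousOn h1) h2 x hx]
  exact h3 x hx

lemma lip_extend {N : ℕ} {S : Set (Eu N)} {g : Eu N → ℝ} {L : ℝ}
    (h : ∀ x ∈ S, ∀ y ∈ S, |g x - g y| ≤ L * ‖x - y‖) :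
    ∃ (K : NNReal) (g' : Eu N → ℝ), LipschitzWith K g' ∧ EqOn g g' S := by
  have : LipschitzOnWith (Real.toNNReal L) g S := by
    refine LipschitzOnWith.of_dist_le_mul fun x hx y hy => ?_
    rw [Real.dist_eq, dist_eq_norm]
    refine (h x hx y hy).trans ?_
    gcongr
    exact Real.le_coe_toNNReal L
  exact ⟨_, this.extend_real⟩

lemma c2_local {N : ℕ} {U F : Eu N → ℝ} {L L' : NNReal} (hU : LipschitzWith L U) (hF : LipschitzWith L' F)
    {x0 : Eu N} {R : ℝ} (hR : 0 < R) (hD : DistSol (ball x0 (3 * R)) U F) :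
    ContDiffOn ℝ 2 U (ball x0 R) ∧ ∀ x ∈ ball x0 R, -lap U x = F x := by
  have hc : ContDiffOn ℝ 2 U (ball x0 R) := by
    have h1 : ContDiff ℝ 2 (Tk Rho U R) := Tk_contDiff (n := 2) Rho_contDiff Rho_compact hU.continuous hR
    have h2 : ContDiff ℝ 2 (Jk (fun r => r) Psi F R) := Jk_contDiff2 Psi_contDiff (fun z hz => Psi_zero hz.le) hF hR
    have h3 : ContDiff ℝ 2 (fun x => (CR N)⁻¹ * (Tk Rho U R x + Jk (fun r => r) Psi F R x)) :=
      contDiff_const.mul (h1.add h2)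
    refine h3.contDiffOn.congr fun x hx => ?_
    rw [← rep_local hU hF hR hD x hx, inv_mul_cancel_left₀ (CR_pos N).ne']
  refine ⟨hc, ?_⟩
  have hl : ContinuousOn (lap U) (ball x0 R) := lap_continuousOn isOpen_ball hc
  have hcont : ContinuousOn (fun x => lap U x + F x) (ball x0 R) := hl.add hF.continuous.continuousOn
  have hz := isOpen_ball.ae_eq_zero_of_integral_contDiff_smul_eq_zero (U := ball x0 R) (μ := volume)
    (f := fun x => lap U x + F x) (hcont.locallyIntegrableOn measurableSet_ball) ?_
  · intro x hx
    have := eq_of_ae isOpen_ball hcont continuousOn_const hz x hx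
    linarith
  intro g hg hgc hgs
  have hg2 : ContDiff ℝ 2 g := hg.of_le (WithTop.coe_le_coe.2 (le_top : (2:ℕ∞) ≤ ⊤))
  have e1 := hD g hg2 hgc (hgs.trans (ball_subset_ball (by linarith)))
  rw [green isOpen_ball hc hg2 hgc hgs] at e1
  have i1 : Integrable (fun x => lap U x * g x) := integrable_mul_of_tsupport isOpen_ball hl hg.continuous hgc hgs
  have i2 : Integrable (fun x => F x * g x) :=
    integrable_mul_of_tsupport isOpen_ball hF.continuous.continuousOn hg.continuous hgc hgs
  have : ∀ x, g x • (lap U x + F x) = lap U x * g x + F x * g x := fun x => by simp; ring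
  simp_rw [this]
  rw [integral_add i1 i2, e1]; ring

lemma Tk_ii_lip {N : ℕ} {F : Eu N → ℝ} {L : NNReal} (hF : LipschitzWith L F) (x : Eu N)
    {R : ℝ} (hR : 0 < R) : IntervalIntegrable (fun r => r * Tk Psi F r x) volume 0 R := by
  have h1 : IntervalIntegrable (fun r => Tk Psi F r x) volume 0 R := by
    rw [intervalIntegrable_iff, uIoc_of_le hR.le]
    refine Integrable.of_bound (C := (|F x| + L * R) * ∫ z : Eu N, |Psi z|)
      (Tk_measurable Psi_contDiff.continuous.measurable hF.continuous.measurable x).aestronglyMeasurable ?_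
    filter_upwards [ae_restrict_mem measurableSet_Ioc] with r hr
    refine Tk_bound Psi_int (fun _ => Psi_zero) fun z hz => ?_
    have h1 := hF.dist_le_mul (x + r • z) x
    rw [Real.dist_eq, dist_eq_norm, add_sub_cancel_left, norm_smul, Real.norm_of_nonneg hr.1.le] at h1
    have h3 : r * ‖z‖ ≤ R * 1 := mul_le_mul hr.2 hz.le (norm_nonneg _) hR.le
    have h4 : (L:ℝ) * (r * ‖z‖) ≤ L * (R * 1) := by gcongr
    have := abs_sub_abs_le_abs_sub (F (x + r • z)) (F x)
    linarith
  exact h1.continuousOn_mul continuousOn_id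

lemma Psi_le_Rho {N : ℕ} (z : Eu N) : Psi z ≤ Rho z / 10 := by
  unfold Psi Rho qq
  have h0 : 0 ≤ max (1 - ‖z‖^2) 0 := le_max_right _ _
  have h1 : max (1 - ‖z‖^2) 0 ≤ 1 := max_le (by nlinarith [norm_nonneg z]) zero_le_one
  have := pow_le_pow_of_le_one h0 h1 (show 4 ≤ 5 by norm_num)
  linarith

lemma zero_local {N : ℕ} {U F : Eu N → ℝ} {L L' : NNReal} (hU : LipschitzWith L U) (hF : LipschitzWith L' F)
    {x0 : Eu N} {R0 k : ℝ} (hk : 0 ≤ k) (hR0 : 0 < R0) (hD : DistSol (ball x0 (3 * R0)) U F)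
    (h0 : ∀ x ∈ ball x0 R0, 0 ≤ U x) (hkF : ∀ x ∈ ball x0 R0, -(k * U x) ≤ F x) (hz : U x0 = 0) :
    ∃ R > 0, ∀ x ∈ ball x0 R, U x = 0 := by
  obtain ⟨R1, hR1, hR10, hR1k⟩ : ∃ R1 > 0, R1 ≤ R0 ∧ k * R1 ^ 2 ≤ 10 := by
    refine ⟨min R0 (1 / (1 + k)), by positivity, min_le_left _ _, ?_⟩
    have h1 : min R0 (1 / (1 + k)) ≤ 1 / (1 + k) := min_le_right _ _
    have h2 : 0 < min R0 (1 / (1 + k)) := by positivity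
    have h3 : min R0 (1 / (1 + k)) * (1 + k) ≤ 1 := by rwa [le_div_iff₀ (by positivity)] at h1
    set m := min R0 (1 / (1 + k))
    have : m ≤ 1 := by nlinarith
    nlinarith
  have inb (r) (hr : r ∈ Ioc 0 R1) (z : Eu N) (hzz : ‖z‖ < 1) : x0 + r • z ∈ ball x0 R0 := by
    rw [mem_ball, dist_eq_norm, add_sub_cancel_left, norm_smul, Real.norm_of_nonneg hr.1.le]
    nlinarith [hr.1, hr.2, norm_nonneg z]
  have cont {k : Eu N → ℝ} (hk : Continuous k) {g : Eu N → ℝ} (hg : Continuous g) (r : ℝ) :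
      Continuous (fun z => g (x0 + r • z) * k z) := (hg.comp (by fun_prop)).mul hk
  have cU (r) := cont Rho_contDiff.continuous hU.continuous r
  have cF (r) := cont Psi_contDiff.continuous hF.continuous r
  have nn (r) (hr : r ∈ Ioc 0 R1) (z : Eu N) : 0 ≤ U (x0 + r • z) * Rho z := by
    rcases lt_or_ge ‖z‖ 1 with h | h
    · exact mul_nonneg (h0 _ (inb r hr z h)) (Rho_nonneg z)
    · rw [Rho_zero h]; simp
  set P : ℝ → ℝ := fun r => Tk Rho U r x0 with hP
  have Pn (r) (hr : r ∈ Ioc 0 R1) : 0 ≤ P r := integral_nonneg (nn r hr)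
  have key (r) (hr : r ∈ Ioc 0 R1) : -(k / 10 * P r) ≤ Tk Psi F r x0 := by
    simp only [hP]; unfold Tk
    rw [← integral_const_mul, ← integral_neg]
    refine integral_mono (((cU r).integrable_of_hasCompactSupport Rho_compact.mul_left).const_mul _).neg
      ((cF r).integrable_of_hasCompactSupport Psi_compact.mul_left) fun z => ?_
    simp only
    rcases lt_or_ge ‖z‖ 1 with h | h
    · have a1 := h0 _ (inb r hr z h)
      have a2 := hkF _ (inb r hr z h)
      have a3 := Psi_le_Rho z
      have a4 := Psi_nonneg z
      have a5 := mul_le_mul_of_nonneg_right a2 a4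
      have a6 := mul_le_mul_of_nonneg_left a3 (mul_nonneg hk a1)
      linarith
    · rw [Rho_zero h, Psi_zero h]; simp
  have rep (R) (hR : R ∈ Ioc 0 R1) : P R = -∫ r in (0:ℝ)..R, r * Tk Psi F r x0 := by
    have := rep_local hU hF hR.1 (hD.mono (ball_subset_ball (by linarith [hR.2]))) x0 (mem_ball_self hR.1)
    rw [hz, mul_zero] at this
    simp only [hP]
    unfold Jk at this
    linarith
  have step (A : ℝ) (hA : ∀ r ∈ Ioc 0 R1, P r ≤ A) : ∀ r ∈ Ioc 0 R1, P r ≤ A / 2 := by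
    intro R hR
    have hA0 : 0 ≤ A := (Pn R hR).trans (hA R hR)
    rw [rep R hR]
    have hm : ∫ r in (0:ℝ)..R, r * (-(k / 10 * A)) ≤ ∫ r in (0:ℝ)..R, r * Tk Psi F r x0 := by
      refine intervalIntegral.integral_mono_on hR.1.le (Continuous.intervalIntegrable (by fun_prop) _ _) (Tk_ii_lip hF x0 hR.1) fun r hr => ?_
      rcases hr.1.eq_or_lt with h | h
      · rw [← h]; simp
      · have hr' : r ∈ Ioc 0 R1 := ⟨h, hr.2.trans hR.2⟩
        refine mul_le_mul_of_nonneg_left ((neg_le_neg ?_).trans (key r hr')) hr.1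
        have := hA r hr'
        gcongr
    rw [intervalIntegral.integral_mul_const, integral_id] at hm
    have h5 : k * R ^ 2 ≤ 10 := (mul_le_mul_of_nonneg_left (pow_le_pow_left₀ hR.1.le hR.2 2) hk).trans hR1k
    have := mul_le_mul_of_nonneg_right h5 hA0
    nlinarith
  obtain ⟨A, hA⟩ : ∃ A, ∀ r ∈ Ioc 0 R1, P r ≤ A := by
    refine ⟨(L * R1) * ∫ z : Eu N, |Rho z|, fun r hr => (le_abs_self _).trans ?_⟩
    refine Tk_bound Rho_int (fun _ => Rho_zero) fun z hzz => ?_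
    have h1 := hU.dist_le_mul (x0 + r • z) x0
    rw [Real.dist_eq, dist_eq_norm, add_sub_cancel_left, norm_smul, Real.norm_of_nonneg hr.1.le, hz, sub_zero] at h1
    have h3 : r * ‖z‖ ≤ R1 * 1 := mul_le_mul hr.2 hzz.le (norm_nonneg _) hR1.le
    have h4 : (L:ℝ) * (r * ‖z‖) ≤ L * (R1 * 1) := by gcongr
    linarith
  have iter (n : ℕ) : ∀ r ∈ Ioc 0 R1, P r ≤ A / 2 ^ n := by
    induction n with
    | zero => simpa using hA
    | succ n ih =>
      have := step _ ih
      intro r hr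
      refine (this r hr).trans (le_of_eq ?_)
      rw [pow_succ]; field_simp
  have hR1m : R1 ∈ Ioc 0 R1 := ⟨hR1, le_rfl⟩
  have P0 : P R1 ≤ 0 := by
    have ht : Tendsto (fun n : ℕ => A / 2 ^ n) atTop (𝓝 0) := by
      have := (tendsto_pow_atTop_nhds_zero_of_lt_one (r := (1/2:ℝ)) (by norm_num) (by norm_num)).const_mul A
      rw [mul_zero] at this
      refine this.congr fun n => ?_
      rw [div_pow, one_pow]; ring
    exact ge_of_tendsto' ht fun n => iter n R1 hR1m
  refine ⟨R1, hR1, fun x hx => ?_⟩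
  by_contra hne
  have hx' : x0 + R1 • (R1⁻¹ • (x - x0)) = x := by
    rw [smul_smul, mul_inv_cancel₀ hR1.ne', one_smul, add_sub_cancel]
  have hlt : ‖R1⁻¹ • (x - x0)‖ < 1 := by
    rw [norm_smul, Real.norm_of_nonneg (inv_pos.2 hR1).le, inv_mul_lt_iff₀ hR1, mul_one]
    rwa [mem_ball, dist_eq_norm] at hx
  have hpos : 0 < ∫ z, U (x0 + R1 • z) * Rho z := by
    refine (cU R1).integral_pos_of_hasCompactSupport_nonneg_nonzero (x := R1⁻¹ • (x - x0)) Rho_compact.mul_left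
      (nn R1 hR1m) ?_
    rw [hx']
    refine mul_ne_zero hne ?_
    unfold Rho qq
    have : 0 < 1 - ‖R1⁻¹ • (x - x0)‖ ^ 2 := by nlinarith [norm_nonneg (R1⁻¹ • (x - x0))]
    have : 0 < max (1 - ‖R1⁻¹ • (x - x0)‖ ^ 2) 0 := lt_max_of_lt_left this
    positivity
  exact absurd P0 (not_le.2 hpos)
end

open Set Metric MeasureTheory Real
noncomputable section
open Filter Topology

lemma full_solution {N : ℕ} {Ω : Set (Eu N)} (hΩ : IsOpen Ω) (hΩb : Bornology.IsBounded Ω)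
    (hne : Ωᶜ.Nonempty) {ub lb : Eu N → ℝ} {f : Eu N → ℝ → ℝ} (hub : ContDiffOn ℝ 2 ub Ω) (hlb : ContDiffOn ℝ 2 lb Ω)
    (mub : Measurable ub) (h0 : ∀ x ∈ Ω, 0 ≤ lb x) (hlt : ∀ x ∈ Ω, lb x < ub x)
    (mf : Measurable (Function.uncurry f)) (f0 : ∀ x, f x 0 = 0)
    (hsup : ∀ x ∈ Ω, f x (ub x) ≤ -lap ub x) (hsub : ∀ x ∈ Ω, -lap lb x ≤ f x (lb x))
    (hlip : ∀ Q, IsCompact Q → Q ⊆ Ω → ∀ B, ∃ L, 0 ≤ L ∧ ∀ x ∈ Q, ∀ y ∈ Q, ∀ a ∈ Icc 0 B, ∀ b ∈ Icc 0 B,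
      |f x a - f y b| ≤ L * (‖x - y‖ + |a - b|))
    {K : Set (Eu N)} (hK : IsCompact K) (hKΩ : K ⊆ Ω) (hKp : ∀ x ∈ Ω, x ∉ K → 0 < lb x) :
    ∃ U : Eu N → ℝ, ContDiffOn ℝ 2 U Ω ∧ ∀ x ∈ Ω, lb x ≤ U x ∧ U x ≤ ub x ∧ 0 < U x ∧ -lap U x = f x (U x) := by
  obtain ⟨U, hU, hUl⟩ := limit_solution hΩ hΩb hne hub hlb mub h0 hlt mf f0 hsup hsub
    (fun Q hQ hQΩ B => by
      obtain ⟨L, hL, h⟩ := hlip Q hQ hQΩ B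
      exact ⟨L, hL, fun x hx a ha b hb => by simpa using h x hx x hx a ha b hb⟩)
  have loc : ∀ x0 ∈ Ω, ∃ R > 0, ball x0 R ⊆ Ω ∧ ContDiffOn ℝ 2 U (ball x0 R) ∧ (∀ x ∈ ball x0 R, -lap U x = f x (U x)) ∧
      (U x0 = 0 → ∃ r > 0, ball x0 r ⊆ Ω ∧ ∀ x ∈ ball x0 r, U x = 0) := by
    intro x0 hx0
    obtain ⟨R, hR, L, hL, hRΩ, hUL, hD⟩ := hUl x0 hx0
    have hsb : closedBall x0 (R/2) ⊆ Ω := (closedBall_subset_ball (by linarith)).trans hRΩ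
    have hbb : ball x0 (R/2) ⊆ ball x0 R := ball_subset_ball (by linarith)
    have hbc : ball x0 (R/2) ⊆ closedBall x0 (R/2) := ball_subset_closedBall
    obtain ⟨B, hB, hBu⟩ := compact_bound (isCompact_closedBall x0 (R/2)) (hub.continuousOn.mono hsb)
    obtain ⟨M, hM, hlipM⟩ := hlip _ (isCompact_closedBall x0 (R/2)) hsb B
    have hUI : ∀ x ∈ ball x0 (R/2), U x ∈ Icc 0 B := fun x hx =>
      ⟨(h0 x (hsb (hbc hx))).trans (hU x (hsb (hbc hx))).1,
        (hU x (hsb (hbc hx))).2.trans ((le_abs_self _).trans (hBu x (hbc hx)))⟩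
    obtain ⟨K1, U', hU', eU⟩ := lip_extend (S := ball x0 (R/2)) (g := U) (L := L)
      fun x hx y hy => hUL x (hbb hx) y (hbb hy)
    obtain ⟨K2, F', hF', eF⟩ := lip_extend (S := ball x0 (R/2)) (g := fun x => f x (U x)) (L := M * (1 + L))
      fun x hx y hy => by
        refine (hlipM x (hbc hx) y (hbc hy) _ (hUI x hx) _ (hUI y hy)).trans ?_
        rw [mul_assoc]
        have := hUL x (hbb hx) y (hbb hy)
        gcongr
        linarith
    have e3 : 3 * (R / 6) = R / 2 := by ring
    have hD' : DistSol (ball x0 (3 * (R / 6))) U' F' := by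
      rw [e3]
      exact (hD.mono hbb).congr_ae (ae_of_all _ fun x hx => (eU hx).symm) (ae_of_all _ fun x hx => (eF hx).symm)
    have hb6 : ball x0 (R/6) ⊆ ball x0 (R/2) := ball_subset_ball (by linarith)
    obtain ⟨c1, c2⟩ := c2_local hU' hF' (by positivity : 0 < R / 6) hD'
    refine ⟨R/6, by positivity, hb6.trans (hbb.trans hRΩ), c1.congr fun x hx => eU (hb6 hx), fun x hx => ?_, fun hz => ?_⟩
    · have : U =ᶠ[𝓝 x] U' := by
        filter_upwards [isOpen_ball.mem_nhds hx] with y hy using eU (hb6 hy)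
      rw [lap_congr this, c2 x hx, ← eF (hb6 hx)]
    · obtain ⟨r, hr, h⟩ := zero_local hU' hF' hM (by positivity : 0 < R / 6) hD'
        (fun x hx => by rw [← eU (hb6 hx)]; exact (hUI x (hb6 hx)).1)
        (fun x hx => by
          rw [← eU (hb6 hx), ← eF (hb6 hx)]
          have h1 := hlipM x (hbc (hb6 hx)) x (hbc (hb6 hx)) _ (hUI x (hb6 hx)) 0 ⟨le_rfl, hB⟩
          rw [f0, sub_self, norm_zero, zero_add, sub_zero, sub_zero, abs_of_nonneg (hUI x (hb6 hx)).1] at h1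
          exact (abs_le.1 h1).1)
        (by rw [← eU (mem_ball_self (by positivity))]; exact hz)
      refine ⟨min r (R/6), by positivity, (ball_subset_ball (min_le_right _ _)).trans (hb6.trans (hbb.trans hRΩ)), fun x hx => ?_⟩
      rw [eU (hb6 (ball_subset_ball (min_le_right _ _) hx))]
      exact h x (ball_subset_ball (min_le_left _ _) hx)
  have hUc : ContDiffOn ℝ 2 U Ω := by
    intro x hx
    obtain ⟨R, hR, -, h, -⟩ := loc x hx
    exact (h.contDiffAt (ball_mem_nhds x hR)).contDiffWithinAt
  refine ⟨U, hUc, fun x hx => ⟨(hU x hx).1, (hU x hx).2, ?_, ?_⟩⟩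
  · refine lt_of_le_of_ne ((h0 x hx).trans (hU x hx).1) fun hz => ?_
    set Z := K ∩ U ⁻¹' {0} with hZ
    have hZm (y) (hy : y ∈ Ω) (hy0 : U y = 0) : y ∈ Z := by
      refine ⟨?_, hy0⟩
      by_contra hyK
      have := hKp y hy hyK
      linarith [(hU y hy).1]
    have hcl : IsClosed Z := (hUc.continuousOn.mono hKΩ).preimage_isClosed_of_isClosed hK.isClosed isClosed_singleton
    have hop : IsOpen Z := by
      rw [Metric.isOpen_iff]
      intro y hy
      obtain ⟨R, hR, -, -, -, h⟩ := loc y (hKΩ hy.1)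
      obtain ⟨r, hr, h1, h2⟩ := h hy.2
      exact ⟨r, hr, fun w hw => hZm w (h1 hw) (h2 w hw)⟩
    rcases isClopen_iff.1 ⟨hcl, hop⟩ with h | h
    · exact (h ▸ hZm x hx hz.symm : x ∈ (∅ : Set (Eu N)))
    · obtain ⟨w, hw⟩ := hne
      exact hw (hKΩ (h ▸ mem_univ w : w ∈ Z).1)
  · obtain ⟨R, hR, -, -, h, -⟩ := loc x hx
    exact h x (mem_ball_self hR)
end

open Set Metric MeasureTheory Real
noncomputable section
open Filter Topology

lemma deriv2_of {g g1 : ℝ → ℝ} {t g2 : ℝ} (h1 : ∀ᶠ s in 𝓝 t, HasDerivAt g (g1 s) s) (h2 : HasDerivAt g1 g2 t) :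
    deriv g t = g1 t ∧ deriv (deriv g) t = g2 := by
  have e : deriv g =ᶠ[𝓝 t] g1 := h1.mono fun s hs => hs.deriv
  exact ⟨e.self_of_nhds, by rw [e.deriv_eq]; exact h2.deriv⟩

lemma lap_bdist {N : ℕ} {Ω : Set (Eu N)} (hΩ : IsOpen Ω) {ρ₀ : ℝ} (hρ : GoodCollar Ω ρ₀) {x : Eu N}
    (hx : x ∈ collar Ω ρ₀) {g : ℝ → ℝ} (hg : ContDiffAt ℝ 2 g (bdist Ω x)) :
    lap (fun y => g (bdist Ω y)) x = deriv (deriv g) (bdist Ω x) + deriv g (bdist Ω x) * lap (bdist Ω) x := by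
  have ho : IsOpen (collar Ω ρ₀) :=
    hΩ.inter (isOpen_lt (Metric.continuous_infDist_pt _) continuous_const)
  have := lap_comp (hρ.2.1.contDiffAt (ho.mem_nhds hx)) hg
  rw [hρ.2.2.1 x hx, one_pow, mul_one] at this
  exact this

/-- profile of the lower barrier -/
def phi (β e M : ℝ) (t : ℝ) : ℝ := t ^ β * qq 3 (1 - M * t ^ e)

lemma phi_contDiffAt (β e M : ℝ) {t : ℝ} (ht : 0 < t) : ContDiffAt ℝ 2 (phi β e M) t := by
  have h (b : ℝ) : ContDiffAt ℝ 2 (fun t : ℝ => t ^ b) t := Real.contDiffAt_rpow_const (Or.inl ht.ne')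
  exact (h β).mul ((qq_contDiff2 0).contDiffAt.comp t (contDiffAt_const.sub (contDiffAt_const.mul (h e))))

lemma phi_derivs (β e M : ℝ) {t : ℝ} (ht : 0 < t) :
    deriv (phi β e M) t = t ^ β / t * (β * qq 3 (1 - M * t ^ e) - 3 * e * (M * t ^ e) * qq 2 (1 - M * t ^ e)) ∧
    deriv (deriv (phi β e M)) t + β * (1 - β) / t ^ 2 * phi β e M t = t ^ β / t ^ 2 *
      (3 * e * (1 - 2 * β - e) * (M * t ^ e) * qq 2 (1 - M * t ^ e) + 6 * e ^ 2 * (M * t ^ e) ^ 2 * qq 1 (1 - M * t ^ e)) := by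
  have hq (s : ℝ) (hs : 0 < s) : HasDerivAt (fun t : ℝ => 1 - M * t ^ e) (-(M * (e * s ^ (e - 1)))) s := by
    have := ((Real.hasDerivAt_rpow_const (p := e) (Or.inl hs.ne')).const_mul M).const_sub 1
    exact this
  have q3 (s : ℝ) (hs : 0 < s) := (qq_hasDerivAt 1 (1 - M * s ^ e)).comp s (hq s hs)
  have q2 (s : ℝ) (hs : 0 < s) := (qq_hasDerivAt 0 (1 - M * s ^ e)).comp s (hq s hs)
  set g1 : ℝ → ℝ := fun t => t ^ (β - 1) * (β * qq 3 (1 - M * t ^ e) - 3 * e * (M * t ^ e) * qq 2 (1 - M * t ^ e)) with hg1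
  have h1 (s : ℝ) (hs : 0 < s) : HasDerivAt (phi β e M) (g1 s) s := by
    refine ((Real.hasDerivAt_rpow_const (p := β) (Or.inl hs.ne')).mul (q3 s hs)).congr_deriv ?_
    simp only [hg1, Function.comp]
    rw [Real.rpow_sub hs, Real.rpow_sub hs, Real.rpow_one]
    push_cast
    field_simp
    ring
  have h2 : HasDerivAt g1 ((β - 1) * t ^ (β - 1 - 1) *
      (β * qq 3 (1 - M * t ^ e) - 3 * e * (M * t ^ e) * qq 2 (1 - M * t ^ e)) + t ^ (β - 1) *
      (β * ((((1:ℕ):ℝ) + 2) * qq 2 (1 - M * t ^ e) * (-(M * (e * t ^ (e - 1))))) -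
        (3 * e * (M * (e * t ^ (e - 1))) * qq 2 (1 - M * t ^ e) + 3 * e * (M * t ^ e) *
        ((((0:ℕ):ℝ) + 2) * qq 1 (1 - M * t ^ e) * (-(M * (e * t ^ (e - 1)))))))) t := by
    refine (Real.hasDerivAt_rpow_const (p := β - 1) (Or.inl ht.ne')).mul (((q3 t ht).const_mul β).sub ?_)
    exact (((Real.hasDerivAt_rpow_const (p := e) (Or.inl ht.ne')).const_mul M).const_mul (3 * e)).mul (q2 t ht)
  obtain ⟨a1, a2⟩ := deriv2_of (g := phi β e M) (by filter_upwards [lt_mem_nhds ht] with s hs using h1 s hs) h2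
  rw [a1, a2]
  simp only [hg1, phi]
  simp only [Real.rpow_sub ht, Real.rpow_one]
  have e3 : qq 3 (1 - M * t ^ e) = qq 1 (1 - M * t ^ e) * qq 2 (1 - M * t ^ e) := by unfold qq; ring
  refine ⟨trivial, ?_⟩
  push_cast
  field_simp
  ring

/-- profile of the upper barrier near the boundary -/
lemma eta_derivs (β e : ℝ) {t : ℝ} (ht : 0 < t) :
    deriv (fun t : ℝ => t ^ β + t ^ (β + e)) t = t ^ β / t * (β + (β + e) * t ^ e) ∧
    deriv (deriv (fun t : ℝ => t ^ β + t ^ (β + e))) t + β * (1 - β) / t ^ 2 * (t ^ β + t ^ (β + e)) =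
      - (t ^ β / t ^ 2 * (e * (1 - 2 * β - e) * t ^ e)) := by
  have h (b s : ℝ) (hs : 0 < s) : HasDerivAt (fun t : ℝ => t ^ b) (b * s ^ (b - 1)) s :=
    Real.hasDerivAt_rpow_const (Or.inl hs.ne')
  obtain ⟨a1, a2⟩ := deriv2_of (g := fun t : ℝ => t ^ β + t ^ (β + e))
    (by filter_upwards [lt_mem_nhds ht] with s hs using (h β s hs).add (h (β + e) s hs))
    (((h (β - 1) t ht).const_mul β).add ((h (β + e - 1) t ht).const_mul (β + e)))
  rw [a1, a2]
  simp only [Pi.add_apply, Real.rpow_sub ht, Real.rpow_add ht, Real.rpow_one]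
  constructor
  · field_simp
  · field_simp
    ring

lemma F_lip (μ s : ℝ) {p : ℝ} (hp : 1 < p) {t0 t1 B : ℝ} (ht0 : 0 < t0) :
    ∃ L : NNReal, LipschitzOnWith L (fun q : ℝ × ℝ => μ / q.1 ^ 2 * q.2 - q.2 ^ p / q.1 ^ s)
      (Icc t0 t1 ×ˢ Icc 0 B) := by
  have hc : ContDiffOn ℝ 1 (fun q : ℝ × ℝ => μ / q.1 ^ 2 * q.2 - q.2 ^ p / q.1 ^ s) (Icc t0 t1 ×ˢ Icc 0 B) := by
    intro q hq
    have hq1 : 0 < q.1 := ht0.trans_le hq.1.1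
    have h1 : ContDiffAt ℝ 1 (fun q : ℝ × ℝ => q.1 ^ s) q :=
      (Real.contDiffAt_rpow_const (Or.inl hq1.ne')).comp (g := fun t : ℝ => t ^ s) q contDiffAt_fst
    have h2 : ContDiffAt ℝ 1 (fun q : ℝ × ℝ => q.2 ^ p) q :=
      ((Real.contDiff_rpow_const_of_le (n := 1) (by exact_mod_cast hp.le)).contDiffAt).comp (g := fun t : ℝ => t ^ p) q contDiffAt_snd
    have h3 : ContDiffAt ℝ 1 (fun q : ℝ × ℝ => μ / q.1 ^ 2) q :=
      contDiffAt_const.div (contDiffAt_fst.pow 2) (by positivity)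
    exact ((h3.mul contDiffAt_snd).sub (h2.div h1 (by positivity))).contDiffWithinAt
  exact hc.exists_lipschitzOnWith (by norm_num) ((convex_Icc _ _).prod (convex_Icc _ _)) (isCompact_Icc.prod isCompact_Icc)
end

open Set Metric MeasureTheory Real
noncomputable section
open Filter Topology

lemma super_ineq {β e M0 t D : ℝ} (he : 0 < e) (ht : 0 < t) (ht1 : t ≤ 1) (hD : |D| ≤ M0)
    (h : M0 * (|β| + |β + e|) * t ^ (1 - e) ≤ e * (1 - 2 * β - e)) :
    deriv (deriv (fun t : ℝ => t ^ β + t ^ (β + e))) t + deriv (fun t : ℝ => t ^ β + t ^ (β + e)) t * D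
      + β * (1 - β) / t ^ 2 * (t ^ β + t ^ (β + e)) ≤ 0 := by
  obtain ⟨h1, h2⟩ := eta_derivs β e ht
  have hy : 0 < t ^ e := Real.rpow_pos_of_pos ht e
  have hy1 : t ^ e ≤ 1 := Real.rpow_le_one ht.le ht1 he.le
  have hb : 0 < t ^ β := Real.rpow_pos_of_pos ht β
  have hyy : t ^ (1 - e) * t ^ e = t := by rw [← Real.rpow_add ht]; simp
  have h3 : deriv (deriv (fun t : ℝ => t ^ β + t ^ (β + e))) t + deriv (fun t : ℝ => t ^ β + t ^ (β + e)) t * D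
      + β * (1 - β) / t ^ 2 * (t ^ β + t ^ (β + e)) =
      t ^ β / t ^ 2 * ((β + (β + e) * t ^ e) * D * t - e * (1 - 2 * β - e) * t ^ e) := by
    rw [h1]
    have : t ^ β / t * (β + (β + e) * t ^ e) * D = t ^ β / t ^ 2 * ((β + (β + e) * t ^ e) * D * t) := by
      field_simp
    linear_combination h2 + this
  rw [h3]
  refine mul_nonpos_of_nonneg_of_nonpos (by positivity) ?_
  have h4 : (β + (β + e) * t ^ e) * D ≤ (|β| + |β + e|) * M0 := by
    refine (le_abs_self _).trans ?_
    rw [abs_mul]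
    refine mul_le_mul ?_ hD (abs_nonneg _) (by positivity)
    refine (abs_add_le _ _).trans ?_
    rw [abs_mul, abs_of_pos hy]
    have := mul_le_mul_of_nonneg_left hy1 (abs_nonneg (β + e))
    linarith
  have h5 := mul_le_mul_of_nonneg_right h4 ht.le
  have h6 := mul_le_mul_of_nonneg_right h hy.le
  have h7 : M0 * (|β| + |β + e|) * t ^ (1 - e) * t ^ e = (|β| + |β + e|) * M0 * t := by
    rw [mul_assoc, hyy]; ring
  linarith

lemma sub_ineq {β e M0 M t D p s : ℝ} (he : 0 < e) (he1 : e < 1) (hκ : 0 < 1 - 2 * β - e) (ht : 0 < t)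
    (hD : |D| ≤ M0) (hp : 1 < p) (hs : e ≤ β * (p - 1) + 2 - s) (hM0 : 0 < M)
    (hM : M0 * (|β| + 3) + 1 ≤ 3 * e * (1 - 2 * β - e) * M) (hM1 : M * t ^ e < 1 → t ≤ 1) :
    -(deriv (deriv (phi β e M)) t + deriv (phi β e M) t * D) ≤
      β * (1 - β) / t ^ 2 * phi β e M t - (phi β e M t) ^ p / t ^ s := by
  obtain ⟨h1, h2⟩ := phi_derivs β e M ht
  have hy : 0 < t ^ e := Real.rpow_pos_of_pos ht e
  have hb : 0 < t ^ β := Real.rpow_pos_of_pos ht β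
  rcases le_or_gt 1 (M * t ^ e) with hc | hc
  · have z (k) : qq (k+1) (1 - M * t ^ e) = 0 := qq_zero k (by linarith)
    have z1 : phi β e M t = 0 := by unfold phi; rw [z 2]; simp
    rw [z 1, z 0, z1] at h2
    rw [z 1, z 2] at h1
    have h2' : deriv (deriv (phi β e M)) t = 0 := by linear_combination h2
    rw [h1, z1, Real.zero_rpow (by linarith), h2']
    simp
  have ht1 := hM1 hc
  have hM00 : 0 ≤ M0 := (abs_nonneg _).trans hD
  set τ := M * t ^ e with hτ
  have hτ0 : 0 < τ := by positivity
  set σ := 1 - τ with hσ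
  have hσ0 : 0 < σ := by linarith
  have hσ1 : σ ≤ 1 := by linarith
  have q (k) : qq k σ = σ ^ k := by unfold qq; rw [max_eq_left hσ0.le]
  have hte : t ≤ t ^ e := by
    have := Real.rpow_le_rpow_of_exponent_ge ht ht1 he1.le
    rwa [Real.rpow_one] at this
  have hpow : (phi β e M t) ^ p / t ^ s ≤ t ^ β / t ^ 2 * (t ^ e * σ ^ 2) := by
    have e1 : phi β e M t = t ^ β * σ ^ 3 := by unfold phi; rw [← hτ, ← hσ, q]
    rw [e1, Real.mul_rpow hb.le (by positivity), ← Real.rpow_mul ht.le]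
    have e2 : t ^ (β * p) / t ^ s = t ^ β / t ^ 2 * t ^ (β * (p - 1) + 2 - s) := by
      rw [← Real.rpow_two, ← Real.rpow_sub ht, ← Real.rpow_sub ht, ← Real.rpow_add ht]
      congr 1; ring
    have e3 : t ^ (β * (p - 1) + 2 - s) ≤ t ^ e := Real.rpow_le_rpow_of_exponent_ge ht ht1 hs
    have e4 : (σ ^ 3) ^ p ≤ σ ^ 2 := by
      have a1 : (σ ^ 3) ^ p ≤ (σ ^ 3) ^ (1:ℝ) :=
        Real.rpow_le_rpow_of_exponent_ge (by positivity) (pow_le_one₀ hσ0.le hσ1) hp.le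
      rw [Real.rpow_one] at a1
      exact a1.trans (pow_le_pow_of_le_one hσ0.le hσ1 (by norm_num))
    rw [mul_div_right_comm, e2, mul_assoc]
    gcongr
  have hpm : -(deriv (phi β e M) t * D) ≤ t ^ β / t ^ 2 * (t * (σ ^ 2 * (|β| + 3)) * M0) := by
    refine (neg_le_abs _).trans ?_
    rw [abs_mul, h1, q, q, abs_mul, abs_of_pos (by positivity : 0 < t ^ β / t)]
    have a1 : |β * σ ^ 3 - 3 * e * τ * σ ^ 2| ≤ σ ^ 2 * (|β| + 3) := by
      have b1 : |β * σ ^ 3 - 3 * e * τ * σ ^ 2| ≤ |β * σ ^ 3| + |3 * e * τ * σ ^ 2| := abs_sub _ _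
      rw [abs_mul, abs_of_pos (by positivity : 0 < σ ^ 3), abs_of_pos (by positivity : 0 < 3 * e * τ * σ ^ 2)] at b1
      have b2 : σ ^ 3 ≤ σ ^ 2 := pow_le_pow_of_le_one hσ0.le hσ1 (by norm_num)
      have b3 : e * τ ≤ 1 := by nlinarith
      have b4 := mul_le_mul_of_nonneg_left b2 (abs_nonneg β)
      have b5 := mul_le_mul_of_nonneg_right b3 (by positivity : 0 ≤ σ ^ 2)
      nlinarith
    have a2 : t ^ β / t * |β * σ ^ 3 - 3 * e * τ * σ ^ 2| * |D| ≤ t ^ β / t * (σ ^ 2 * (|β| + 3)) * M0 := by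
      gcongr
    refine a2.trans (le_of_eq ?_)
    field_simp
  rw [q, q] at h2
  have h8 : deriv (deriv (phi β e M)) t = t ^ β / t ^ 2 * (3 * e * (1 - 2 * β - e) * τ * σ ^ 2 + 6 * e ^ 2 * τ ^ 2 * σ ^ 1)
    - β * (1 - β) / t ^ 2 * phi β e M t := by linarith
  have hw : 0 < t ^ β / t ^ 2 := by positivity
  suffices hh : t * (σ ^ 2 * (|β| + 3)) * M0 + t ^ e * σ ^ 2 ≤
      3 * e * (1 - 2 * β - e) * τ * σ ^ 2 + 6 * e ^ 2 * τ ^ 2 * σ ^ 1 by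
    have := mul_le_mul_of_nonneg_left hh hw.le
    rw [mul_add] at this
    linarith
  have k1 : t * (σ ^ 2 * (|β| + 3)) * M0 ≤ t ^ e * (σ ^ 2 * (|β| + 3)) * M0 := by gcongr
  have k2 := mul_le_mul_of_nonneg_right hM (by positivity : 0 ≤ t ^ e * σ ^ 2)
  have k3 : 0 ≤ 6 * e ^ 2 * τ ^ 2 * σ ^ 1 := by positivity
  have k4 : 3 * e * (1 - 2 * β - e) * τ * σ ^ 2 = 3 * e * (1 - 2 * β - e) * M * (t ^ e * σ ^ 2) := by
    rw [hτ]; ring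
  linarith
end

open Set Metric MeasureTheory Real
noncomputable section
open Filter Topology

lemma small_pow (C : ℝ) {b ε : ℝ} (hb : 0 < b) (hε : 0 < ε) : ∃ r > 0, ∀ t, 0 < t → t ≤ r → C * t ^ b ≤ ε := by
  have h1 : Tendsto (fun t : ℝ => C * t ^ b) (𝓝 0) (𝓝 0) := by
    have := ((Real.continuousAt_rpow_const 0 b (Or.inr hb.le)).const_mul C).tendsto
    simpa [Real.zero_rpow hb.ne'] using this
  obtain ⟨r, hr, h⟩ := Metric.eventually_nhds_iff.1 (h1.eventually (gt_mem_nhds hε))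
  refine ⟨r / 2, by positivity, fun t ht htr => (h ?_).le⟩
  rw [Real.dist_eq, sub_zero, abs_of_pos ht]; linarith

lemma bdist_cont {N : ℕ} (Ω : Set (Eu N)) : Continuous (bdist Ω) := Metric.continuous_infDist_pt _

lemma bdist_pos_iff {N : ℕ} {Ω : Set (Eu N)} (hΩ : IsOpen Ω) (hne : Ωᶜ.Nonempty) (x : Eu N) :
    x ∈ Ω ↔ 0 < bdist Ω x := by
  have := hΩ.isClosed_compl.notMem_iff_infDist_pos hne (x := x)
  rw [notMem_compl_iff] at this
  exact this

lemma deep_compact {N : ℕ} {Ω : Set (Eu N)} (hΩ : IsOpen Ω) (hΩb : Bornology.IsBounded Ω) (hne : Ωᶜ.Nonempty)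
    {r : ℝ} (hr : 0 < r) : IsCompact {x | r ≤ bdist Ω x} ∧ {x | r ≤ bdist Ω x} ⊆ Ω := by
  have hs : {x | r ≤ bdist Ω x} ⊆ Ω := fun x hx => (bdist_pos_iff hΩ hne x).2 (hr.trans_le hx)
  exact ⟨Metric.isCompact_of_isClosed_isBounded (isClosed_le continuous_const (bdist_cont Ω)) (hΩb.subset hs), hs⟩

/-- profile of the upper barrier -/
def eta (β e ρ t : ℝ) : ℝ :=
  (1 - Real.smoothTransition ((t - ρ) / ρ)) * (t ^ β + t ^ (β + e)) + Real.smoothTransition ((t - ρ) / ρ)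

lemma eta_contDiffAt (β e ρ : ℝ) {t : ℝ} (ht : 0 < t) : ContDiffAt ℝ 2 (eta β e ρ) t := by
  have h (b : ℝ) : ContDiffAt ℝ 2 (fun t : ℝ => t ^ b) t := Real.contDiffAt_rpow_const (Or.inl ht.ne')
  have hT : ContDiffAt ℝ 2 (fun t : ℝ => Real.smoothTransition ((t - ρ) / ρ)) t :=
    (Real.smoothTransition.contDiff (n := 2)).contDiffAt.comp (g := Real.smoothTransition) t
      ((contDiffAt_id.sub contDiffAt_const).div_const ρ)
  exact ((contDiffAt_const.sub hT).mul ((h β).add (h (β + e)))).add hT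

lemma eta_pos (β e ρ : ℝ) {t : ℝ} (ht : 0 < t) : 0 < eta β e ρ t := by
  unfold eta
  have h1 := Real.smoothTransition.nonneg ((t - ρ) / ρ)
  have h2 := Real.smoothTransition.le_one ((t - ρ) / ρ)
  have h3 := Real.rpow_pos_of_pos ht β
  have h4 := Real.rpow_pos_of_pos ht (β + e)
  rcases h2.eq_or_lt with h | h
  · rw [h]; norm_num
  · have := mul_pos (sub_pos.2 h) (add_pos h3 h4)
    linarith

lemma eta_near (β e : ℝ) {ρ t : ℝ} (hρ : 0 < ρ) (ht : t ≤ ρ) : eta β e ρ t = t ^ β + t ^ (β + e) := by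
  unfold eta
  rw [Real.smoothTransition.zero_of_nonpos (div_nonpos_of_nonpos_of_nonneg (by linarith) hρ.le)]; ring

lemma eta_far (β e : ℝ) {ρ t : ℝ} (hρ : 0 < ρ) (ht : 2 * ρ ≤ t) : eta β e ρ t = 1 := by
  unfold eta
  rw [Real.smoothTransition.one_of_one_le (by rw [le_div_iff₀ hρ]; linarith)]; ring

lemma eta_measurable (β e ρ : ℝ) : Measurable (eta β e ρ) := by
  unfold eta
  have : Measurable (fun t : ℝ => Real.smoothTransition ((t - ρ) / ρ)) :=
    (Real.smoothTransition.continuous.comp (by fun_prop)).measurable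
  have h (b : ℝ) : Measurable (fun t : ℝ => t ^ b) := measurable_id.pow_const b
  exact ((measurable_const.sub this).mul ((h _).add (h _))).add this

lemma comp_contDiffOn {N : ℕ} {Ω : Set (Eu N)} (hΩ : IsOpen Ω) (hne : Ωᶜ.Nonempty) {ρ₀ : ℝ} (hρ : GoodCollar Ω ρ₀)
    {g : ℝ → ℝ} (hg : ∀ t, 0 < t → ContDiffAt ℝ 2 g t) {r c : ℝ} (hr : r < ρ₀) (hgc : ∀ t, r ≤ t → g t = c) :
    ContDiffOn ℝ 2 (fun x => g (bdist Ω x)) Ω ∧ ∀ x, ρ₀ ≤ bdist Ω x → lap (fun x => g (bdist Ω x)) x = 0 := by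
  have ho : IsOpen (collar Ω ρ₀) :=
    hΩ.inter (isOpen_lt (Metric.continuous_infDist_pt _) continuous_const)
  have ev (x) (hx : ρ₀ ≤ bdist Ω x) : (fun x => g (bdist Ω x)) =ᶠ[𝓝 x] fun _ => c := by
    filter_upwards [(isOpen_lt continuous_const (bdist_cont Ω)).mem_nhds (hr.trans_le hx : r < bdist Ω x)] with y hy
    exact hgc _ (le_of_lt hy)
  refine ⟨fun x hx => ContDiffAt.contDiffWithinAt ?_, fun x hx => ?_⟩
  · rcases lt_or_ge (bdist Ω x) ρ₀ with h | h
    · exact (hg _ ((bdist_pos_iff hΩ hne x).1 hx)).comp x (hρ.2.1.contDiffAt (ho.mem_nhds ⟨hx, h⟩))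
    · exact contDiffAt_const.congr_of_eventuallyEq (ev x h)
  · rw [lap_congr (ev x hx)]
    exact lap_const c x

lemma f_lip {N : ℕ} {Ω : Set (Eu N)} (hΩ : IsOpen Ω) (hne : Ωᶜ.Nonempty) (μ s : ℝ) {p : ℝ} (hp : 1 < p)
    (Q : Set (Eu N)) (hQ : IsCompact Q) (hQΩ : Q ⊆ Ω) (B : ℝ) :
    ∃ L, 0 ≤ L ∧ ∀ x ∈ Q, ∀ y ∈ Q, ∀ a ∈ Icc 0 B, ∀ b ∈ Icc 0 B,
      |(μ / bdist Ω x ^ 2 * a - a ^ p / bdist Ω x ^ s) - (μ / bdist Ω y ^ 2 * b - b ^ p / bdist Ω y ^ s)|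
        ≤ L * (‖x - y‖ + |a - b|) := by
  rcases Q.eq_empty_or_nonempty with rfl | hQn
  · exact ⟨0, le_rfl, by simp⟩
  obtain ⟨x0, hx0, h0⟩ := hQ.exists_isMinOn hQn (bdist_cont Ω).continuousOn
  obtain ⟨x1, hx1, h1⟩ := hQ.exists_isMaxOn hQn (bdist_cont Ω).continuousOn
  obtain ⟨L, hL⟩ := F_lip μ s hp (t0 := bdist Ω x0) (t1 := bdist Ω x1) (B := B) ((bdist_pos_iff hΩ hne x0).1 (hQΩ hx0))
  refine ⟨L, L.2, fun x hx y hy a ha b hb => ?_⟩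
  have := hL.dist_le_mul (bdist Ω x, a) ⟨⟨h0 hx, h1 hx⟩, ha⟩ (bdist Ω y, b) ⟨⟨h0 hy, h1 hy⟩, hb⟩
  rw [Real.dist_eq] at this
  refine this.trans ?_
  gcongr
  rw [Prod.dist_eq]
  have hd : dist (bdist Ω x) (bdist Ω y) ≤ ‖x - y‖ := by
    have := (Metric.lipschitz_infDist_pt Ωᶜ).dist_le_mul x y
    rw [NNReal.coe_one, one_mul, dist_eq_norm x y] at this
    exact this
  have := abs_nonneg (a - b)
  have := norm_nonneg (x - y)
  simp only
  rw [Real.dist_eq a b]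
  exact max_le (by linarith) (by linarith)

end

open Set Metric MeasureTheory Real
noncomputable section
open Filter Topology

/-- (Existence of an `ML`-solution, case `μ < 1/4`.) Let `μ < 1/4`,
`p > 1` and `s < β₋(p-1)+2`. Then there are a positive solution `U` of `(*)` on all of
`Ω`, a constant `c ≥ 1` and `ρ > 0` with `c⁻¹·δ^{β₋} ≤ U ≤ c·δ^{β₋}` on `Ω_ρ`. -/
theorem stmt18 {N : ℕ} (hN : 2 ≤ N) (Ω : Set (EuclideanSpace ℝ (Fin N)))
    (hΩo : IsOpen Ω) (hΩne : Ω.Nonempty) (hΩb : Bornology.IsBounded Ω)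
    (ρ₀ : ℝ) (hρ₀ : GoodCollar Ω ρ₀)
    (d : EuclideanSpace ℝ (Fin N) → ℝ) (c₀ : ℝ) (hd : RegDist Ω d c₀)
    (μ s p : ℝ) (hμ : μ < 1 / 4) (hp : 1 < p)
    (hs : s < (1 / 2 - Real.sqrt (1 / 4 - μ)) * (p - 1) + 2) :
    ∃ U : EuclideanSpace ℝ (Fin N) → ℝ, ∃ c ρ : ℝ,
      ContDiffOn ℝ 2 U Ω ∧ (∀ x ∈ Ω, 0 < U x) ∧
      (∀ x ∈ Ω,
        -(lap U x) - μ / (bdist Ω x) ^ 2 * U x + (U x) ^ p / (bdist Ω x) ^ s = 0) ∧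
      1 ≤ c ∧ 0 < ρ ∧
      ∀ x ∈ collar Ω ρ,
        c⁻¹ * bdist Ω x ^ (1 / 2 - Real.sqrt (1 / 4 - μ)) ≤ U x ∧
        U x ≤ c * bdist Ω x ^ (1 / 2 - Real.sqrt (1 / 4 - μ)) := by
  have hne : Ωᶜ.Nonempty := by
    rw [Set.nonempty_compl]
    rintro rfl
    haveI : Nonempty (Fin N) := ⟨⟨0, by omega⟩⟩
    exact NormedSpace.unbounded_univ ℝ (EuclideanSpace ℝ (Fin N)) hΩb
  set r := Real.sqrt (1 / 4 - μ) with hr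
  have hr0 : 0 < r := Real.sqrt_pos.2 (by linarith)
  have hr2 : r ^ 2 = 1 / 4 - μ := Real.sq_sqrt (by linarith)
  set β := 1 / 2 - r with hβ
  have hβμ : β * (1 - β) = μ := by rw [hβ]; linarith
  obtain ⟨e, he, he1, hκ, hes⟩ : ∃ e, 0 < e ∧ e < 1 ∧ 0 < 1 - 2 * β - e ∧ e ≤ β * (p - 1) + 2 - s := by
    have h1 : 0 < β * (p - 1) + 2 - s := by linarith
    refine ⟨min (1/2) (min r (β * (p - 1) + 2 - s)), by positivity, ?_, ?_, ?_⟩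
    · exact (min_le_left _ _).trans_lt (by norm_num)
    · have := (min_le_right (1/2) (min r (β * (p - 1) + 2 - s))).trans (min_le_left _ _)
      rw [hβ] at this ⊢; linarith
    · exact (min_le_right _ _).trans (min_le_right _ _)
  set κ := 1 - 2 * β - e with hκdef
  obtain ⟨M0, hM0, hlap⟩ : ∃ M0, 0 ≤ M0 ∧ ∀ x ∈ collar Ω ρ₀, |lap (bdist Ω) x| ≤ M0 := by
    obtain ⟨M, hM⟩ := hρ₀.2.2.2
    exact ⟨|M|, abs_nonneg _, fun x hx => (hM x hx).trans (le_abs_self _)⟩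
  have hρ₀p := hρ₀.1
  have dpos (x) (hx : x ∈ Ω) : 0 < bdist Ω x := (bdist_pos_iff hΩo hne x).1 hx
  -- width of the inner collar
  obtain ⟨r1, hr1, hr1s⟩ := small_pow (M0 * (|β| + |β + e|)) (b := 1 - e) (by linarith) (mul_pos he hκ)
  set ρ1 := min r1 (min 1 (ρ₀ / 3)) with hρ1def
  have hρ1 : 0 < ρ1 := by positivity
  have hρ1a : ρ1 ≤ r1 := min_le_left _ _
  have hρ1b : ρ1 ≤ 1 := (min_le_right _ _).trans (min_le_left _ _)
  have hρ1c : ρ1 ≤ ρ₀ / 3 := (min_le_right _ _).trans (min_le_right _ _)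
  -- upper barrier
  set v : EuclideanSpace ℝ (Fin N) → ℝ := fun x => eta β e ρ1 (bdist Ω x) with hv
  obtain ⟨hvC, -⟩ := comp_contDiffOn hΩo hne hρ₀ (g := eta β e ρ1) (fun t ht => eta_contDiffAt β e ρ1 ht)
    (r := 2 * ρ1) (c := 1) (by linarith) (fun t ht => eta_far β e hρ1 ht)
  have hvp (x) (hx : x ∈ Ω) : 0 < v x := eta_pos β e ρ1 (dpos x hx)
  have hvnear (x) (hx : x ∈ Ω) (hx1 : bdist Ω x < ρ1) : lap v x + μ / bdist Ω x ^ 2 * v x ≤ 0 := by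
    have hxc : x ∈ collar Ω ρ₀ := ⟨hx, by linarith⟩
    have ht := dpos x hx
    have ev : v =ᶠ[𝓝 x] fun y => (fun t : ℝ => t ^ β + t ^ (β + e)) (bdist Ω y) := by
      filter_upwards [(isOpen_lt (bdist_cont Ω) continuous_const).mem_nhds hx1] with y hy
      exact eta_near β e hρ1 (le_of_lt hy)
    have hg : ContDiffAt ℝ 2 (fun t : ℝ => t ^ β + t ^ (β + e)) (bdist Ω x) :=
      (Real.contDiffAt_rpow_const (Or.inl ht.ne')).add (Real.contDiffAt_rpow_const (Or.inl ht.ne'))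
    rw [lap_congr ev, lap_bdist hΩo hρ₀ hxc hg, ev.self_of_nhds, ← hβμ]
    exact super_ineq he ht (by linarith) (hlap x hxc) (hr1s _ ht (by linarith))
  obtain ⟨hQ, hQΩ⟩ := deep_compact hΩo hΩb hne hρ1
  set Q := {x | ρ1 ≤ bdist Ω x} with hQdef
  have hdc : ContinuousOn (bdist Ω) Q := (bdist_cont Ω).continuousOn
  have hvQ : ContinuousOn v Q := hvC.continuousOn.mono hQΩ
  obtain ⟨C1, hC1, hC1b⟩ := compact_bound (h := fun x => lap v x + μ / bdist Ω x ^ 2 * v x) hQ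
    (((lap_continuousOn hΩo hvC).mono hQΩ).add
      ((continuousOn_const.div (hdc.pow 2) fun x hx => (pow_pos (dpos x (hQΩ hx)) 2).ne').mul hvQ))
  obtain ⟨C2, hC2, hC2b⟩ := compact_bound (h := fun x => (bdist Ω x ^ s) / (v x) ^ p) hQ
    ((hdc.rpow_const fun x hx => Or.inl (dpos x (hQΩ hx)).ne').div
      (hvQ.rpow_const fun x hx => Or.inl (hvp x (hQΩ hx)).ne')
      fun x hx => (Real.rpow_pos_of_pos (hvp x (hQΩ hx)) p).ne')
  obtain ⟨A, hA1, hAp⟩ : ∃ A : ℝ, 1 ≤ A ∧ C1 * C2 ≤ A ^ (p - 1) := by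
    have h1 := (tendsto_rpow_atTop (by linarith : 0 < p - 1)).eventually (eventually_ge_atTop (C1 * C2))
    exact ((eventually_ge_atTop (1:ℝ)).and h1).exists
  have hA0 : 0 < A := by linarith
  -- lower barrier
  obtain ⟨M, hM, hMa, hMb⟩ : ∃ M, 0 < M ∧ M0 * (|β| + 3) + 1 ≤ 3 * e * κ * M ∧ 1 ≤ M * ρ1 ^ e := by
    have h1 : 0 < ρ1 ^ e := Real.rpow_pos_of_pos hρ1 e
    have h2 : 0 < 3 * e * κ := by positivity
    have h3 : 0 < M0 * (|β| + 3) + 1 := by positivity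
    refine ⟨(M0 * (|β| + 3) + 1) / (3 * e * κ) + 1 / ρ1 ^ e, by positivity, ?_, ?_⟩
    · rw [mul_add (3 * e * κ), mul_div_cancel₀ _ h2.ne']
      have : 0 < 3 * e * κ * (1 / ρ1 ^ e) := by positivity
      linarith
    · rw [add_mul, one_div_mul_cancel h1.ne']
      have : 0 < (M0 * (|β| + 3) + 1) / (3 * e * κ) * ρ1 ^ e := by positivity
      linarith
  have hMt (t : ℝ) (ht : ρ1 ≤ t) : 1 ≤ M * t ^ e :=
    hMb.trans (mul_le_mul_of_nonneg_left (Real.rpow_le_rpow hρ1.le ht he.le) hM.le)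
  have hphi0 (t : ℝ) (ht : ρ1 ≤ t) : phi β e M t = 0 := by
    unfold phi
    rw [qq_zero 2 (by linarith [hMt t ht]), mul_zero]
  set lb : EuclideanSpace ℝ (Fin N) → ℝ := fun x => phi β e M (bdist Ω x) with hlb
  obtain ⟨hlbC, hlbL⟩ := comp_contDiffOn hΩo hne hρ₀ (g := phi β e M) (fun t ht => phi_contDiffAt β e M ht)
    (r := ρ1) (c := 0) (by linarith) hphi0
  have hlb0 (x) (hx : x ∈ Ω) : 0 ≤ lb x := mul_nonneg (Real.rpow_pos_of_pos (dpos x hx) β).le (qq_nonneg _ _)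
  obtain ⟨r2, hr2p, hr2s⟩ := small_pow M he (by norm_num : (0:ℝ) < 1 / 2)
  have hlbl (x) (hx : x ∈ Ω) (hxr : bdist Ω x ≤ r2) : 1 / 8 * bdist Ω x ^ β ≤ lb x := by
    have h1 := hr2s _ (dpos x hx) hxr
    have h2 : (1/2:ℝ) ^ 3 ≤ qq 3 (1 - M * bdist Ω x ^ e) := by
      unfold qq
      exact pow_le_pow_left₀ (by norm_num) (le_max_of_le_left (by linarith)) 3
    have h3 := mul_le_mul_of_nonneg_left h2 (Real.rpow_pos_of_pos (dpos x hx) β).le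
    simp only [hlb, phi]
    norm_num at h3 ⊢
    linarith
  obtain ⟨hK, hKΩ⟩ := deep_compact hΩo hΩb hne hr2p
  obtain ⟨U, hUC, hU⟩ : ∃ U : EuclideanSpace ℝ (Fin N) → ℝ, ContDiffOn ℝ 2 U Ω ∧ ∀ x ∈ Ω, lb x ≤ U x ∧
      U x ≤ A * v x ∧ 0 < U x ∧ -lap U x = μ / bdist Ω x ^ 2 * U x - U x ^ p / bdist Ω x ^ s := by
    refine full_solution (Ω := Ω) hΩo hΩb hne (ub := fun x => A * v x) (lb := lb)
      (f := fun x a => μ / bdist Ω x ^ 2 * a - a ^ p / bdist Ω x ^ s)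
      (contDiffOn_const.mul hvC) hlbC
      (((eta_measurable β e ρ1).comp (bdist_cont Ω).measurable).const_mul A) hlb0
      (fun x hx => ?lt) ?mf (fun x => by simp [Real.zero_rpow (by linarith : p ≠ 0)]) (fun x hx => ?sup) (fun x hx => ?sub)
      (f_lip hΩo hne μ s hp) hK hKΩ (fun x hx hxK => ?pos)
    case mf =>
      have hm : Measurable (fun q : EuclideanSpace ℝ (Fin N) × ℝ => bdist Ω q.1) := (bdist_cont Ω).measurable.comp measurable_fst
      exact ((measurable_const.div (hm.pow_const 2)).mul measurable_snd).sub ((measurable_snd.pow_const p).div (hm.pow_const s))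
    case pos =>
      have h1 : bdist Ω x ≤ r2 := le_of_lt (not_le.1 hxK)
      have := hlbl x hx h1
      have := Real.rpow_pos_of_pos (dpos x hx) β
      linarith
    case lt =>
      rcases lt_or_ge (bdist Ω x) ρ1 with h | h
      · have h1 : v x = bdist Ω x ^ β + bdist Ω x ^ (β + e) := eta_near β e hρ1 h.le
        have h2 := Real.rpow_pos_of_pos (dpos x hx) β
        have h3 := Real.rpow_pos_of_pos (dpos x hx) (β + e)
        have h5 := Real.rpow_pos_of_pos (dpos x hx) e
        have h4 : lb x ≤ bdist Ω x ^ β * 1 :=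
          mul_le_mul_of_nonneg_left (qq_le_one 3 (by nlinarith)) h2.le
        simp only [h1]
        nlinarith
      · have : lb x = 0 := hphi0 _ h
        rw [this]
        exact mul_pos hA0 (hvp x hx)
    case sup =>
      have hvx := hvp x hx
      have hd := dpos x hx
      have e1 : lap (fun x => A * v x) x = A * lap v x := lap_const_mul A (hvC.contDiffAt (hΩo.mem_nhds hx))
      rw [e1, Real.mul_rpow hA0.le hvx.le]
      have hw : 0 < v x ^ p / bdist Ω x ^ s := div_pos (Real.rpow_pos_of_pos hvx p) (Real.rpow_pos_of_pos hd s)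
      have e2 : A ^ p = A * A ^ (p - 1) := by
        rw [← Real.rpow_one_add' hA0.le (by linarith)]; congr 1; ring
      have hAp0 : 0 < A ^ (p - 1) := Real.rpow_pos_of_pos hA0 _
      have key : lap v x + μ / bdist Ω x ^ 2 * v x ≤ A ^ (p - 1) * (v x ^ p / bdist Ω x ^ s) := by
        rcases lt_or_ge (bdist Ω x) ρ1 with h | h
        · exact (hvnear x hx h).trans (by positivity)
        · have k1 := (le_abs_self _).trans (hC1b x h)
          have k2 := (le_abs_self _).trans (hC2b x h)
          rw [← inv_div] at k2
          have k3 : 1 ≤ C2 * (v x ^ p / bdist Ω x ^ s) := by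
            rwa [inv_le_iff_one_le_mul₀ hw] at k2
          have k4 := mul_le_mul_of_nonneg_left k3 hC1
          have k5 := mul_le_mul_of_nonneg_right hAp hw.le
          linarith
      have := mul_le_mul_of_nonneg_left key hA0.le
      rw [e2, mul_div_assoc]
      linarith
    case sub =>
      have hd := dpos x hx
      rcases lt_or_ge (bdist Ω x) ρ₀ with h | h
      · have hxc : x ∈ collar Ω ρ₀ := ⟨hx, h⟩
        have e1 : lap lb x = _ := lap_bdist hΩo hρ₀ hxc (phi_contDiffAt β e M hd)
        rw [e1, ← hβμ]
        refine sub_ineq he he1 hκ hd (hlap x hxc) hp hes hM hMa fun hlt => ?_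
        by_contra hgt
        linarith [hMt (bdist Ω x) (by linarith)]
      · rw [hlbL x h]
        have : lb x = 0 := hphi0 _ (by linarith)
        rw [this, Real.zero_rpow (by linarith)]
        simp
  refine ⟨U, max 8 (2 * A), min r2 ρ1, hUC, fun x hx => (hU x hx).2.2.1, fun x hx => ?_, ?_, by positivity, fun x hx => ?_⟩
  · have := (hU x hx).2.2.2
    linarith
  · exact le_max_of_le_left (by norm_num)
  · obtain ⟨hxΩ, hxd⟩ := hx
    have hd := dpos x hxΩ
    have hb := Real.rpow_pos_of_pos hd β
    obtain ⟨u1, u2, -, -⟩ := hU x hxΩ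
    constructor
    · refine le_trans ?_ ((hlbl x hxΩ (hxd.le.trans (min_le_left _ _))).trans u1)
      gcongr
      rw [one_div]
      exact inv_anti₀ (by norm_num) (le_max_left _ _)
    · refine u2.trans ?_
      have hxr : bdist Ω x ≤ ρ1 := hxd.le.trans (min_le_right _ _)
      have h1 : v x = bdist Ω x ^ β + bdist Ω x ^ (β + e) := eta_near β e hρ1 hxr
      have h2 : bdist Ω x ^ (β + e) ≤ bdist Ω x ^ β :=
        Real.rpow_le_rpow_of_exponent_ge hd (hxr.trans hρ1b) (by linarith)
      simp only [h1]
      calc A * (bdist Ω x ^ β + bdist Ω x ^ (β + e)) ≤ A * (2 * bdist Ω x ^ β) := by gcongr; linarith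
        _ = 2 * A * bdist Ω x ^ β := by ring
        _ ≤ _ := by gcongr; exact le_max_right _ _
end
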